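/- arXiv:2205.00879 — 9 statements merged into one kernel-verified Lean document; each statement's English description precedes it below -/
import Mathlib

section
/- Euler's identity (the infinite form of Gauss' binomial theorem): for every field K and every formal Laurent series α ∈ K((X)), one has ∏_{k=0}^∞ (1 + α X^k) = ∑_{k=0}^∞ α^k X^{k(k−1)/2} (X^k!)^{−1}, an identity in K((X)); both the infinite product and the infinite sum converge in the X-adic topology. -/
open Filter

/-- The indeterminant `X` as a formal Laurent series. -/
noncomputable def LaurentX (K : Type*) [Field K] : LaurentSeries K :=
  HahnSeries.single (1 : ℤ) (1 : K)

namespace Valued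

variable {L Γ₀ : Type*} [Field L] [LinearOrderedCommGroupWithZero Γ₀] [Valued L Γ₀]

theorem nonarchimedeanRing : NonarchimedeanRing L where
  is_nonarchimedean U hU := by
    obtain ⟨γ, hγ⟩ := mem_nhds_zero.mp hU
    exact ⟨⟨(v (R := L)).restrict.ltAddSubgroup γ, isOpen_ball L γ.1⟩, hγ⟩

theorem tendsto_zero_of_eventually_le {ι : Type*} {l : Filter ι} {f g : ι → L}
    (hg : Tendsto g l (nhds 0)) (h : ∀ᶠ i in l, v (f i) ≤ v (g i)) :
    Tendsto f l (nhds 0) := by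
  refine tendsto_iff_forall_eventually_mem.mpr fun U hU ↦ ?_
  obtain ⟨γ, hγ⟩ := mem_nhds_zero.mp hU
  have hball : {x : L | v.restrict x < γ.1} ∈ nhds 0 := mem_nhds_zero.mpr ⟨γ, subset_rfl⟩
  filter_upwards [hg.eventually_mem hball, h] with i hi hle
  exact hγ ((v.restrict_le_iff.mpr hle).trans_lt hi)

theorem isClosed_setOf_le (a : L) : IsClosed {x : L | v x ≤ v a} := by
  simpa only [Valuation.restrict_le_iff] using isClosed_closedBall L (v.restrict a)

theorem tsum_le {f : ℕ → L} {a : L} (hf : Summable f) (h : ∀ n, v (f n) ≤ v a) :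
    v (∑' n, f n) ≤ v a :=
  (isClosed_setOf_le a).mem_of_tendsto hf.hasSum.tendsto_sum_nat
    (Eventually.of_forall fun _ ↦ v.map_sum_le fun n _ ↦ h n)

end Valued

section EulerSeries

open Valued

variable {L Γ₀ : Type*} [Field L] [LinearOrderedCommGroupWithZero Γ₀]

/-- The `k`-th term of Euler's expansion of the infinite product `∏ (1 + a * q ^ k)`. -/
noncomputable def eulerTerm (q a : L) (k : ℕ) : L :=
  a ^ k * q ^ (k * (k - 1) / 2) * (∏ i ∈ Finset.range k, (1 - q ^ (i + 1)))⁻¹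

theorem eulerTerm_zero (q a : L) : eulerTerm q a 0 = 1 := by simp [eulerTerm]

theorem eulerTerm_mul_left (q a : L) (k : ℕ) :
    eulerTerm q (a * q) k = q ^ k * eulerTerm q a k := by
  simp only [eulerTerm]
  ring

theorem eulerTerm_succ (q a : L) (k : ℕ) :
    eulerTerm q a (k + 1) = a * q ^ k * eulerTerm q a k * (1 - q ^ (k + 1))⁻¹ := by
  have hexp : (k + 1) * (k + 1 - 1) / 2 = k * (k - 1) / 2 + k := by
    simpa only [Finset.sum_range_id] using Finset.sum_range_succ (fun i ↦ i) k
  simp only [eulerTerm, hexp, Finset.prod_range_succ, mul_inv]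
  ring

variable [Valued L Γ₀] {q : L}

theorem valuation_one_sub_pow_succ (hq : v q < 1) (k : ℕ) : v (1 - q ^ (k + 1)) = 1 :=
  v.map_one_sub_of_lt (by rw [map_pow]; exact pow_lt_one₀ zero_le hq k.succ_ne_zero)

theorem eulerTerm_succ_sub (hq : v q < 1) (a : L) (k : ℕ) :
    eulerTerm q a (k + 1) - eulerTerm q (a * q) (k + 1) = a * eulerTerm q (a * q) k := by
  have h : 1 - q ^ (k + 1) ≠ 0 :=
    v.ne_zero_iff.mp (by rw [valuation_one_sub_pow_succ hq]; exact one_ne_zero)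
  rw [eulerTerm_mul_left, eulerTerm_mul_left, eulerTerm_succ]
  field_simp

theorem valuation_eulerTerm_succ (hq : v q < 1) (a : L) (k : ℕ) :
    v (eulerTerm q a (k + 1)) = v (a * q ^ k) * v (eulerTerm q a k) := by
  rw [eulerTerm_succ, map_mul, map_inv₀, valuation_one_sub_pow_succ hq, inv_one, mul_one, map_mul]

theorem valuation_eulerTerm_succ_le (hq : v q < 1) {a : L} (ha : v a ≤ 1) (k : ℕ) :
    v (eulerTerm q a (k + 1)) ≤ v a := by
  have hle (k : ℕ) : v (a * q ^ k) ≤ v a := by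
    rw [map_mul, map_pow]
    exact mul_le_of_le_one_right' (pow_le_one₀ zero_le hq.le)
  induction k with
  | zero => simp [valuation_eulerTerm_succ hq, eulerTerm_zero]
  | succ k ih =>
    rw [valuation_eulerTerm_succ hq]
    exact (mul_le_of_le_one_right' (ih.trans ha)).trans (hle _)

theorem tendsto_const_mul_pow_zero (hq0 : Tendsto (fun n : ℕ ↦ q ^ n) atTop (nhds 0)) (a : L) :
    Tendsto (fun n : ℕ ↦ a * q ^ n) atTop (nhds 0) := by
  simpa using hq0.const_mul a

theorem eventually_valuation_mul_pow_le_one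
    (hq0 : Tendsto (fun n : ℕ ↦ q ^ n) atTop (nhds 0)) (a : L) :
    ∀ᶠ n in atTop, v (a * q ^ n) ≤ 1 :=
  tendsto_const_mul_pow_zero hq0 a ((isOpen_integer L).mem_nhds (zero_mem _))

theorem tendsto_eulerTerm (hq : v q < 1) (hq0 : Tendsto (fun n : ℕ ↦ q ^ n) atTop (nhds 0))
    (a : L) : Tendsto (eulerTerm q a) atTop (nhds 0) := by
  obtain ⟨m, hm⟩ := (eventually_valuation_mul_pow_le_one hq0 a).exists
  rw [← tendsto_add_atTop_iff_nat (m + 1)]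
  refine tendsto_zero_of_eventually_le
    (tendsto_const_mul_pow_zero hq0 (eulerTerm q a (m + 1))) (Eventually.of_forall fun j ↦ ?_)
  induction j with
  | zero => simp
  | succ j ih =>
    have hstep : v (a * q ^ (j + (m + 1))) ≤ v q := by
      rw [show a * q ^ (j + (m + 1)) = a * q ^ m * q ^ j * q by ring, map_mul, map_mul _ _ (q ^ j),
        map_pow]
      exact mul_le_of_le_one_left' (mul_le_one' hm (pow_le_one₀ zero_le hq.le))
    rw [add_right_comm, valuation_eulerTerm_succ hq, pow_succ', mul_left_comm, map_mul v q]
    exact mul_le_mul' hstep ih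

theorem summable_eulerTerm [CompleteSpace L] (hq : v q < 1)
    (hq0 : Tendsto (fun n : ℕ ↦ q ^ n) atTop (nhds 0)) (a : L) : Summable (eulerTerm q a) := by
  have : NonarchimedeanRing L := nonarchimedeanRing
  apply NonarchimedeanAddGroup.summable_of_tendsto_cofinite_zero
  rw [Nat.cofinite_eq_atTop]
  exact tendsto_eulerTerm hq hq0 a

theorem tsum_eulerTerm_eq_one_add_mul [CompleteSpace L] (hq : v q < 1)
    (hq0 : Tendsto (fun n : ℕ ↦ q ^ n) atTop (nhds 0)) (a : L) :
    ∑' k, eulerTerm q a k = (1 + a) * ∑' k, eulerTerm q (a * q) k := by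
  have ha := summable_eulerTerm hq hq0 a
  have haq := summable_eulerTerm hq hq0 (a * q)
  have hdiff := ((summable_nat_add_iff 1).mpr ha).tsum_sub ((summable_nat_add_iff 1).mpr haq)
  simp only [eulerTerm_succ_sub hq, tsum_mul_left] at hdiff
  have h₁ := ha.tsum_eq_zero_add
  have h₂ := haq.tsum_eq_zero_add
  rw [eulerTerm_zero] at h₁ h₂
  linear_combination h₁ - h₂ - hdiff

theorem tsum_eulerTerm_eq_prod_mul [CompleteSpace L] (hq : v q < 1)
    (hq0 : Tendsto (fun n : ℕ ↦ q ^ n) atTop (nhds 0)) (a : L) (N : ℕ) :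
    ∑' k, eulerTerm q a k =
      (∏ k ∈ Finset.range N, (1 + a * q ^ k)) * ∑' k, eulerTerm q (a * q ^ N) k := by
  induction N with
  | zero => simp
  | succ N ih =>
    rw [ih, tsum_eulerTerm_eq_one_add_mul hq hq0 (a * q ^ N), Finset.prod_range_succ,
      mul_assoc a, ← pow_succ, mul_assoc]

theorem tendsto_tsum_eulerTerm_mul_pow [CompleteSpace L] (hq : v q < 1)
    (hq0 : Tendsto (fun n : ℕ ↦ q ^ n) atTop (nhds 0)) (a : L) :
    Tendsto (fun N ↦ ∑' k, eulerTerm q (a * q ^ N) k) atTop (nhds 1) := by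
  have htail : Tendsto (fun N ↦ ∑' k, eulerTerm q (a * q ^ N) (k + 1)) atTop (nhds 0) := by
    refine tendsto_zero_of_eventually_le (tendsto_const_mul_pow_zero hq0 a) ?_
    filter_upwards [eventually_valuation_mul_pow_le_one hq0 a] with N hN
    exact tsum_le ((summable_nat_add_iff 1).mpr (summable_eulerTerm hq hq0 _))
      (valuation_eulerTerm_succ_le hq hN)
  simpa [(summable_eulerTerm hq hq0 _).tsum_eq_zero_add, eulerTerm_zero] using htail.const_add 1

theorem tendsto_prod_one_add_mul_pow [CompleteSpace L] (hq : v q < 1)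
    (hq0 : Tendsto (fun n : ℕ ↦ q ^ n) atTop (nhds 0)) (a : L) :
    Tendsto (fun N ↦ ∏ k ∈ Finset.range N, (1 + a * q ^ k)) atTop
      (nhds (∑' k, eulerTerm q a k)) := by
  have hlim := tendsto_tsum_eulerTerm_mul_pow hq hq0 a
  have hdiv := (tendsto_const_nhds (x := ∑' k, eulerTerm q a k)).div hlim one_ne_zero
  rw [div_one] at hdiv
  refine hdiv.congr' ?_
  filter_upwards [hlim.eventually_ne one_ne_zero] with N hN
  exact (eq_div_of_mul_eq hN (tsum_eulerTerm_eq_prod_mul hq hq0 a N).symm).symm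

end EulerSeries

theorem LaurentX.valuation_lt_one (K : Type*) [Field K] : Valued.v (LaurentX K) < 1 := by
  rw [LaurentX, LaurentSeries.valuation_single_zpow, ← WithZero.exp_zero, WithZero.exp_lt_exp]
  norm_num

theorem LaurentX.tendsto_pow_zero (K : Type*) [Field K] :
    Tendsto (fun n : ℕ ↦ LaurentX K ^ n) atTop (nhds 0) := by
  refine tendsto_iff_forall_eventually_mem.mpr fun U hU ↦ ?_
  obtain ⟨γ, hγ⟩ := Valued.mem_nhds_zero.mp hU
  obtain ⟨n, hn⟩ := exists_pow_lt₀ (LaurentX.valuation_lt_one K)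
    (Units.map (MonoidWithZeroHom.ValueGroup₀.embedding
      (f := .ofClass (Valued.v (R := LaurentSeries K)))) γ)
  filter_upwards [eventually_ge_atTop n] with N hN
  refine hγ (Valued.v.restrict_lt_iff_lt_embedding.mpr ?_)
  rw [map_pow]
  exact (pow_le_pow_right_of_le_one' (LaurentX.valuation_lt_one K).le hN).trans_lt hn

/-- **Euler's identity** (the infinite form of Gauss' binomial theorem): for every field `K`
and every formal Laurent series `α`,
`∏_{k=0}^∞ (1 + α X^k) = ∑_{k=0}^∞ α^k X^{k(k−1)/2} (X^k!)⁻¹` in `K((X))`, where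
`X^k! = (1 − X)⋯(1 − X^k)`; both sides converge in the `X`-adic topology. -/
theorem euler_infinite_gauss_binomial (K : Type*) [Field K] (α : LaurentSeries K) :
    ∃ S : LaurentSeries K,
      Tendsto (fun N : ℕ => ∏ k ∈ Finset.range N, (1 + α * LaurentX K ^ k))
        atTop (nhds S) ∧
      Tendsto (fun N : ℕ => ∑ k ∈ Finset.range N,
          α ^ k * LaurentX K ^ (k * (k - 1) / 2) *
            (∏ i ∈ Finset.range k, (1 - LaurentX K ^ (i + 1)))⁻¹)
        atTop (nhds S) := by
  have hq := LaurentX.valuation_lt_one K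
  have hq0 := LaurentX.tendsto_pow_zero K
  exact ⟨∑' k, eulerTerm (LaurentX K) α k, tendsto_prod_one_add_mul_pow hq hq0 α,
    (summable_eulerTerm hq hq0 α).hasSum.tendsto_sum_nat⟩
end

section
/- For every field K and every formal power series α ∈ K[[X]], one has ∏_{k=1}^∞ (1 − α X^k)^{−1} = ∑_{k=0}^∞ α^k X^k (X^k!)^{−1}, an identity in K[[X]]; each factor 1 − αX^k has constant term 1 and is therefore invertible, and the infinite product and the infinite sum converge in the X-adic topology. -/
open PowerSeries Filter

/-- The product (coefficientwise) topology on formal power series; with discrete coefficients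
this is exactly the `X`-adic topology for convergence purposes: a sequence converges iff for
every `n` the sequence of `n`-th coefficients is eventually constant. -/
noncomputable instance powerSeriesTopology (R : Type*) [TopologicalSpace R] :
    TopologicalSpace (PowerSeries R) :=
  inferInstanceAs (TopologicalSpace ((Unit →₀ ℕ) → R))

/-- Partial sums of the series `∑ α^k X^k (X^k!)⁻¹`. -/
noncomputable def eulerPartialSum {K : Type*} [Field K] (α : PowerSeries K) (N : ℕ) :
    PowerSeries K :=
  ∑ k ∈ Finset.range N, α ^ k * (X : PowerSeries K) ^ k *
    (∏ i ∈ Finset.range k, (1 - (X : PowerSeries K) ^ (i + 1)))⁻¹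

section

variable {K : Type*} [Field K]

theorem eulerPartialSum_succ (α : PowerSeries K) (N : ℕ) :
    eulerPartialSum α (N + 1) = eulerPartialSum α N + α ^ N * (X : PowerSeries K) ^ N *
      (∏ i ∈ Finset.range N, (1 - (X : PowerSeries K) ^ (i + 1)))⁻¹ :=
  Finset.sum_range_succ _ _

theorem X_pow_dvd_eulerPartialSum_succ_sub (α : PowerSeries K) (N : ℕ) :
    (X : PowerSeries K) ^ N ∣ eulerPartialSum α (N + 1) - eulerPartialSum α N := by
  rw [eulerPartialSum_succ, add_sub_cancel_left]
  exact ((dvd_refl _).mul_left _).mul_right _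

theorem X_pow_dvd_eulerPartialSum_sub (α : PowerSeries K) {M N : ℕ} (h : M ≤ N) :
    (X : PowerSeries K) ^ M ∣ eulerPartialSum α N - eulerPartialSum α M := by
  induction N, h using Nat.le_induction with
  | base => simp
  | succ N h ih =>
    have := ((pow_dvd_pow X h).trans (X_pow_dvd_eulerPartialSum_succ_sub α N)).add ih
    simpa using this

theorem inv_prod_one_sub_X_pow_succ_mul (k : ℕ) :
    (∏ i ∈ Finset.range (k + 1), (1 - (X : PowerSeries K) ^ (i + 1)))⁻¹ *
      (1 - (X : PowerSeries K) ^ (k + 1)) =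
    (∏ i ∈ Finset.range k, (1 - (X : PowerSeries K) ^ (i + 1)))⁻¹ := by
  rw [Finset.prod_range_succ, PowerSeries.mul_inv_rev, mul_right_comm,
    PowerSeries.inv_mul_cancel _ (by simp), one_mul]

/-- The functional equation of the truncated series under `α ↦ α X`. -/
theorem eulerPartialSum_succ_sub_mul_X (α : PowerSeries K) (N : ℕ) :
    eulerPartialSum α (N + 1) - eulerPartialSum (α * X) (N + 1) =
      α * X * eulerPartialSum α N := by
  induction N with
  | zero => simp [eulerPartialSum]
  | succ N ih =>
    rw [eulerPartialSum_succ _ (N + 1), eulerPartialSum_succ _ (N + 1)]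
    linear_combination ih - α * X * eulerPartialSum_succ α N +
      α ^ (N + 1) * X ^ (N + 1) * inv_prod_one_sub_X_pow_succ_mul (K := K) N

theorem X_pow_dvd_eulerPartialSum_mul_sub (α : PowerSeries K) (M : ℕ) :
    (X : PowerSeries K) ^ M ∣
      eulerPartialSum α M * (1 - α * X) - eulerPartialSum (α * X) M := by
  have h := (X_pow_dvd_eulerPartialSum_succ_sub (α * X) M).sub
    (X_pow_dvd_eulerPartialSum_succ_sub α M)
  convert h using 1
  linear_combination eulerPartialSum_succ_sub_mul_X α M

theorem X_pow_dvd_eulerPartialSum_mul_prod_sub (α : PowerSeries K) (M N : ℕ) :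
    (X : PowerSeries K) ^ M ∣
      eulerPartialSum α M * ∏ k ∈ Finset.range N, (1 - α * (X : PowerSeries K) ^ (k + 1)) -
        eulerPartialSum (α * X ^ N) M := by
  induction N with
  | zero => simp
  | succ N ih =>
    have h := (ih.mul_right (1 - α * X ^ (N + 1))).add
      (X_pow_dvd_eulerPartialSum_mul_sub (α * X ^ N) M)
    rw [Finset.prod_range_succ]
    convert h using 1
    rw [mul_assoc α, ← pow_succ]
    ring

theorem X_pow_dvd_eulerPartialSum_mul_X_pow_sub_one (α : PowerSeries K) (N : ℕ) :
    (X : PowerSeries K) ^ N ∣ eulerPartialSum (α * X ^ N) N - 1 := by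
  cases N with
  | zero => simp
  | succ N =>
    rw [eulerPartialSum, Finset.sum_range_succ']
    simp only [pow_zero, Finset.range_zero, Finset.prod_empty, mul_one,
      inv_one, add_sub_cancel_right]
    refine Finset.dvd_sum fun k _ => Dvd.dvd.mul_right (Dvd.dvd.mul_right ?_ _) _
    exact (Dvd.intro_left α rfl).trans (dvd_pow_self _ k.succ_ne_zero)

theorem X_pow_dvd_prod_inv_sub_eulerPartialSum (α : PowerSeries K) (N : ℕ) :
    (X : PowerSeries K) ^ N ∣
      ∏ k ∈ Finset.range N, (1 - α * (X : PowerSeries K) ^ (k + 1))⁻¹ - eulerPartialSum α N := by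
  have h := ((X_pow_dvd_eulerPartialSum_mul_prod_sub α N N).add
    (X_pow_dvd_eulerPartialSum_mul_X_pow_sub_one α N)).mul_right
      (∏ k ∈ Finset.range N, (1 - α * (X : PowerSeries K) ^ (k + 1))⁻¹)
  have hinv : (∏ k ∈ Finset.range N, (1 - α * (X : PowerSeries K) ^ (k + 1))) *
      ∏ k ∈ Finset.range N, (1 - α * (X : PowerSeries K) ^ (k + 1))⁻¹ = 1 := by
    rw [← Finset.prod_mul_distrib]
    exact Finset.prod_eq_one fun k _ => PowerSeries.mul_inv_cancel _ (by simp)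
  rw [← dvd_neg]
  convert h using 1
  linear_combination -eulerPartialSum α N * hinv

theorem tendsto_of_X_pow_dvd_sub [TopologicalSpace K] {f : ℕ → PowerSeries K}
    {S : PowerSeries K} (h : ∀ N, (X : PowerSeries K) ^ N ∣ f N - S) :
    Tendsto f atTop (nhds S) := by
  refine (PowerSeries.WithPiTopology.tendsto_iff_coeff_tendsto K f atTop S).2 fun d => ?_
  refine tendsto_const_nhds.congr' ?_
  filter_upwards [eventually_gt_atTop d] with N hN
  have := X_pow_dvd_iff.1 (h N) d hN
  rw [map_sub, sub_eq_zero] at this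
  exact this.symm

theorem X_pow_dvd_eulerPartialSum_sub_mk (α : PowerSeries K) (N : ℕ) :
    (X : PowerSeries K) ^ N ∣
      eulerPartialSum α N - PowerSeries.mk fun n => coeff n (eulerPartialSum α (n + 1)) := by
  refine X_pow_dvd_iff.2 fun d hd => ?_
  have := X_pow_dvd_iff.1 (X_pow_dvd_eulerPartialSum_sub α (Nat.succ_le_of_lt hd)) d
    d.lt_succ_self
  rwa [map_sub, coeff_mk, ← map_sub]

end

/-- For every field `K` and every `α ∈ K⟦X⟧`, one has
`∏_{k=1}^∞ (1 − α X^k)⁻¹ = ∑_{k=0}^∞ α^k X^k (X^k!)⁻¹` in `K⟦X⟧`, where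
`X^k! = (1 − X)⋯(1 − X^k)`; both sides converge in the `X`-adic topology. -/
theorem euler_dual_identity (K : Type*) [Field K] [TopologicalSpace K] [DiscreteTopology K]
    (α : PowerSeries K) :
    ∃ S : PowerSeries K,
      Tendsto (fun N : ℕ => ∏ k ∈ Finset.range N, (1 - α * (X : PowerSeries K) ^ (k + 1))⁻¹)
        atTop (nhds S) ∧
      Tendsto (fun N : ℕ => ∑ k ∈ Finset.range N,
          α ^ k * (X : PowerSeries K) ^ k *
            (∏ i ∈ Finset.range k, (1 - (X : PowerSeries K) ^ (i + 1)))⁻¹)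
        atTop (nhds S) := by
  refine ⟨PowerSeries.mk fun n => coeff n (eulerPartialSum α (n + 1)),
    tendsto_of_X_pow_dvd_sub fun N => ?_,
    tendsto_of_X_pow_dvd_sub (X_pow_dvd_eulerPartialSum_sub_mk α)⟩
  simpa using (X_pow_dvd_prod_inv_sub_eulerPartialSum α N).add
    (X_pow_dvd_eulerPartialSum_sub_mk α N)
end

section
/- Jacobi's triple product identity: for every field K and every nonzero formal Laurent series α ∈ K((X)), one has ∏_{k=1}^∞ (1 − X^{2k})(1 + α X^{2k−1})(1 + α^{−1} X^{2k−1}) = ∑_{k=−∞}^∞ α^k X^{k²}, an identity in K((X)), where the right-hand side is the sum over all k ∈ ℤ; both sides converge in the X-adic topology. -/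
open Filter

open WithZero

section Algebra

variable {F : Type*} [Field F]

/-- The finite Euler product `∏_{k=1}^n (1 - q^{2k})`. -/
def eulerProd (q : F) (n : ℕ) : F := ∏ k ∈ Finset.range n, (1 - q ^ (2 * (k + 1)))

/-- The Gaussian binomial coefficient with base `q ^ 2`. -/
def gaussChoose (q : F) : ℕ → ℕ → F
  | _, 0 => 1
  | 0, _ + 1 => 0
  | n + 1, k + 1 => gaussChoose q n k + q ^ (2 * (k + 1)) * gaussChoose q n (k + 1)

@[simp]
theorem gaussChoose_zero_right (q : F) (n : ℕ) : gaussChoose q n 0 = 1 := by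
  cases n <;> rfl

theorem gaussChoose_succ_succ (q : F) (n k : ℕ) :
    gaussChoose q (n + 1) (k + 1) =
      gaussChoose q n k + q ^ (2 * (k + 1)) * gaussChoose q n (k + 1) := rfl

theorem gaussChoose_eq_zero_of_lt (q : F) {n k : ℕ} (h : n < k) : gaussChoose q n k = 0 := by
  induction n generalizing k with
  | zero => cases k with
    | zero => omega
    | succ k => rfl
  | succ n ih => cases k with
    | zero => omega
    | succ k => rw [gaussChoose_succ_succ, ih (by omega), ih (by omega)]; simp

theorem gaussChoose_self (q : F) (n : ℕ) : gaussChoose q n n = 1 := by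
  induction n with
  | zero => rfl
  | succ n ih => rw [gaussChoose_succ_succ, ih, gaussChoose_eq_zero_of_lt q n.lt_succ_self]; simp

theorem eulerProd_succ (q : F) (n : ℕ) :
    eulerProd q (n + 1) = eulerProd q n * (1 - q ^ (2 * (n + 1))) :=
  Finset.prod_range_succ _ _

theorem gaussChoose_mul_eulerProd (q : F) (k m : ℕ) :
    gaussChoose q (k + m) k * (eulerProd q k * eulerProd q m) = eulerProd q (k + m) := by
  induction k generalizing m with
  | zero => simp [eulerProd]
  | succ k ihk =>
    induction m with
    | zero => simp [gaussChoose_self, eulerProd]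
    | succ m ihm =>
      have h1 := ihk (m + 1)
      rw [show k + 1 + m = k + (m + 1) by ring] at ihm
      rw [show k + 1 + (m + 1) = k + (m + 1) + 1 by ring, gaussChoose_succ_succ,
        eulerProd_succ q (k + (m + 1))]
      rw [eulerProd_succ] at h1 ihm ⊢
      rw [eulerProd_succ q m]
      linear_combination (1 - q ^ (2 * (k + 1))) * h1 +
        q ^ (2 * (k + 1)) * (1 - q ^ (2 * (m + 1))) * ihm

/-- The finite `q`-binomial theorem. -/
theorem prod_one_add_mul_pow_odd (q x : F) (n : ℕ) :
    ∏ k ∈ Finset.range n, (1 + x * q ^ (2 * k + 1)) =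
      ∑ k ∈ Finset.range (n + 1), gaussChoose q n k * q ^ (k ^ 2) * x ^ k := by
  induction n generalizing x with
  | zero => simp
  | succ n ih =>
    have hshift : ∏ k ∈ Finset.range n, (1 + x * q ^ (2 * (k + 1) + 1)) =
        ∑ k ∈ Finset.range (n + 1), gaussChoose q n k * q ^ (k ^ 2) * (x * q ^ 2) ^ k := by
      rw [← ih]
      exact Finset.prod_congr rfl fun k _ => by ring
    have hsplit : ∑ k ∈ Finset.range (n + 1), gaussChoose q n k * q ^ (k ^ 2) * (x * q ^ 2) ^ k =
        ∑ k ∈ Finset.range (n + 1),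
          gaussChoose q n (k + 1) * q ^ ((k + 1) ^ 2) * (x * q ^ 2) ^ (k + 1) + 1 := by
      have h := Finset.sum_range_succ
        (fun k => gaussChoose q n k * q ^ (k ^ 2) * (x * q ^ 2) ^ k) (n + 1)
      rw [Finset.sum_range_succ', gaussChoose_eq_zero_of_lt q n.lt_succ_self] at h
      simpa using h.symm
    rw [Finset.prod_range_succ', hshift, Finset.sum_range_succ' _ (n + 1), mul_add,
      mul_one]
    nth_rewrite 1 [hsplit]
    rw [add_right_comm, Finset.sum_mul, ← Finset.sum_add_distrib]
    congr 1
    · refine Finset.sum_congr rfl fun k _ => ?_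
      rw [gaussChoose_succ_succ]
      ring
    · simp

theorem prod_one_add_zpow_odd {q α : F} (hq : q ≠ 0) (hα : α ≠ 0) (N : ℕ) :
    ∏ k ∈ Finset.range N, (1 + α * q ^ (-(2 * k + 1) : ℤ)) =
      α ^ N * q ^ (-(N : ℤ) ^ 2) * ∏ k ∈ Finset.range N, (1 + α⁻¹ * q ^ (2 * k + 1)) := by
  induction N with
  | zero => simp
  | succ N ih =>
    have h : -((N + 1 : ℕ) : ℤ) ^ 2 = -(N : ℤ) ^ 2 + -(2 * N + 1) := by push_cast; ring
    rw [Finset.prod_range_succ, Finset.prod_range_succ, ih, h, zpow_add₀ hq]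
    have h2 : q ^ (-(2 * N + 1) : ℤ) * q ^ (2 * N + 1) = 1 := by
      rw [← zpow_natCast, ← zpow_add₀ hq]
      simp
    have h3 : 1 + α * q ^ (-(2 * N + 1) : ℤ) =
        α * q ^ (-(2 * N + 1) : ℤ) * (1 + α⁻¹ * q ^ (2 * N + 1)) := by
      field_simp
      linear_combination -h2
    rw [h3]
    ring

/-- The finite form of the triple product identity (without the Euler factor). -/
theorem prod_mul_prod_eq_sum_gaussChoose {q α : F} (hq : q ≠ 0) (hα : α ≠ 0) (N : ℕ) :
    ∏ k ∈ Finset.range N, ((1 + α * q ^ (2 * k + 1)) * (1 + α⁻¹ * q ^ (2 * k + 1))) =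
      ∑ k ∈ Finset.range (2 * N + 1),
        gaussChoose q (2 * N) k * (α ^ ((k : ℤ) - N) * q ^ (((k : ℤ) - N) ^ 2)) := by
  have key := prod_one_add_mul_pow_odd q (α * q ^ (-(2 * N) : ℤ)) (2 * N)
  have hlow : ∏ k ∈ Finset.range N, (1 + α * q ^ (-(2 * N) : ℤ) * q ^ (2 * k + 1)) =
      ∏ k ∈ Finset.range N, (1 + α * q ^ (-(2 * k + 1) : ℤ)) := by
    rw [← Finset.prod_range_reflect]
    refine Finset.prod_congr rfl fun k hk => ?_
    have hk' : k < N := Finset.mem_range.1 hk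
    rw [mul_assoc, ← zpow_natCast q, ← zpow_add₀ hq]
    congr 3
    omega
  have hhigh : ∏ k ∈ Finset.range N, (1 + α * q ^ (-(2 * N) : ℤ) * q ^ (2 * (N + k) + 1)) =
      ∏ k ∈ Finset.range N, (1 + α * q ^ (2 * k + 1)) := by
    refine Finset.prod_congr rfl fun k _ => ?_
    rw [mul_assoc, ← zpow_natCast q, ← zpow_natCast q, ← zpow_add₀ hq]
    congr 3
    push_cast
    ring
  rw [two_mul N, Finset.prod_range_add, ← two_mul N, hlow, hhigh,
    prod_one_add_zpow_odd hq hα] at key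
  have hc : α ^ N * q ^ (-(N : ℤ) ^ 2) ≠ 0 := mul_ne_zero (pow_ne_zero _ hα) (zpow_ne_zero _ hq)
  refine mul_left_cancel₀ hc ?_
  rw [Finset.prod_mul_distrib, Finset.mul_sum]
  refine Eq.trans (by ring) (key.trans (Finset.sum_congr rfl fun k _ => ?_))
  have h1 : α ^ k = α ^ N * α ^ ((k : ℤ) - N) := by
    rw [← zpow_natCast, ← zpow_natCast, ← zpow_add₀ hα]
    congr 1
    ring
  have h2 : q ^ (k ^ 2) * (q ^ (-(2 * N) : ℤ)) ^ k =
      q ^ (-(N : ℤ) ^ 2) * q ^ (((k : ℤ) - N) ^ 2) := by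
    rw [← zpow_natCast, ← zpow_natCast, ← zpow_mul, ← zpow_add₀ hq, ← zpow_add₀ hq]
    congr 1
    push_cast
    ring
  rw [mul_pow, h1]
  linear_combination gaussChoose q (2 * N) k * α ^ N * α ^ ((k : ℤ) - N) * h2

/-- The finite form of Jacobi's triple product identity. -/
theorem prod_triple_eq_sum_gaussChoose {q α : F} (hq : q ≠ 0) (hα : α ≠ 0) (N : ℕ) :
    ∏ k ∈ Finset.range N, ((1 - q ^ (2 * (k + 1))) * (1 + α * q ^ (2 * k + 1)) *
        (1 + α⁻¹ * q ^ (2 * k + 1))) =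
      ∑ k ∈ Finset.range (2 * N + 1), eulerProd q N * gaussChoose q (2 * N) k *
        (α ^ ((k : ℤ) - N) * q ^ (((k : ℤ) - N) ^ 2)) := by
  simp_rw [mul_assoc, ← Finset.mul_sum]
  rw [← prod_mul_prod_eq_sum_gaussChoose hq hα, eulerProd, ← Finset.prod_mul_distrib]

theorem sum_Icc_neg_eq_sum_range (f : ℤ → F) (N : ℕ) :
    ∑ j ∈ Finset.Icc (-(N : ℤ)) N, f j = ∑ k ∈ Finset.range (2 * N + 1), f ((k : ℤ) - N) := by
  symm
  refine Finset.sum_nbij' (fun k => (k : ℤ) - N) (fun j => (j + N).toNat) ?_ ?_ ?_ ?_ ?_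
  · intro k hk
    simp only [Finset.mem_range, Finset.mem_Icc] at *
    omega
  · intro k hk
    simp only [Finset.mem_range, Finset.mem_Icc] at *
    omega
  · intro k _
    simp
  · intro j hj
    simp only [Finset.mem_Icc] at hj
    omega
  · intro k _
    rfl

end Algebra

section Valuation

variable {F : Type*} [Field F] {v : Valuation F ℤᵐ⁰} {q : F}

theorem valuation_one_sub_pow (hq : v q = exp (-1)) (k : ℕ) :
    v (1 - q ^ (2 * (k + 1))) = 1 := by
  apply Valuation.map_one_sub_of_lt
  rw [map_pow, hq, ← exp_nsmul, ← exp_zero, exp_lt_exp, nsmul_eq_mul]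
  push_cast
  linarith

theorem valuation_eulerProd (hq : v q = exp (-1)) (n : ℕ) : v (eulerProd q n) = 1 := by
  rw [eulerProd, map_prod]
  exact Finset.prod_eq_one fun k _ => valuation_one_sub_pow hq k

theorem valuation_eulerProd_sub_le (hq : v q = exp (-1)) {m n : ℕ} (h : m ≤ n) :
    v (eulerProd q n - eulerProd q m) ≤ exp (-(2 * m) : ℤ) := by
  induction n, h using Nat.le_induction with
  | base => simp
  | succ n h ih =>
    have e : eulerProd q (n + 1) - eulerProd q m =
        (eulerProd q n - eulerProd q m) - eulerProd q n * q ^ (2 * (n + 1)) := by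
      rw [eulerProd_succ]; ring
    rw [e]
    refine v.map_sub_le ih ?_
    rw [map_mul, valuation_eulerProd hq, one_mul, map_pow, hq, ← exp_nsmul, exp_le_exp,
      nsmul_eq_mul]
    push_cast
    omega

theorem valuation_eulerProd_mul_gaussChoose_sub_one_le (hq : v q = exp (-1)) {N k m : ℕ}
    (hk : m ≤ k) (hkN : k + m ≤ 2 * N) :
    v (eulerProd q N * gaussChoose q (2 * N) k - 1) ≤ exp (-(2 * m) : ℤ) := by
  obtain ⟨l, hl⟩ := Nat.exists_eq_add_of_le (show k ≤ 2 * N by omega)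
  have hB := gaussChoose_mul_eulerProd q k l
  rw [← hl] at hB
  have hdiff : ∀ {a b : ℕ}, m ≤ a → m ≤ b →
      v (eulerProd q a - eulerProd q b) ≤ exp (-(2 * m) : ℤ) := fun {a b} ha hb => by
    rw [← sub_sub_sub_cancel_right _ _ (eulerProd q m)]
    exact v.map_sub_le (valuation_eulerProd_sub_le hq ha) (valuation_eulerProd_sub_le hq hb)
  have e : (eulerProd q N * gaussChoose q (2 * N) k - 1) * (eulerProd q k * eulerProd q l) =
      eulerProd q (2 * N) * (eulerProd q N - eulerProd q k) +
        eulerProd q k * (eulerProd q (2 * N) - eulerProd q l) := by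
    linear_combination eulerProd q N * hB
  have hv := congrArg v e
  rw [map_mul, map_mul, valuation_eulerProd hq, valuation_eulerProd hq, mul_one, mul_one] at hv
  rw [hv]
  refine v.map_add_le ?_ ?_ <;> rw [map_mul, valuation_eulerProd hq, one_mul] <;>
    exact hdiff (by omega) (by omega)

theorem valuation_zpow_mul_zpow_sq {α : F} {a : ℤ} (hq : v q = exp (-1)) (hα : v α = exp a)
    (j : ℤ) : v (α ^ j * q ^ (j ^ 2)) = exp (a * j - j ^ 2) := by
  rw [map_mul, map_zpow₀, map_zpow₀, hq, hα, ← exp_zsmul, ← exp_zsmul, ← exp_add]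
  congr 1
  simp only [smul_eq_mul]
  ring

theorem valuation_prod_triple_sub_sum_le {α : F} {a : ℤ} (hq : v q = exp (-1))
    (hα : v α = exp a) (N : ℕ) :
    v (∏ k ∈ Finset.range N, ((1 - q ^ (2 * (k + 1))) * (1 + α * q ^ (2 * k + 1)) *
        (1 + α⁻¹ * q ^ (2 * k + 1))) -
      ∑ j ∈ Finset.Icc (-(N : ℤ)) N, α ^ j * q ^ (j ^ 2)) ≤ exp ((|a| + 2) ^ 2 - 2 * N) := by
  have hq0 : q ≠ 0 := by rintro rfl; exact exp_ne_zero (hq.symm.trans v.map_zero)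
  have hα0 : α ≠ 0 := by rintro rfl; exact exp_ne_zero (hα.symm.trans v.map_zero)
  rw [prod_triple_eq_sum_gaussChoose hq0 hα0, sum_Icc_neg_eq_sum_range, ← Finset.sum_sub_distrib]
  refine v.map_sum_le fun k hk => ?_
  rw [← sub_one_mul, map_mul, valuation_zpow_mul_zpow_sq hq hα]
  have hk' : k < 2 * N + 1 := Finset.mem_range.1 hk
  set j : ℤ := (k : ℤ) - N with hj
  have hm : ((N - j.natAbs : ℕ) : ℤ) = N - |j| := by
    rw [Int.abs_eq_natAbs]
    omega
  refine (mul_le_mul_left (valuation_eulerProd_mul_gaussChoose_sub_one_le hq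
    (m := N - j.natAbs) (by omega) (by omega)) _).trans ?_
  rw [← exp_add, exp_le_exp, hm]
  have h1 : a * j ≤ |a| * |j| := (le_abs_self _).trans (abs_mul a j).le
  nlinarith [sq_abs j, abs_nonneg a, abs_nonneg j, sq_nonneg (|a| + 2 - |j|),
    mul_nonneg (abs_nonneg a) (abs_nonneg j)]

end Valuation

section Topology

variable (K : Type*) [Field K]

theorem valuation_LaurentX : Valued.v (LaurentX K) = (exp (-1) : ℤᵐ⁰) :=
  LaurentSeries.valuation_single_zpow K 1

instance LaurentSeries.nonarchimedeanAddGroup : NonarchimedeanAddGroup (LaurentSeries K) where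
  is_nonarchimedean U hU := by
    obtain ⟨γ, hγ⟩ := Valued.mem_nhds_zero.1 hU
    exact ⟨⟨Valued.v.restrict.ltAddSubgroup γ, Valued.isOpen_ball _ _⟩, hγ⟩

variable {K}

theorem LaurentSeries.tendsto_zero_of_valuation_le {ι : Type*} {l : Filter ι}
    {f : ι → LaurentSeries K}
    (h : ∀ n : ℤ, ∀ᶠ i in l, Valued.v (f i) ≤ (exp (-n) : ℤᵐ⁰)) : Tendsto f l (nhds 0) := by
  intro U hU
  obtain ⟨γ, hγ⟩ := Valued.mem_nhds_zero.1 hU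
  set D := -(log (MonoidWithZeroHom.ValueGroup₀.embedding γ.1) - 1) with hD₀
  have hD : exp (-D) < MonoidWithZeroHom.ValueGroup₀.embedding γ.1 := by
    rw [← lt_log_iff_exp_lt (by simp), hD₀]
    simp
  exact (h D).mono fun i hi => hγ (Valued.v.restrict_lt_iff_lt_embedding.2 (hi.trans_lt hD))

theorem summable_zpow_mul_LaurentX_zpow_sq {α : LaurentSeries K} (hα : α ≠ 0) :
    Summable fun k : ℤ => α ^ k * LaurentX K ^ (k ^ 2) := by
  apply NonarchimedeanAddGroup.summable_of_tendsto_cofinite_zero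
  refine LaurentSeries.tendsto_zero_of_valuation_le fun n => ?_
  have ha : Valued.v α = (exp (log (Valued.v α)) : ℤᵐ⁰) :=
    (exp_log ((Valuation.ne_zero_iff _).2 hα)).symm
  set a : ℤ := log (Valued.v α)
  rw [Filter.eventually_cofinite]
  refine (Set.finite_Icc (-(|a| + |n| + 1)) (|a| + |n| + 1)).subset fun j hj => ?_
  by_contra hout
  apply hj
  rw [valuation_zpow_mul_zpow_sq (valuation_LaurentX K) ha, exp_le_exp]
  have hlt : |a| + |n| + 1 < |j| := by
    by_contra hle
    exact hout (abs_le.1 (not_lt.1 hle))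
  have h1 : a * j ≤ |a| * |j| := (le_abs_self _).trans (abs_mul a j).le
  nlinarith [sq_abs j, abs_nonneg a, abs_nonneg n, le_abs_self n]

end Topology

/-- **Jacobi's triple product identity**: for every field `K` and every nonzero Laurent
series `α`,
`∏_{k=1}^∞ (1 − X^{2k})(1 + α X^{2k−1})(1 + α⁻¹ X^{2k−1}) = ∑_{k=−∞}^∞ α^k X^{k²}`
in `K((X))`; both sides converge in the `X`-adic topology. -/
theorem jacobi_triple_product (K : Type*) [Field K] (α : LaurentSeries K) (hα : α ≠ 0) :
    ∃ S : LaurentSeries K,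
      Tendsto (fun N : ℕ => ∏ k ∈ Finset.range N,
          ((1 - LaurentX K ^ (2 * (k + 1))) * (1 + α * LaurentX K ^ (2 * k + 1)) *
            (1 + α⁻¹ * LaurentX K ^ (2 * k + 1))))
        atTop (nhds S) ∧
      HasSum (fun k : ℤ => α ^ k * LaurentX K ^ (k ^ 2)) S := by
  have ha : Valued.v α = (exp (log (Valued.v α)) : ℤᵐ⁰) :=
    (exp_log ((Valuation.ne_zero_iff _).2 hα)).symm
  obtain ⟨S, hS⟩ := summable_zpow_mul_LaurentX_zpow_sq hα
  refine ⟨S, ?_, hS⟩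
  have hIcc : Tendsto (fun N : ℕ => Finset.Icc (-(N : ℤ)) N) atTop atTop := by
    refine tendsto_atTop_finset_of_monotone (fun M N h => ?_) fun j => ⟨j.natAbs, ?_⟩
    · exact Finset.Icc_subset_Icc (by omega) (by omega)
    · rw [Finset.mem_Icc]
      omega
  have hdiff := LaurentSeries.tendsto_zero_of_valuation_le (l := atTop)
    (f := fun N : ℕ => ∏ k ∈ Finset.range N,
        ((1 - LaurentX K ^ (2 * (k + 1))) * (1 + α * LaurentX K ^ (2 * k + 1)) *
          (1 + α⁻¹ * LaurentX K ^ (2 * k + 1))) -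
      ∑ j ∈ Finset.Icc (-(N : ℤ)) N, α ^ j * LaurentX K ^ (j ^ 2)) fun n => by
    filter_upwards [eventually_ge_atTop ((|log (Valued.v α)| + 2) ^ 2 + n).toNat] with N hN
    refine (valuation_prod_triple_sub_sum_le (valuation_LaurentX K) ha N).trans ?_
    rw [exp_le_exp]
    have := Int.toNat_le.1 hN
    linarith
  simpa using hdiff.add (hS.comp hIcc)
end

section
/- Euler's pentagonal number theorem: in ℤ[[X]], ∏_{k=1}^∞ (1 − X^k) = ∑_{k=−∞}^∞ (−1)^k X^{(3k²+k)/2}, the sum ranging over all k ∈ ℤ (note that (3k²+k)/2 is a non-negative integer for every k ∈ ℤ). -/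
open PowerSeries Filter

/-- **Euler's pentagonal number theorem**: in `ℤ⟦X⟧`,
`∏_{k=1}^∞ (1 − X^k) = ∑_{k=−∞}^∞ (−1)^k X^{(3k²+k)/2}`. -/
theorem euler_pentagonal_number_theorem :
    ∃ S : PowerSeries ℤ,
      Tendsto (fun N : ℕ => ∏ k ∈ Finset.range N, (1 - (X : PowerSeries ℤ) ^ (k + 1)))
        atTop (nhds S) ∧
      HasSum (fun k : ℤ =>
        ((k.negOnePow : ℤ) : PowerSeries ℤ) * (X : PowerSeries ℤ) ^ ((3 * k ^ 2 + k) / 2).toNat)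
        S := by
  refine ⟨pentagonalSeries ℤ, ?_, ?_⟩
  · exact (WithPiTopology.hasProd_one_sub_X_pow ℤ).tendsto_prod_nat
  · have hterm : (fun k : ℤ =>
        ((k.negOnePow : ℤ) : PowerSeries ℤ) * (X : PowerSeries ℤ) ^ ((3 * k ^ 2 + k) / 2).toNat) =
        (fun k : ℤ => ((k.negOnePow : ℤ) : PowerSeries ℤ) * X ^ pentagonal k) ∘ Equiv.neg ℤ := by
      funext k
      simp only [Function.comp_apply, Equiv.neg_apply, Int.negOnePow_neg, pentagonal_neg]
      ring_nf
    rw [hterm]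
    exact (Equiv.neg ℤ).hasSum_iff.mpr (WithPiTopology.hasSum_pentagonalSeries ℤ)
end

section
/- Jacobi's cube identity: in ℤ[[X]], ∏_{k=1}^∞ (1 − X^k)³ = ∑_{k=0}^∞ (−1)^k (2k+1) X^{k(k+1)/2}. -/
open PowerSeries Filter

/-- The finite `q`-Pochhammer product `∏_{k=1}^n (1 - X^k)`. -/
noncomputable def qPoch (n : ℕ) : PowerSeries ℤ :=
  ∏ k ∈ Finset.range n, (1 - (X : PowerSeries ℤ) ^ (k + 1))

lemma qPoch_zero : qPoch 0 = 1 := by simp [qPoch]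

lemma qPoch_succ (n : ℕ) : qPoch (n + 1) = qPoch n * (1 - (X : PowerSeries ℤ) ^ (n + 1)) := by
  simp [qPoch, Finset.prod_range_succ]

lemma isUnit_qPoch (n : ℕ) : IsUnit (qPoch n) := by
  simp [PowerSeries.isUnit_iff_constantCoeff, qPoch]

lemma X_pow_dvd_qPoch_add_sub (n k : ℕ) :
    (X : PowerSeries ℤ) ^ (n + 1) ∣ qPoch (n + k) - qPoch n := by
  induction k with
  | zero => simp
  | succ k ih =>
    have h : qPoch (n + (k + 1)) - qPoch n =
        (qPoch (n + k) - qPoch n) - X ^ (n + 1) * (X ^ k * qPoch (n + k)) := by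
      rw [← add_assoc, qPoch_succ]; ring
    rw [h]
    exact dvd_sub ih (dvd_mul_right _ _)

/-- The coefficient of `z ^ j` in `(1 - z⁻¹) ∏_{k=1}^n (1 - z X^k)(1 - z⁻¹ X^k)`; the coefficients
are antisymmetric under `j ↦ -1 - j`, so only `j ≥ 0` is kept. -/
noncomputable def tripleCoeff : ℕ → ℕ → PowerSeries ℤ
  | 0, 0 => 1
  | 0, _ + 1 => 0
  | n + 1, 0 => (1 + X ^ (2 * (n + 1))) * tripleCoeff n 0
      - X ^ (n + 1) * (tripleCoeff n 1 - tripleCoeff n 0)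
  | n + 1, j + 1 => (1 + X ^ (2 * (n + 1))) * tripleCoeff n (j + 1)
      - X ^ (n + 1) * (tripleCoeff n j + tripleCoeff n (j + 2))

lemma tripleCoeff_eq_zero {n j : ℕ} (h : n < j) : tripleCoeff n j = 0 := by
  induction n generalizing j with
  | zero =>
    obtain ⟨j, rfl⟩ := Nat.exists_eq_succ_of_ne_zero (by omega : j ≠ 0)
    simp [tripleCoeff]
  | succ n ih =>
    obtain ⟨j, rfl⟩ := Nat.exists_eq_succ_of_ne_zero (by omega : j ≠ 0)
    simp [tripleCoeff, ih (by omega : n < j + 1), ih (by omega : n < j),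
      ih (by omega : n < j + 2)]

lemma triangle_succ (j : ℕ) : (j + 1) * (j + 1 + 1) / 2 = j * (j + 1) / 2 + (j + 1) := by
  rw [show (j + 1) * (j + 1 + 1) = j * (j + 1) + (j + 1) * 2 by ring,
    Nat.add_mul_div_right _ _ (by norm_num)]

lemma le_triangle (j : ℕ) : j ≤ j * (j + 1) / 2 := by
  induction j with
  | zero => simp
  | succ j ih => rw [triangle_succ]; omega

lemma tripleCoeff_mul_qPoch (m j : ℕ) :
    tripleCoeff (m + j) j * (qPoch m * qPoch (m + 2 * j + 1)) =
      (-1) ^ j * X ^ (j * (j + 1) / 2) * qPoch (2 * (m + j) + 1) := by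
  induction hn : m + j generalizing m j with
  | zero =>
    obtain ⟨rfl, rfl⟩ : m = 0 ∧ j = 0 := by omega
    simp [tripleCoeff, qPoch_zero]
  | succ n ih =>
    have hR : qPoch (2 * (n + 1) + 1) =
        qPoch (2 * n + 1) * (1 - X ^ (2 * n + 2)) * (1 - X ^ (2 * n + 3)) := by
      rw [show 2 * (n + 1) + 1 = 2 * n + 1 + 1 + 1 by ring, qPoch_succ, qPoch_succ]
    rw [hR]
    rcases j with _ | j
    · obtain rfl : m = n + 1 := by omega
      have h0 := ih n 0 rfl
      have h1 : tripleCoeff n 1 * (qPoch (n + 1) * qPoch (n + 2)) =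
          - (X * (1 - X ^ n) * (1 - X ^ (n + 1)) * qPoch (2 * n + 1)) := by
        rcases n with _ | n
        · simp [tripleCoeff]
        · have := ih n 1 rfl
          rw [qPoch_succ (n + 1), qPoch_succ n]
          norm_num at this
          linear_combination (1 - X ^ (n + 1)) * (1 - X ^ (n + 1 + 1)) * this
      norm_num at h0 ⊢
      rw [tripleCoeff]
      have e1 := qPoch_succ n
      have e2 := qPoch_succ (n + 1)
      have h0' : tripleCoeff n 0 * (qPoch (n + 1) * qPoch (n + 2)) =
          qPoch (2 * n + 1) * (1 - X ^ (n + 1)) * (1 - X ^ (n + 2)) := by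
        rw [e2, ← h0, e1]; ring
      linear_combination (1 + X ^ (2 * (n + 1)) + X ^ (n + 1)) * h0' - X ^ (n + 1) * h1
    · obtain rfl : n = m + j := by omega
      have hm : tripleCoeff (m + j) j * (qPoch m * qPoch (m + 2 * (j + 1) + 1)) =
          (-1) ^ j * X ^ (j * (j + 1) / 2) * qPoch (2 * (m + j) + 1) *
            ((1 - X ^ (m + 2 * j + 2)) * (1 - X ^ (m + 2 * j + 3))) := by
        rw [show m + 2 * (j + 1) + 1 = m + 2 * j + 1 + 1 + 1 by ring, qPoch_succ, qPoch_succ]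
        linear_combination
          ((1 - X ^ (m + 2 * j + 2)) * (1 - X ^ (m + 2 * j + 3))) * ih m j rfl
      have hz : tripleCoeff (m + j) (j + 1) * (qPoch m * qPoch (m + 2 * (j + 1) + 1)) =
          (-1) ^ (j + 1) * X ^ (j * (j + 1) / 2 + (j + 1)) * qPoch (2 * (m + j) + 1) *
            ((1 - X ^ m) * (1 - X ^ (m + 2 * j + 3))) := by
        rcases m with _ | m
        · simp [tripleCoeff_eq_zero]
        · have := ih m (j + 1) (by omega)
          rw [triangle_succ] at this
          rw [show m + 1 + 2 * (j + 1) + 1 = m + 2 * (j + 1) + 1 + 1 by ring,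
            qPoch_succ (m + 2 * (j + 1) + 1), qPoch_succ m]
          linear_combination ((1 - X ^ (m + 1)) * (1 - X ^ (m + 2 * (j + 1) + 1 + 1))) * this
      have hp : tripleCoeff (m + j) (j + 2) * (qPoch m * qPoch (m + 2 * (j + 1) + 1)) =
          (-1) ^ j * X ^ (j * (j + 1) / 2 + (j + 1) + (j + 2)) * qPoch (2 * (m + j) + 1) *
            ((1 - X ^ m) * (1 - X ^ (m - 1))) := by
        rcases m with _ | _ | m
        · simp [tripleCoeff_eq_zero]
        · simp [tripleCoeff_eq_zero (show 0 + 1 + j < j + 2 by omega)]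
        · have := ih m (j + 2) (by omega)
          rw [triangle_succ, triangle_succ] at this
          rw [show m + 1 + 1 + 2 * (j + 1) + 1 = m + 2 * (j + 2) + 1 by ring, qPoch_succ,
            qPoch_succ m, Nat.add_sub_cancel]
          linear_combination ((1 - X ^ (m + 1)) * (1 - X ^ (m + 1 + 1))) * this
      rw [triangle_succ, tripleCoeff]
      rcases m with _ | m
      · simp only [pow_zero, sub_self, zero_mul, mul_zero] at hz hp
        linear_combination (1 + X ^ (2 * (0 + j + 1))) * hz - X ^ (0 + j + 1) * (hm + hp)
      · rw [Nat.add_sub_cancel] at hp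
        linear_combination (1 + X ^ (2 * (m + 1 + j + 1))) * hz -
          X ^ (m + 1 + j + 1) * (hm + hp)

lemma sum_shift_tripleCoeff (f : ℕ → PowerSeries ℤ) (n : ℕ) :
    ∑ j ∈ Finset.range n, (2 * ((j + 1 : ℕ) : PowerSeries ℤ) + 1) * (f j + f (j + 2)) =
      2 * ∑ j ∈ Finset.range n, (2 * (j : PowerSeries ℤ) + 1) * f j + f 0 - f 1
        + (2 * (n : PowerSeries ℤ) - 1) * f n + (2 * (n : PowerSeries ℤ) + 1) * f (n + 1) := by
  induction n with
  | zero => simp; ring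
  | succ n ih =>
    rw [Finset.sum_range_succ, ih, Finset.sum_range_succ]
    push_cast
    ring

/-- The derivative at `z = 1` of the finite Jacobi triple product. -/
lemma sum_tripleCoeff (n : ℕ) :
    ∑ j ∈ Finset.range (n + 1), (2 * (j : PowerSeries ℤ) + 1) * tripleCoeff n j =
      qPoch n ^ 2 := by
  induction n with
  | zero => simp [tripleCoeff, qPoch_zero]
  | succ n ih =>
    have hs := sum_shift_tripleCoeff (tripleCoeff n) (n + 1)
    rw [tripleCoeff_eq_zero (Nat.lt_succ_self n),
      tripleCoeff_eq_zero (show n < n + 1 + 1 by omega), ih] at hs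
    have ht : ∑ j ∈ Finset.range (n + 1), (2 * ((j + 1 : ℕ) : PowerSeries ℤ) + 1) *
        tripleCoeff n (j + 1) = qPoch n ^ 2 - tripleCoeff n 0 := by
      rw [← ih, eq_sub_iff_add_eq]
      have h := Finset.sum_range_succ'
        (fun j => (2 * (j : PowerSeries ℤ) + 1) * tripleCoeff n j) (n + 1)
      rw [Finset.sum_range_succ, tripleCoeff_eq_zero (Nat.lt_succ_self n)] at h
      simpa using h.symm
    rw [Finset.sum_range_succ']
    have hu : ∑ j ∈ Finset.range (n + 1), (2 * ((j + 1 : ℕ) : PowerSeries ℤ) + 1) *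
        tripleCoeff (n + 1) (j + 1) =
        (1 + X ^ (2 * (n + 1))) * ∑ j ∈ Finset.range (n + 1),
          (2 * ((j + 1 : ℕ) : PowerSeries ℤ) + 1) * tripleCoeff n (j + 1)
        - X ^ (n + 1) * ∑ j ∈ Finset.range (n + 1),
          (2 * ((j + 1 : ℕ) : PowerSeries ℤ) + 1) *
            (tripleCoeff n j + tripleCoeff n (j + 2)) := by
      rw [Finset.mul_sum, Finset.mul_sum, ← Finset.sum_sub_distrib]
      refine Finset.sum_congr rfl fun j _ => ?_
      rw [tripleCoeff]; ring
    rw [hu, hs, ht, tripleCoeff, qPoch_succ]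
    push_cast
    ring

lemma X_pow_dvd_qPoch_mul_tripleCoeff_sub {n j : ℕ} (h : j ≤ n) :
    (X : PowerSeries ℤ) ^ (n + 1) ∣
      qPoch n * tripleCoeff n j - (-1) ^ j * X ^ (j * (j + 1) / 2) := by
  obtain ⟨m, rfl⟩ := Nat.exists_eq_add_of_le' h
  rw [← ((isUnit_qPoch m).mul (isUnit_qPoch (m + 2 * j + 1))).dvd_mul_right]
  have key : (qPoch (m + j) * tripleCoeff (m + j) j - (-1) ^ j * X ^ (j * (j + 1) / 2)) *
      (qPoch m * qPoch (m + 2 * j + 1)) = (-1) ^ j * (X ^ (j * (j + 1) / 2) *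
        ((qPoch (m + j) - qPoch m) * qPoch (2 * (m + j) + 1) +
          qPoch m * (qPoch (m + 2 * j + 1 + m) - qPoch (m + 2 * j + 1)))) := by
    rw [show m + 2 * j + 1 + m = 2 * (m + j) + 1 by ring]
    linear_combination qPoch (m + j) * tripleCoeff_mul_qPoch m j
  rw [key]
  refine Dvd.dvd.mul_left ((pow_dvd_pow X
    (show m + j + 1 ≤ j * (j + 1) / 2 + (m + 1) by have := le_triangle j; omega)).trans ?_) _
  rw [pow_add]
  refine mul_dvd_mul_left _ (dvd_add ((X_pow_dvd_qPoch_add_sub m j).mul_right _)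
    (Dvd.dvd.mul_left ((pow_dvd_pow X (by omega)).trans
      (X_pow_dvd_qPoch_add_sub (m + 2 * j + 1) m)) _))

lemma X_pow_dvd_qPoch_cube_sub_sum (n : ℕ) :
    (X : PowerSeries ℤ) ^ (n + 1) ∣ qPoch n ^ 3 - ∑ k ∈ Finset.range (n + 1),
      (((-1) ^ k * (2 * k + 1) : ℤ) : PowerSeries ℤ) * X ^ (k * (k + 1) / 2) := by
  rw [pow_succ (qPoch n) 2, ← sum_tripleCoeff, Finset.sum_mul, ← Finset.sum_sub_distrib]
  refine Finset.dvd_sum fun j hj => ?_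
  have h := X_pow_dvd_qPoch_mul_tripleCoeff_sub (Nat.lt_succ_iff.1 (Finset.mem_range.1 hj))
  convert h.mul_left (2 * (j : PowerSeries ℤ) + 1) using 1
  push_cast
  ring

lemma coeff_eq_of_X_pow_dvd_sub {f g : PowerSeries ℤ} {n d : ℕ} (h : X ^ n ∣ f - g)
    (hd : d < n) : coeff d f = coeff d g := by
  have := PowerSeries.X_pow_dvd_iff.1 h d hd
  rwa [map_sub, sub_eq_zero] at this

lemma coeff_qPoch_cube {d n : ℕ} (h : d ≤ n) :
    coeff d (qPoch n ^ 3) = coeff d (qPoch d ^ 3) := by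
  obtain ⟨k, rfl⟩ := Nat.exists_eq_add_of_le h
  exact coeff_eq_of_X_pow_dvd_sub
    ((X_pow_dvd_qPoch_add_sub d k).trans (sub_dvd_pow_sub_pow _ _ 3)) (Nat.lt_succ_self d)

lemma tendsto_of_eventually_coeff_eq {F : ℕ → PowerSeries ℤ} {S : PowerSeries ℤ}
    (h : ∀ d, ∀ᶠ N in atTop, coeff d (F N) = coeff d S) : Tendsto F atTop (nhds S) := by
  refine (PowerSeries.WithPiTopology.tendsto_iff_coeff_tendsto ℤ F atTop S).2 fun d => ?_
  exact tendsto_const_nhds.congr' ((h d).mono fun N hN => hN.symm)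

/-- **Jacobi's cube identity**: in `ℤ⟦X⟧`,
`∏_{k=1}^∞ (1 − X^k)³ = ∑_{k=0}^∞ (−1)^k (2k+1) X^{k(k+1)/2}`. -/
theorem jacobi_cube_identity :
    ∃ S : PowerSeries ℤ,
      Tendsto (fun N : ℕ => ∏ k ∈ Finset.range N, (1 - (X : PowerSeries ℤ) ^ (k + 1)) ^ 3)
        atTop (nhds S) ∧
      Tendsto (fun N : ℕ => ∑ k ∈ Finset.range N,
          (((-1) ^ k * (2 * k + 1) : ℤ) : PowerSeries ℤ) * (X : PowerSeries ℤ) ^ (k * (k + 1) / 2))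
        atTop (nhds S) := by
  refine ⟨PowerSeries.mk fun d => coeff d (qPoch d ^ 3),
    tendsto_of_eventually_coeff_eq fun d => ?_, tendsto_of_eventually_coeff_eq fun d => ?_⟩
  · filter_upwards [eventually_ge_atTop d] with N hN
    rw [Finset.prod_pow, coeff_mk, ← coeff_qPoch_cube hN, qPoch]
  · filter_upwards [eventually_ge_atTop (d + 1)] with N hN
    obtain ⟨n, rfl⟩ := Nat.exists_eq_succ_of_ne_zero (by omega : N ≠ 0)
    rw [coeff_mk, ← coeff_qPoch_cube (show d ≤ n by omega)]
    exact (coeff_eq_of_X_pow_dvd_sub (X_pow_dvd_qPoch_cube_sub_sum n) (by omega)).symm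
end

section
/- The Rogers–Ramanujan identities: in ℤ[[X]], ∏_{k=1}^∞ ((1 − X^{5k−1})(1 − X^{5k−4}))^{−1} = ∑_{k=0}^∞ X^{k²} (X^k!)^{−1} and ∏_{k=1}^∞ ((1 − X^{5k−2})(1 − X^{5k−3}))^{−1} = ∑_{k=0}^∞ X^{k²+k} (X^k!)^{−1}; all the series being inverted have constant term 1 and are therefore invertible in ℤ[[X]]. -/
open PowerSeries Filter

/-- The inverse of a power series with constant term `1` (given by `invOfUnit` at the unit `1`);
for such a series `φ` it satisfies `φ * inv1 φ = 1`. -/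
noncomputable def inv1 (φ : PowerSeries ℤ) : PowerSeries ℤ := φ.invOfUnit 1

/-- `X^k! = (1 − X)(1 − X²)⋯(1 − X^k)`. -/
noncomputable def Xfact (k : ℕ) : PowerSeries ℤ :=
  ∏ i ∈ Finset.range k, (1 - (X : PowerSeries ℤ) ^ (i + 1))

section QSeries

variable {R : Type*} [CommRing R] {q : R} {e : ℕ → R}

/-- Extension by zero of a sequence to the integers. -/
def zeroExt (e : ℕ → R) (n : ℤ) : R := if n < 0 then 0 else e n.toNat

@[simp] theorem zeroExt_natCast (e : ℕ → R) (n : ℕ) : zeroExt e (n : ℤ) = e n := by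
  simp [zeroExt]

theorem zeroExt_of_neg (e : ℕ → R) {n : ℤ} (h : n < 0) : zeroExt e n = 0 := by
  simp [zeroExt, h]

/-- A limiting case of the `q`-Chu–Vandermonde identity, where `e n = 1 / (q; q)_n`. -/
theorem sum_pow_mul_qVandermonde [IsDomain R] (he0 : e 0 = 1)
    (he : ∀ n, (1 - q ^ (n + 1)) * e (n + 1) = e n) (hq : ∀ n : ℕ, 1 - q ^ (n + 1) ≠ 0)
    (M a : ℕ) :
    ∑ i ∈ Finset.range (M + 1), q ^ (i * (i + a)) * e (M - i) * e i * e (i + a) =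
      e M * e (M + a) := by
  induction M generalizing a with
  | zero => simp [he0]
  | succ M ih =>
    apply mul_left_cancel₀ (hq M)
    rw [← mul_assoc, he, show M + 1 + a = M + (a + 1) by ring, ← ih (a + 1), Finset.mul_sum]
    have key : ∀ i ∈ Finset.range (M + 1 + 1),
        (1 - q ^ (M + 1)) * (q ^ (i * (i + a)) * e (M + 1 - i) * e i * e (i + a)) =
        q ^ (i * (i + a)) * e (M + 1 - i) * ((1 - q ^ i) * e i) * e (i + a) +
        q ^ (i * (i + a + 1)) * ((1 - q ^ (M + 1 - i)) * e (M + 1 - i)) * e i * e (i + a) := by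
      intro i hi
      obtain ⟨c, hc⟩ := Nat.exists_eq_add_of_le (Finset.mem_range_succ_iff.1 hi)
      rw [hc, Nat.add_sub_cancel_left, show i * (i + a + 1) = i * (i + a) + i by ring]
      ring
    rw [Finset.sum_congr rfl key, Finset.sum_add_distrib, Finset.sum_range_succ' _ (M + 1),
      Finset.sum_range_succ _ (M + 1)]
    simp only [pow_zero, Nat.sub_self, sub_self, zero_mul, mul_zero, add_zero]
    rw [← Finset.sum_add_distrib]
    refine Finset.sum_congr rfl fun i hi => ?_
    obtain ⟨c, rfl⟩ := Nat.exists_eq_add_of_le (Finset.mem_range_succ_iff.1 hi)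
    rw [show i + c + 1 - (i + 1) = c by omega, show i + c + 1 - i = c + 1 by omega,
      Nat.add_sub_cancel_left, he, he, ← he (i + a), show i + 1 + a = i + a + 1 by ring,
      show i + (a + 1) = i + a + 1 by ring,
      show (i + 1) * (i + a + 1) = i * (i + a + 1) + (i + a + 1) by ring]
    ring

/-- The homogeneous `q`-binomial theorem, where `e n = 1 / (q; q)_n`. -/
theorem sum_qBinomial [IsDomain R] (he0 : e 0 = 1)
    (he : ∀ n, (1 - q ^ (n + 1)) * e (n + 1) = e n) (hq : ∀ n : ℕ, 1 - q ^ (n + 1) ≠ 0)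
    (x y : R) (n : ℕ) :
    ∑ k ∈ Finset.range (n + 1),
        (-1) ^ k * q ^ (k.choose 2) * x ^ k * y ^ (n - k) * e (n - k) * e k =
      e n * ∏ k ∈ Finset.range n, (y - x * q ^ k) := by
  induction n with
  | zero => simp [he0]
  | succ n ih =>
    apply mul_left_cancel₀ (hq n)
    rw [← mul_assoc, he, Finset.prod_range_succ, ← mul_assoc, ← ih, Finset.mul_sum]
    have key : ∀ k ∈ Finset.range (n + 1 + 1),
        (1 - q ^ (n + 1)) *
          ((-1) ^ k * q ^ (k.choose 2) * x ^ k * y ^ (n + 1 - k) * e (n + 1 - k) * e k) =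
        (-1) ^ k * q ^ (k.choose 2) * x ^ k * y ^ (n + 1 - k) * q ^ (n + 1 - k) *
          e (n + 1 - k) * ((1 - q ^ k) * e k) +
        (-1) ^ k * q ^ (k.choose 2) * x ^ k * y ^ (n + 1 - k) *
          ((1 - q ^ (n + 1 - k)) * e (n + 1 - k)) * e k := by
      intro k hk
      obtain ⟨c, hc⟩ := Nat.exists_eq_add_of_le (Finset.mem_range_succ_iff.1 hk)
      rw [hc, Nat.add_sub_cancel_left]
      ring
    rw [Finset.sum_congr rfl key, Finset.sum_add_distrib, Finset.sum_range_succ' _ (n + 1),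
      Finset.sum_range_succ _ (n + 1)]
    simp only [pow_zero, Nat.sub_self, sub_self, zero_mul, mul_zero, add_zero]
    rw [← Finset.sum_add_distrib, Finset.sum_mul]
    refine Finset.sum_congr rfl fun k hk => ?_
    obtain ⟨c, rfl⟩ := Nat.exists_eq_add_of_le (Finset.mem_range_succ_iff.1 hk)
    rw [show k + c + 1 - (k + 1) = c by omega, show k + c + 1 - k = c + 1 by omega,
      Nat.add_sub_cancel_left, he, he, Nat.choose_succ_succ' k 1, Nat.choose_one_right]
    ring

theorem sum_Icc_zeroExt (f : ℤ → R) (e : ℕ → R) {t d B : ℕ} (hB : t + d ≤ B) :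
    ∑ j ∈ Finset.Icc (-B : ℤ) B, f j * zeroExt e (t - j) * zeroExt e (t + d + j) =
      ∑ k ∈ Finset.range (2 * t + d + 1), f (k - (t + d)) * e (2 * t + d - k) * e k := by
  symm
  refine Finset.sum_of_injOn (fun k : ℕ => (k : ℤ) - (t + d)) ?_ ?_ ?_ ?_
  · intro a _ b _ h
    simpa using h
  · intro k hk
    simp only [Finset.coe_range, Set.mem_Iio, Finset.coe_Icc, Set.mem_Icc] at hk ⊢
    omega
  · intro j _ hj
    by_cases h1 : (t : ℤ) - j < 0
    · simp [zeroExt_of_neg e h1]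
    by_cases h2 : (t : ℤ) + d + j < 0
    · simp [zeroExt_of_neg e h2]
    refine absurd ⟨(t + d + j).toNat, ?_, ?_⟩ hj
    · simp only [Finset.coe_range, Set.mem_Iio]
      omega
    · simp only
      omega
  · intro k hk
    have hk := Finset.mem_range_succ_iff.1 hk
    rw [show (t : ℤ) - (k - (t + d)) = ((2 * t + d - k : ℕ) : ℤ) by omega,
      show (t : ℤ) + d + (k - (t + d)) = (k : ℤ) by ring, zeroExt_natCast, zeroExt_natCast]

theorem sum_pow_mul_zeroExt_natCast [IsDomain R] (he0 : e 0 = 1)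
    (he : ∀ n, (1 - q ^ (n + 1)) * e (n + 1) = e n) (hq : ∀ n : ℕ, 1 - q ^ (n + 1) ≠ 0)
    (d N m : ℕ) :
    ∑ s ∈ Finset.range (N + 1),
        q ^ (s * (s + d)) * e (N - s) * (zeroExt e (s - m) * zeroExt e (s + d + m)) =
      q ^ (m * (m + d)) * (zeroExt e (N - m) * zeroExt e (N + d + m)) := by
  rcases lt_or_ge N m with h | h
  · rw [zeroExt_of_neg e (by omega : (N : ℤ) - m < 0), zero_mul, mul_zero]
    refine Finset.sum_eq_zero fun s hs => ?_
    have hs := Finset.mem_range_succ_iff.1 hs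
    rw [zeroExt_of_neg e (by omega : (s : ℤ) - m < 0), zero_mul, mul_zero]
  · obtain ⟨M, rfl⟩ := Nat.exists_eq_add_of_le h
    rw [add_assoc, Finset.sum_range_add, Finset.sum_eq_zero, zero_add]
    · rw [show ((m + M : ℕ) : ℤ) - m = (M : ℕ) by push_cast; ring,
        show ((m + M : ℕ) : ℤ) + d + m = ((M + (2 * m + d) : ℕ) : ℤ) by push_cast; ring,
        zeroExt_natCast, zeroExt_natCast, ← sum_pow_mul_qVandermonde he0 he hq, Finset.mul_sum]
      refine Finset.sum_congr rfl fun i _ => ?_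
      rw [show ((m + i : ℕ) : ℤ) - m = (i : ℕ) by push_cast; ring,
        show ((m + i : ℕ) : ℤ) + d + m = ((i + (2 * m + d) : ℕ) : ℤ) by push_cast; ring,
        zeroExt_natCast, zeroExt_natCast, Nat.add_sub_add_left]
      ring
    · intro s hs
      have hs := Finset.mem_range.1 hs
      rw [zeroExt_of_neg e (by omega : (s : ℤ) - m < 0), zero_mul, mul_zero]

/-- The change of base underlying the Bailey lemma for `a = q ^ d`, `d ∈ {0, 1}`. -/
theorem sum_pow_mul_zeroExt [IsDomain R] (he0 : e 0 = 1)
    (he : ∀ n, (1 - q ^ (n + 1)) * e (n + 1) = e n) (hq : ∀ n : ℕ, 1 - q ^ (n + 1) ≠ 0)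
    {d : ℕ} (hd : d ≤ 1) (N : ℕ) (j : ℤ) :
    ∑ s ∈ Finset.range (N + 1),
        q ^ (s * (s + d)) * e (N - s) * (zeroExt e (s - j) * zeroExt e (s + d + j)) =
      q ^ (j * (j + d)).toNat * (zeroExt e (N - j) * zeroExt e (N + d + j)) := by
  rcases le_or_gt 0 j with h | h
  · lift j to ℕ using h
    rw [sum_pow_mul_zeroExt_natCast he0 he hq]
    norm_cast
  · obtain ⟨m, hm⟩ := Int.eq_ofNat_of_zero_le (show 0 ≤ -d - j by omega)
    obtain rfl : j = -d - m := by omega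
    have := sum_pow_mul_zeroExt_natCast he0 he hq d N m
    have h1 : ∀ s : ℤ, zeroExt e (s - (-d - m)) * zeroExt e (s + d + (-d - m)) =
        zeroExt e (s - m) * zeroExt e (s + d + m) := by
      intro s
      rw [mul_comm]
      congr 2 <;> ring
    simp only [h1, this]
    congr 2
    rw [show (-d - m : ℤ) * (-d - m + d) = ((m * (m + d) : ℕ) : ℤ) by push_cast; ring,
      Int.toNat_natCast]

/-- `j (j - 1) / 2` for an integer `j`. -/
def triangle (j : ℤ) : ℕ := (j * (j - 1) / 2).toNat

theorem two_mul_triangle (j : ℤ) : 2 * (triangle j : ℤ) = j * (j - 1) := by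
  have h : 2 ∣ j * (j - 1) := (Int.even_mul_pred_self j).two_dvd
  have h0 : 0 ≤ j * (j - 1) := by
    rcases le_or_gt j 0 with h | h <;> nlinarith
  unfold triangle
  omega

theorem two_mul_choose_two (k : ℕ) : 2 * (k.choose 2 : ℤ) = k * (k - 1) := by
  induction k with
  | zero => simp
  | succ k ih =>
    rw [Nat.choose_succ_succ' k 1, Nat.choose_one_right]
    push_cast
    linarith

theorem neg_one_pow_natAbs_sub (k u : ℕ) :
    (-1 : R) ^ ((k : ℤ) - u).natAbs = (-1) ^ u * (-1) ^ k := by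
  rw [← pow_add]
  rcases le_total u k with h | h
  · obtain ⟨c, rfl⟩ := Nat.exists_eq_add_of_le h
    rw [show (((u + c : ℕ) : ℤ) - u).natAbs = c by omega, show u + (u + c) = 2 * u + c by ring,
      pow_add, pow_mul]
    simp
  · obtain ⟨c, rfl⟩ := Nat.exists_eq_add_of_le h
    rw [show ((k : ℤ) - (k + c : ℕ)).natAbs = c by omega, show k + c + k = 2 * k + c by ring,
      pow_add, pow_mul]
    simp

/-- The unit Bailey pair relative to `a = q ^ d`, `d ∈ {0, 1}`. -/
theorem sum_unit_bailey_pair [IsDomain R] (he0 : e 0 = 1)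
    (he : ∀ n, (1 - q ^ (n + 1)) * e (n + 1) = e n) (hq : ∀ n : ℕ, 1 - q ^ (n + 1) ≠ 0)
    (hq0 : q ≠ 0) {t d B : ℕ} (hd : d ≤ 1) (hB : t + d ≤ B) :
    ∑ j ∈ Finset.Icc (-B : ℤ) B,
        (-1) ^ j.natAbs * q ^ triangle j * (zeroExt e (t - j) * zeroExt e (t + d + j)) =
      if t = 0 then 1 else 0 := by
  simp only [← mul_assoc]
  rw [sum_Icc_zeroExt (fun j => (-1) ^ j.natAbs * q ^ triangle j) e hB]
  split_ifs with ht
  · subst ht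
    have h1 := he 0
    interval_cases d
    · simp [he0, triangle]
    · norm_num [Finset.sum_range_succ, he0, triangle] at h1 ⊢
      linear_combination h1
  · apply mul_left_cancel₀
      (pow_ne_zero ((t + d).choose 2 + t * (t + d)) hq0)
    rw [mul_zero, Finset.mul_sum]
    have := sum_qBinomial he0 he hq ((1 : R)) (q ^ (t + d)) (2 * t + d)
    rw [Finset.prod_eq_zero (i := t + d) (by simp; omega) (by ring), mul_zero] at this
    rw [← mul_zero ((-1) ^ (t + d)), ← this, Finset.mul_sum]
    refine Finset.sum_congr rfl fun k hk => ?_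
    obtain ⟨c, hc⟩ := Nat.exists_eq_add_of_le (Finset.mem_range_succ_iff.1 hk)
    have hE : (t + d).choose 2 + t * (t + d) + triangle ((k : ℤ) - (t + d)) =
        k.choose 2 + (t + d) * c := by
      have h1 := two_mul_choose_two (t + d)
      have h2 := two_mul_choose_two k
      have h3 := two_mul_triangle ((k : ℤ) - (t + d))
      have hc' : (2 * t + d : ℤ) = k + c := by exact_mod_cast hc
      have hcz : (c : ℤ) = 2 * t + d - k := by linarith
      zify
      push_cast at h1
      rw [hcz]
      linarith
    have hs := neg_one_pow_natAbs_sub (R := R) k (t + d)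
    push_cast at hs
    rw [hc, Nat.add_sub_cancel_left, hs, ← pow_mul]
    have hE' := congrArg (q ^ ·) hE
    simp only [pow_add q _ (triangle _)] at hE'
    rw [pow_add q (k.choose 2)] at hE'
    linear_combination ((-1) ^ (t + d) * (-1) ^ k * e c * e k) * hE'

/-- One step along the Bailey chain relative to `a = q ^ d`, `d ∈ {0, 1}`. -/
theorem sum_bailey_step [IsDomain R] (he0 : e 0 = 1)
    (he : ∀ n, (1 - q ^ (n + 1)) * e (n + 1) = e n) (hq : ∀ n : ℕ, 1 - q ^ (n + 1) ≠ 0)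
    {d : ℕ} (hd : d ≤ 1) (J : Finset ℤ) (α : ℤ → R) (β : ℕ → R) (N : ℕ)
    (h : ∀ s ≤ N, ∑ j ∈ J, α j * (zeroExt e (s - j) * zeroExt e (s + d + j)) = β s) :
    ∑ j ∈ J, α j * q ^ (j * (j + d)).toNat * (zeroExt e (N - j) * zeroExt e (N + d + j)) =
      ∑ s ∈ Finset.range (N + 1), q ^ (s * (s + d)) * e (N - s) * β s := by
  simp only [mul_assoc (α _), ← sum_pow_mul_zeroExt he0 he hq hd N, Finset.mul_sum]
  rw [Finset.sum_comm]
  refine Finset.sum_congr rfl fun s hs => ?_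
  rw [← h s (Finset.mem_range_succ_iff.1 hs), Finset.mul_sum]
  exact Finset.sum_congr rfl fun j _ => by ring

/-- `j (5 j + 4 d - 1) / 2`, for `d ∈ {0, 1}`. -/
def thetaExp (d : ℕ) (j : ℤ) : ℕ := triangle j + 2 * (j * (j + d)).toNat

theorem mul_add_nonneg_of_le_one {d : ℕ} (hd : d ≤ 1) (j : ℤ) : 0 ≤ j * (j + d) := by
  rcases le_or_gt 0 j with h | h
  · positivity
  · exact mul_nonneg_of_nonpos_of_nonpos h.le (by omega)

theorem two_mul_thetaExp {d : ℕ} (hd : d ≤ 1) (j : ℤ) :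
    2 * (thetaExp d j : ℤ) = j * (5 * j + 4 * d - 1) := by
  have h1 := two_mul_triangle j
  have h2 := Int.toNat_of_nonneg (mul_add_nonneg_of_le_one hd j)
  unfold thetaExp
  push_cast
  rw [mul_add, h1]
  linear_combination 4 * h2

theorem natAbs_le_thetaExp {d : ℕ} (hd : d ≤ 1) (j : ℤ) : j.natAbs ≤ thetaExp d j := by
  have h := two_mul_thetaExp hd j
  zify
  rcases le_or_gt 0 j with h0 | h0
  · rw [abs_of_nonneg h0]
    rcases h0.eq_or_lt with rfl | h1
    · simp
    · nlinarith
  · rw [abs_of_neg h0]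
    have : (d : ℤ) ≤ 1 := by exact_mod_cast hd
    nlinarith

/-- The finite form of the Rogers–Ramanujan identities, before applying the triple product. -/
theorem sum_theta_eq_sum [IsDomain R] (he0 : e 0 = 1)
    (he : ∀ n, (1 - q ^ (n + 1)) * e (n + 1) = e n) (hq : ∀ n : ℕ, 1 - q ^ (n + 1) ≠ 0)
    (hq0 : q ≠ 0) {d N B : ℕ} (hd : d ≤ 1) (hB : N + d ≤ B) :
    ∑ j ∈ Finset.Icc (-B : ℤ) B,
        (-1) ^ j.natAbs * q ^ thetaExp d j * (zeroExt e (N - j) * zeroExt e (N + d + j)) =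
      ∑ s ∈ Finset.range (N + 1), q ^ (s * (s + d)) * e (N - s) * e s := by
  rw [← sum_bailey_step he0 he hq hd (Finset.Icc (-B : ℤ) B)
    (fun j => (-1) ^ j.natAbs * q ^ triangle j * q ^ (j * (j + d)).toNat)]
  · refine Finset.sum_congr rfl fun j _ => ?_
    rw [thetaExp]
    ring
  · intro s hs
    rw [sum_bailey_step he0 he hq hd _ _ (fun t => if t = 0 then 1 else 0)]
    · simp
    · exact fun t ht => sum_unit_bailey_pair he0 he hq hq0 hd (by omega)

theorem prod_pow_add_mul (p : R) (b c N : ℕ) :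
    ∏ k ∈ Finset.range N, p ^ (b + c * k) = p ^ (b * N + c * N.choose 2) := by
  induction N with
  | zero => simp
  | succ N ih =>
    rw [Finset.prod_range_succ, ih, Nat.choose_succ_succ' N 1, Nat.choose_one_right]
    ring

theorem prod_range_two_mul_sub (p : R) {d : ℕ} (hd : d ≤ 1) (N : ℕ) :
    ∏ k ∈ Finset.range (2 * N), ((p ^ 5) ^ N - p ^ (2 + 2 * d) * (p ^ 5) ^ k) =
      (-1) ^ N * p ^ ((2 + 2 * d) * N + 5 * N.choose 2 + 5 * N * N) *
        ∏ k ∈ Finset.range N,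
          ((1 - p ^ (5 * (k + 1) - (3 - 2 * d))) * (1 - p ^ (5 * (k + 1) - (2 + 2 * d)))) := by
  rw [two_mul, Finset.prod_range_add, ← Finset.prod_range_reflect, Finset.prod_mul_distrib]
  have h1 : ∀ k ∈ Finset.range N, (p ^ 5) ^ N - p ^ (2 + 2 * d) * (p ^ 5) ^ (N - 1 - k) =
      -1 * p ^ (2 + 2 * d + 5 * (N - 1 - k)) * (1 - p ^ (5 * (k + 1) - (2 + 2 * d))) := by
    intro k hk
    have hk := Finset.mem_range.1 hk
    have : 5 * N = 2 + 2 * d + 5 * (N - 1 - k) + (5 * (k + 1) - (2 + 2 * d)) := by omega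
    rw [← pow_mul, this, ← pow_mul]
    ring
  have h2 : ∀ k ∈ Finset.range N, (p ^ 5) ^ N - p ^ (2 + 2 * d) * (p ^ 5) ^ (N + k) =
      p ^ (5 * N) * (1 - p ^ (5 * (k + 1) - (3 - 2 * d))) := by
    intro k hk
    rw [show 5 * (k + 1) - (3 - 2 * d) = 2 + 2 * d + 5 * k by omega]
    ring
  rw [Finset.prod_congr rfl h1, Finset.prod_congr rfl h2, Finset.prod_mul_distrib,
    Finset.prod_mul_distrib, Finset.prod_mul_distrib,
    Finset.prod_range_reflect (fun k => p ^ (2 + 2 * d + 5 * k)), prod_pow_add_mul]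
  simp only [Finset.prod_const, Finset.card_range]
  ring

/-- A finite form of the Jacobi triple product in base `p ^ 5`. -/
theorem sum_theta_eq_prod [IsDomain R] {p : R} (he0 : e 0 = 1)
    (he : ∀ n, (1 - (p ^ 5) ^ (n + 1)) * e (n + 1) = e n)
    (hq : ∀ n : ℕ, 1 - (p ^ 5) ^ (n + 1) ≠ 0)
    (hp0 : p ≠ 0) {d N B : ℕ} (hd : d ≤ 1) (hB : N ≤ B) :
    ∑ j ∈ Finset.Icc (-B : ℤ) B,
        (-1) ^ j.natAbs * p ^ thetaExp d j * (zeroExt e (N - j) * zeroExt e (N + j)) =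
      e (2 * N) * ∏ k ∈ Finset.range N,
        ((1 - p ^ (5 * (k + 1) - (3 - 2 * d))) * (1 - p ^ (5 * (k + 1) - (2 + 2 * d)))) := by
  have h0 := sum_Icc_zeroExt (fun j => (-1) ^ j.natAbs * p ^ thetaExp d j) e
    (t := N) (d := 0) (B := B) hB
  simp only [Nat.cast_zero, add_zero, mul_assoc ((-1 : R) ^ _ * _)] at h0
  rw [h0]
  apply mul_left_cancel₀ (mul_ne_zero (pow_ne_zero N (neg_ne_zero.2 one_ne_zero))
    (pow_ne_zero ((2 + 2 * d) * N + 5 * N.choose 2 + 5 * N * N) hp0))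
  rw [mul_left_comm _ (e (2 * N)), ← prod_range_two_mul_sub p hd N, ← sum_qBinomial he0 he hq,
    Finset.mul_sum]
  refine Finset.sum_congr rfl fun k hk => ?_
  obtain ⟨c, hc⟩ := Nat.exists_eq_add_of_le (Finset.mem_range_succ_iff.1 hk)
  have hE : (2 + 2 * d) * N + 5 * N.choose 2 + 5 * N * N + thetaExp d ((k : ℤ) - N) =
      5 * k.choose 2 + (2 + 2 * d) * k + 5 * N * c := by
    have h1 := two_mul_choose_two N
    have h2 := two_mul_choose_two k
    have h3 := two_mul_thetaExp hd ((k : ℤ) - N)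
    have hc' : (c : ℤ) = 2 * N - k := by
      have : (2 * N : ℤ) = k + c := by exact_mod_cast hc
      linarith
    zify
    rw [hc']
    linarith
  have hE' := congrArg (p ^ ·) hE
  simp only [pow_add p _ (thetaExp _ _), pow_add p _ (5 * N * c),
    pow_add p (5 * k.choose 2)] at hE'
  have hs : (-1 : R) ^ N * (-1) ^ N = 1 := by rw [← mul_pow]; simp
  rw [hc, Nat.add_sub_cancel_left, neg_one_pow_natAbs_sub, ← pow_mul, ← pow_mul, ← pow_mul,
    ← pow_mul, ← mul_assoc 5 N c]
  linear_combination ((-1) ^ N * (-1) ^ N * (-1) ^ k * e c * e k) * hE' +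
    (-1) ^ k * p ^ (5 * k.choose 2) * p ^ ((2 + 2 * d) * k) * p ^ (5 * N * c) * e c * e k * hs

end QSeries

section Truncation

variable {q : PowerSeries ℤ}

theorem mul_inv1 {φ : PowerSeries ℤ} (h : constantCoeff φ = 1) : φ * inv1 φ = 1 :=
  mul_invOfUnit φ 1 (by simpa using h)

theorem constantCoeff_prod_one_sub {ι : Type*} (s : Finset ι) (f : ι → PowerSeries ℤ)
    (h : ∀ i ∈ s, X ∣ f i) : constantCoeff (∏ i ∈ s, (1 - f i)) = 1 := by
  rw [map_prod]
  refine Finset.prod_eq_one fun i hi => ?_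
  simp [X_dvd_iff.1 (h i hi)]

/-- The sequence `n ↦ 1 / (q; q)_n`. -/
noncomputable def qFactInv (q : PowerSeries ℤ) (n : ℕ) : PowerSeries ℤ :=
  inv1 (∏ i ∈ Finset.range n, (1 - q ^ (i + 1)))

theorem prod_mul_qFactInv (hq : X ∣ q) (n : ℕ) :
    (∏ i ∈ Finset.range n, (1 - q ^ (i + 1))) * qFactInv q n = 1 :=
  mul_inv1 (constantCoeff_prod_one_sub _ _ fun i _ => dvd_pow hq i.succ_ne_zero)

theorem qFactInv_zero (hq : X ∣ q) : qFactInv q 0 = 1 := by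
  simpa using prod_mul_qFactInv hq 0

theorem one_sub_pow_mul_qFactInv (hq : X ∣ q) (n : ℕ) :
    (1 - q ^ (n + 1)) * qFactInv q (n + 1) = qFactInv q n := by
  have h1 := prod_mul_qFactInv hq n
  have h2 := prod_mul_qFactInv hq (n + 1)
  rw [Finset.prod_range_succ] at h2
  linear_combination (-(1 - q ^ (n + 1)) * qFactInv q (n + 1)) * h1 + qFactInv q n * h2

theorem one_sub_pow_ne_zero (hq : X ∣ q) (n : ℕ) : 1 - q ^ (n + 1) ≠ 0 := by
  intro h
  simpa [X_dvd_iff.1 hq] using congrArg constantCoeff h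

/-- Reduction modulo `X ^ M`. -/
noncomputable abbrev modXPow (M : ℕ) :
    PowerSeries ℤ →+* PowerSeries ℤ ⧸ Ideal.span {(X : PowerSeries ℤ) ^ M} :=
  Ideal.Quotient.mk _

theorem modXPow_eq_iff {M : ℕ} {f g : PowerSeries ℤ} :
    modXPow M f = modXPow M g ↔ X ^ M ∣ f - g := by
  rw [Ideal.Quotient.eq, Ideal.mem_span_singleton]

theorem modXPow_pow_eq_zero (hq : X ∣ q) {M n : ℕ} (h : M ≤ n) : modXPow M (q ^ n) = 0 := by
  rw [Ideal.Quotient.eq_zero_iff_mem, Ideal.mem_span_singleton]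
  exact (pow_dvd_pow X h).trans (pow_dvd_pow_of_dvd hq n)

theorem modXPow_qFactInv (hq : X ∣ q) {M n : ℕ} (h : M ≤ n) :
    modXPow M (qFactInv q n) = modXPow M (qFactInv q M) := by
  induction n, h using Nat.le_induction with
  | base => rfl
  | succ n hn ih =>
    rw [← ih, ← one_sub_pow_mul_qFactInv hq n, map_mul, map_sub,
      modXPow_pow_eq_zero hq (hn.trans n.le_succ)]
    simp

theorem isUnit_qFactInv (hq : X ∣ q) (n : ℕ) : IsUnit (qFactInv q n) :=
  .of_mul_eq_one_right _ (prod_mul_qFactInv hq n)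

theorem modXPow_sum_theta (hq : X ∣ q) {d M N B u : ℕ} (hd : d ≤ 1) (hN : 2 * M ≤ N) :
    modXPow M (∑ j ∈ Finset.Icc (-B : ℤ) B, (-1) ^ j.natAbs * X ^ thetaExp d j *
        (zeroExt (qFactInv q) (N - j) * zeroExt (qFactInv q) (N + u + j))) =
      modXPow M (qFactInv q M) ^ 2 *
        modXPow M (∑ j ∈ Finset.Icc (-B : ℤ) B, (-1) ^ j.natAbs * X ^ thetaExp d j) := by
  rw [map_sum, map_sum, Finset.mul_sum]
  refine Finset.sum_congr rfl fun j _ => ?_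
  rcases le_or_gt M j.natAbs with h | h
  · simp only [map_mul, modXPow_pow_eq_zero dvd_rfl (h.trans (natAbs_le_thetaExp hd j))]
    ring
  · rw [show (N : ℤ) - j = ((N - j).toNat : ℕ) by omega,
      show (N : ℤ) + u + j = ((N + u + j).toNat : ℕ) by omega, zeroExt_natCast, zeroExt_natCast]
    simp only [map_mul]
    rw [modXPow_qFactInv hq (by omega : M ≤ ((N : ℤ) - j).toNat),
      modXPow_qFactInv hq (by omega : M ≤ ((N : ℤ) + u + j).toNat)]
    ring

theorem modXPow_sum_qFactInv {d M N : ℕ} (hN : 2 * M ≤ N) :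
    modXPow M (∑ s ∈ Finset.range (N + 1),
        X ^ (s * (s + d)) * qFactInv X (N - s) * qFactInv X s) =
      modXPow M (qFactInv X M) *
        modXPow M (∑ s ∈ Finset.range (N + 1), X ^ (s * (s + d)) * qFactInv X s) := by
  rw [map_sum, map_sum, Finset.mul_sum]
  refine Finset.sum_congr rfl fun s _ => ?_
  simp only [map_mul]
  rcases le_or_gt M s with h | h
  · rw [modXPow_pow_eq_zero dvd_rfl
      (h.trans (Nat.le_mul_self s |>.trans (by gcongr; omega)) : M ≤ s * (s + d))]
    ring
  · rw [modXPow_qFactInv dvd_rfl (by omega : M ≤ N - s)]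
    ring

theorem prod_range_five_mul {d : ℕ} (hd : d ≤ 1) (N : ℕ) :
    ∏ i ∈ Finset.range (5 * N), (1 - (X : PowerSeries ℤ) ^ (i + 1)) =
      (∏ k ∈ Finset.range N,
        ((1 - X ^ (5 * (k + 1) - (1 + d))) * (1 - X ^ (5 * (k + 1) - (4 - d))))) *
      (∏ k ∈ Finset.range N,
        ((1 - X ^ (5 * (k + 1) - (3 - 2 * d))) * (1 - X ^ (5 * (k + 1) - (2 + 2 * d))))) *
      ∏ k ∈ Finset.range N, (1 - (X ^ 5) ^ (k + 1)) := by
  induction N with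
  | zero => simp
  | succ N ih =>
    rw [show 5 * (N + 1) = 5 * N + 1 + 1 + 1 + 1 + 1 by ring]
    simp only [Finset.prod_range_succ, ih]
    rw [← pow_mul X 5 (N + 1)]
    interval_cases d
    · rw [show 5 * (N + 1) - (1 + 0) = 5 * N + 4 by omega,
        show 5 * (N + 1) - (4 - 0) = 5 * N + 1 by omega,
        show 5 * (N + 1) - (3 - 2 * 0) = 5 * N + 2 by omega,
        show 5 * (N + 1) - (2 + 2 * 0) = 5 * N + 3 by omega]
      ring
    · rw [show 5 * (N + 1) - (1 + 1) = 5 * N + 3 by omega,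
        show 5 * (N + 1) - (4 - 1) = 5 * N + 2 by omega,
        show 5 * (N + 1) - (3 - 2 * 1) = 5 * N + 4 by omega,
        show 5 * (N + 1) - (2 + 2 * 1) = 5 * N + 1 by omega]
      ring

theorem prod_mul_prod_inv1 {a b : ℕ → ℕ} (ha : ∀ k, a k ≠ 0) (hb : ∀ k, b k ≠ 0) (N : ℕ) :
    (∏ k ∈ Finset.range N, ((1 - (X : PowerSeries ℤ) ^ a k) * (1 - X ^ b k))) *
      ∏ k ∈ Finset.range N, inv1 ((1 - (X : PowerSeries ℤ) ^ a k) * (1 - X ^ b k)) = 1 := by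
  rw [← Finset.prod_mul_distrib]
  refine Finset.prod_eq_one fun k _ => mul_inv1 ?_
  simp [ha k, hb k]

/-- The Rogers–Ramanujan identities modulo `X ^ M`. -/
theorem modXPow_sum_eq_prod {d M N : ℕ} (hd : d ≤ 1) (hN : 2 * M ≤ N) :
    modXPow M (∑ s ∈ Finset.range (N + 1), X ^ (s * (s + d)) * qFactInv X s) =
      modXPow M (∏ k ∈ Finset.range N, inv1 ((1 - (X : PowerSeries ℤ) ^ (5 * (k + 1) - (1 + d))) *
        (1 - X ^ (5 * (k + 1) - (4 - d))))) := by
  have hX : (X : PowerSeries ℤ) ∣ X ^ 5 := dvd_pow_self X (by norm_num)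
  have hsum := congrArg (modXPow M) (sum_theta_eq_sum (qFactInv_zero dvd_rfl)
    (one_sub_pow_mul_qFactInv dvd_rfl) (one_sub_pow_ne_zero dvd_rfl) X_ne_zero hd le_rfl
    (N := N))
  have hprod := congrArg (modXPow M) (sum_theta_eq_prod (qFactInv_zero hX)
    (one_sub_pow_mul_qFactInv hX) (one_sub_pow_ne_zero hX) X_ne_zero hd (Nat.le_add_right N d))
  have h5 := modXPow_sum_theta hX hd hN (B := N + d) (u := 0)
  simp only [Nat.cast_zero, add_zero] at h5
  rw [modXPow_sum_theta dvd_rfl hd hN, modXPow_sum_qFactInv hN] at hsum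
  rw [h5, map_mul, modXPow_qFactInv hX (by omega : M ≤ 2 * N)] at hprod
  have hu1 := (isUnit_qFactInv (q := X) dvd_rfl M).map (modXPow M)
  have hu5 := (isUnit_qFactInv hX M).map (modXPow M)
  rw [sq, mul_assoc, hu1.mul_right_inj] at hsum
  rw [sq, mul_assoc, hu5.mul_right_inj] at hprod
  have hP := prod_mul_prod_inv1 (a := fun k => 5 * (k + 1) - (1 + d))
    (b := fun k => 5 * (k + 1) - (4 - d)) (by intro k; omega) (by intro k; omega) N
  have hN1 := prod_mul_qFactInv (q := X) dvd_rfl (5 * N)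
  have hN5 := prod_mul_qFactInv hX N
  rw [prod_range_five_mul hd] at hN1
  set P := ∏ k ∈ Finset.range N, ((1 - (X : PowerSeries ℤ) ^ (5 * (k + 1) - (1 + d))) *
    (1 - X ^ (5 * (k + 1) - (4 - d))))
  set C := ∏ k ∈ Finset.range N, inv1 ((1 - (X : PowerSeries ℤ) ^ (5 * (k + 1) - (1 + d))) *
    (1 - X ^ (5 * (k + 1) - (4 - d))))
  set Q := ∏ k ∈ Finset.range N, ((1 - (X : PowerSeries ℤ) ^ (5 * (k + 1) - (3 - 2 * d))) *
    (1 - X ^ (5 * (k + 1) - (2 + 2 * d))))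
  set F := ∏ k ∈ Finset.range N, (1 - ((X : PowerSeries ℤ) ^ 5) ^ (k + 1))
  have key : qFactInv X (5 * N) * Q = C * qFactInv (X ^ 5) N := by
    linear_combination C * qFactInv (X ^ 5) N * hN1 - qFactInv X (5 * N) * Q * hP -
      P * C * Q * qFactInv X (5 * N) * hN5
  have key' := congrArg (modXPow M) key
  rw [map_mul, map_mul, modXPow_qFactInv dvd_rfl (by omega : M ≤ 5 * N),
    modXPow_qFactInv hX (by omega : M ≤ N),
    ← hprod] at key'
  rw [← hsum]
  exact hu5.mul_left_cancel (by linear_combination key')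

theorem tendsto_of_X_pow_dvd {f : ℕ → PowerSeries ℤ} {S : PowerSeries ℤ}
    (h : ∀ N, X ^ (N / 2) ∣ f N - S) : Tendsto f atTop (nhds S) := by
  refine tendsto_pi_nhds.2 fun s => tendsto_const_nhds.congr' ?_
  filter_upwards [eventually_ge_atTop (2 * (s () + 1))] with N hN
  have := X_pow_dvd_iff.1 (h N) (s ()) (by omega)
  rw [map_sub, sub_eq_zero] at this
  have hs : s = Finsupp.single () (s ()) := by ext; simp
  rw [hs]
  exact this.symm

theorem exists_X_pow_dvd_sum_sub {f : ℕ → PowerSeries ℤ} (h : ∀ k, X ^ k ∣ f k) :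
    ∃ S, ∀ N, X ^ N ∣ ∑ k ∈ Finset.range N, f k - S := by
  refine ⟨mk fun n => coeff n (∑ k ∈ Finset.range (n + 1), f k), fun N => ?_⟩
  refine X_pow_dvd_iff.2 fun n hn => ?_
  rw [map_sub, coeff_mk, ← Finset.sum_range_add_sum_Ico f (show n + 1 ≤ N from hn), map_add,
    add_sub_cancel_left, map_sum]
  refine Finset.sum_eq_zero fun k hk => X_pow_dvd_iff.1 (h k) n ?_
  have := Finset.mem_Ico.1 hk
  omega

theorem exists_tendsto_prod_and_tendsto_sum {d : ℕ} (hd : d ≤ 1) :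
    ∃ S : PowerSeries ℤ,
      Tendsto (fun N : ℕ => ∏ k ∈ Finset.range N,
          inv1 ((1 - (X : PowerSeries ℤ) ^ (5 * (k + 1) - (1 + d))) *
            (1 - (X : PowerSeries ℤ) ^ (5 * (k + 1) - (4 - d)))))
        atTop (nhds S) ∧
      Tendsto (fun N : ℕ => ∑ k ∈ Finset.range N,
          (X : PowerSeries ℤ) ^ (k * (k + d)) * qFactInv X k) atTop (nhds S) := by
  obtain ⟨S, hS⟩ := exists_X_pow_dvd_sum_sub
    (f := fun k => (X : PowerSeries ℤ) ^ (k * (k + d)) * qFactInv X k)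
    fun k => (pow_dvd_pow X (by nlinarith [Nat.zero_le (k * d), Nat.le_mul_self k])).mul_right _
  refine ⟨S, tendsto_of_X_pow_dvd fun N => ?_, tendsto_of_X_pow_dvd fun N =>
    (pow_dvd_pow X (Nat.div_le_self N 2)).trans (hS N)⟩
  rw [← modXPow_eq_iff, ← modXPow_sum_eq_prod hd (by omega), modXPow_eq_iff]
  exact (pow_dvd_pow X (by omega)).trans (hS (N + 1))

end Truncation

/-- **The Rogers–Ramanujan identities** in `ℤ⟦X⟧`:
`∏_{k=1}^∞ ((1 − X^{5k−1})(1 − X^{5k−4}))⁻¹ = ∑_{k=0}^∞ X^{k²} (X^k!)⁻¹` and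
`∏_{k=1}^∞ ((1 − X^{5k−2})(1 − X^{5k−3}))⁻¹ = ∑_{k=0}^∞ X^{k²+k} (X^k!)⁻¹`. -/
theorem rogers_ramanujan_identities :
    (∃ S : PowerSeries ℤ,
      Tendsto (fun N : ℕ => ∏ k ∈ Finset.range N,
          inv1 ((1 - (X : PowerSeries ℤ) ^ (5 * (k + 1) - 1)) *
            (1 - (X : PowerSeries ℤ) ^ (5 * (k + 1) - 4))))
        atTop (nhds S) ∧
      Tendsto (fun N : ℕ => ∑ k ∈ Finset.range N,
          (X : PowerSeries ℤ) ^ (k ^ 2) * inv1 (Xfact k)) atTop (nhds S)) ∧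
    (∃ S : PowerSeries ℤ,
      Tendsto (fun N : ℕ => ∏ k ∈ Finset.range N,
          inv1 ((1 - (X : PowerSeries ℤ) ^ (5 * (k + 1) - 2)) *
            (1 - (X : PowerSeries ℤ) ^ (5 * (k + 1) - 3))))
        atTop (nhds S) ∧
      Tendsto (fun N : ℕ => ∑ k ∈ Finset.range N,
          (X : PowerSeries ℤ) ^ (k ^ 2 + k) * inv1 (Xfact k)) atTop (nhds S)) := by
  refine ⟨?_, ?_⟩
  · have h := exists_tendsto_prod_and_tendsto_sum (d := 0) (by norm_num)
    simp only [add_zero, ← sq] at h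
    exact h
  · have h := exists_tendsto_prod_and_tendsto_sum (d := 1) (by norm_num)
    simp only [mul_add, ← sq, mul_one] at h ⊢
    exact h
end

section
/- Schur's partition theorems: for every n ∈ ℕ, the number of partitions of n whose parts are pairwise distinct and pairwise differ by more than 1 equals the number of partitions of n all of whose parts are congruent to 1 or 4 modulo 5; and the number of partitions of n whose parts are all at least 2, pairwise distinct and pairwise differ by more than 1 equals the number of partitions of n all of whose parts are congruent to 2 or 3 modulo 5. -/
namespace SchurPartition

open Finset

section QBinomial

variable {R : Type*} [CommRing R] (q : R)

/-- The Gaussian binomial coefficient `[n; k]` at `q`, zero unless `0 ≤ k ≤ n`. -/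
def qBinom : ℕ → ℤ → R
  | 0, k => if k = 0 then 1 else 0
  | n + 1, k => qBinom n (k - 1) + q ^ k.toNat * qBinom n k

/-- The finite `q`-Pochhammer symbol `(q; q)_n`. -/
def qPoch (n : ℕ) : R := ∏ i ∈ range n, (1 - q ^ (i + 1))

theorem qPoch_succ (n : ℕ) : qPoch q (n + 1) = qPoch q n * (1 - q ^ (n + 1)) :=
  prod_range_succ _ _

theorem qBinom_succ (n : ℕ) (k : ℤ) :
    qBinom q (n + 1) k = qBinom q n (k - 1) + q ^ k.toNat * qBinom q n k := rfl

theorem qBinom_of_neg (n : ℕ) {k : ℤ} (hk : k < 0) : qBinom q n k = 0 := by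
  induction n generalizing k with
  | zero => simp [qBinom, hk.ne]
  | succ n ih => simp [qBinom_succ, ih hk, ih (show k - 1 < 0 by omega)]

theorem qBinom_of_lt (n : ℕ) {k : ℤ} (hk : (n : ℤ) < k) : qBinom q n k = 0 := by
  induction n generalizing k with
  | zero => simp [qBinom, show k ≠ 0 by omega]
  | succ n ih =>
    rw [qBinom_succ, ih (show (n : ℤ) < k by omega), ih (show (n : ℤ) < k - 1 by omega)]
    simp

theorem pow_mul_qBinom_congr (n : ℕ) (k : ℤ) {a b : ℕ} (h : 0 ≤ k → k ≤ n → a = b) :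
    q ^ a * qBinom q n k = q ^ b * qBinom q n k := by
  by_cases h0 : k < 0
  · simp [qBinom_of_neg q n h0]
  by_cases h1 : (n : ℤ) < k
  · simp [qBinom_of_lt q n h1]
  · rw [h (by omega) (by omega)]

theorem qBinom_succ' (n : ℕ) (k : ℤ) :
    qBinom q (n + 1) k = qBinom q n k + q ^ (n + 1 - k).toNat * qBinom q n (k - 1) := by
  induction n generalizing k with
  | zero =>
    rcases lt_trichotomy k 0 with h | rfl | h
    · simp [qBinom_of_neg q _ h, qBinom_of_neg q _ (show k - 1 < 0 by omega)]
    · simp [qBinom]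
    · obtain rfl | h := eq_or_ne k 1
      · simp [qBinom]
      · simp [qBinom, show k ≠ 0 by omega, show k - 1 ≠ 0 by omega]
  | succ n ih =>
    rw [qBinom_succ]
    have h := pow_mul_qBinom_congr q n (k - 1) (a := k.toNat + (n + 1 - k).toNat)
      (b := (((n + 1 : ℕ) : ℤ) + 1 - k).toNat + (k - 1).toNat) (by omega)
    have h' : ((n : ℤ) + 1 - (k - 1)).toNat = (((n + 1 : ℕ) : ℤ) + 1 - k).toNat := by
      congr 1; push_cast; ring
    have hk := ih (k - 1)
    rw [h'] at hk
    simp only [pow_add] at h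
    linear_combination h + hk + q ^ k.toNat * ih k - qBinom_succ q n k
      - q ^ (((n + 1 : ℕ) : ℤ) + 1 - k).toNat * qBinom_succ q n (k - 1)

theorem qBinom_zero_right (n : ℕ) : qBinom q n 0 = 1 := by
  induction n with
  | zero => simp [qBinom]
  | succ n ih => simp [qBinom_succ, ih, qBinom_of_neg]

theorem qBinom_self (n : ℕ) : qBinom q n n = 1 := by
  induction n with
  | zero => simp [qBinom]
  | succ n ih =>
    rw [qBinom_succ, qBinom_of_lt q n (k := ((n + 1 : ℕ) : ℤ)) (by push_cast; omega)]
    simp [ih]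

theorem qBinom_mul_qPoch (a b : ℕ) :
    qBinom q (a + b) a * (qPoch q a * qPoch q b) = qPoch q (a + b) := by
  induction h : a + b generalizing a b with
  | zero =>
    obtain ⟨rfl, rfl⟩ : a = 0 ∧ b = 0 := by omega
    simp [qBinom, qPoch]
  | succ n ih =>
    rcases a with _ | a
    · obtain rfl : b = n + 1 := by omega
      simp [qBinom_zero_right, qPoch]
    rcases b with _ | b
    · obtain rfl : a = n := by omega
      rw [qBinom_self]
      simp [qPoch]
    have h1 := ih a (b + 1) (by omega)
    have h2 := ih (a + 1) b (by omega)
    obtain rfl : n = a + b + 1 := by omega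
    rw [qBinom_succ, qPoch_succ q (a + b + 1)]
    simp only [Int.toNat_natCast]
    push_cast at h2 ⊢
    rw [add_sub_cancel_right]
    rw [qPoch_succ q a] at h2 ⊢
    rw [qPoch_succ q b] at h1 ⊢
    linear_combination (1 - q ^ (a + 1)) * h1 + q ^ (a + 1) * (1 - q ^ (b + 1)) * h2

variable {q}

theorem prod_one_sub_pow_eq_of_le {N M : ℕ} (hq : q ^ N = 0) (hNM : N ≤ M)
    (p : ℕ → Prop) [DecidablePred p] :
    ∏ i ∈ range M, (if p (i + 1) then 1 - q ^ (i + 1) else 1) =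
      ∏ i ∈ range N, (if p (i + 1) then 1 - q ^ (i + 1) else 1) := by
  refine (prod_subset (range_subset_range.2 hNM) fun i _ hi ↦ ?_).symm
  rw [pow_eq_zero_of_le (by grind) hq]
  simp

theorem qPoch_eq_of_le {N M : ℕ} (hq : q ^ N = 0) (hNM : N ≤ M) : qPoch q M = qPoch q N := by
  simpa [qPoch] using prod_one_sub_pow_eq_of_le hq hNM (fun _ ↦ True)

theorem isUnit_one_sub_pow {N : ℕ} (hq : q ^ N = 0) {k : ℕ} (hk : k ≠ 0) :
    IsUnit (1 - q ^ k) :=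
  IsNilpotent.isUnit_one_sub (IsNilpotent.pow_of_pos ⟨N, hq⟩ hk)

theorem isUnit_qPoch {N : ℕ} (hq : q ^ N = 0) (k : ℕ) : IsUnit (qPoch q k) := by
  induction k with
  | zero => simp [qPoch]
  | succ k ih =>
    rw [qPoch_succ]
    exact ih.mul (isUnit_one_sub_pow hq k.succ_ne_zero)

theorem qBinom_mul_qPoch_of_pow_eq_zero {N n : ℕ} (hq : q ^ N = 0) {k : ℤ}
    (hk : (N : ℤ) ≤ k) (hk' : k + N ≤ n) : qBinom q n k * qPoch q N = 1 := by
  lift k to ℕ using by omega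
  obtain ⟨b, rfl⟩ := Nat.exists_eq_add_of_le (show k ≤ n by omega)
  have h := qBinom_mul_qPoch q k b
  rw [qPoch_eq_of_le hq (show N ≤ k by omega), qPoch_eq_of_le hq (show N ≤ b by omega),
    qPoch_eq_of_le hq (show N ≤ k + b by omega)] at h
  exact (isUnit_qPoch hq N).mul_right_cancel (by rw [mul_assoc, h, one_mul])

end QBinomial

section Theta

theorem sum_Icc_sub_succ {A : Type*} [AddCommGroup A] (f : ℤ → A) (M : ℕ) :
    ∑ j ∈ Icc (-(M : ℤ)) M, (f j - f (j + 1)) = f (-M) - f (M + 1) := by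
  induction M with
  | zero => simp
  | succ M ih =>
    have h : Icc (-((M + 1 : ℕ) : ℤ)) ((M + 1 : ℕ) : ℤ) =
        insert (-((M : ℤ) + 1)) (insert ((M : ℤ) + 1) (Icc (-(M : ℤ)) M)) := by
      ext j; simp only [mem_Icc, mem_insert]; push_cast; omega
    rw [h, sum_insert (by simp; omega), sum_insert (by simp), ih]
    push_cast
    rw [neg_add_rev, neg_add_cancel_comm]
    abel

/-- The exponent `j (5 j + 1 - 4 s) / 2` of the theta series. -/
def thetaExp (s : ℕ) (j : ℤ) : ℕ := (j * (5 * j + 1 - 4 * s) / 2).toNat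

variable {s : ℕ}

theorem two_mul_thetaExp (hs : s ≤ 1) (j : ℤ) :
    2 * (thetaExp s j : ℤ) = j * (5 * j + 1 - 4 * s) := by
  have h2 : (2 : ℤ) ∣ j * (5 * j + 1 - 4 * s) := by
    rcases Int.even_or_odd' j with ⟨c, rfl | rfl⟩
    · exact ⟨c * (5 * (2 * c) + 1 - 4 * s), by ring⟩
    · exact ⟨(2 * c + 1) * (5 * c + 3 - 2 * s), by ring⟩
  have h0 : 0 ≤ j * (5 * j + 1 - 4 * s) := by
    interval_cases s <;> push_cast <;> rcases lt_trichotomy j 0 with h | rfl | h <;> nlinarith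
  rw [thetaExp, Int.toNat_of_nonneg (Int.ediv_nonneg h0 (by norm_num)), Int.mul_ediv_cancel' h2]

theorem thetaExp_succ (hs : s ≤ 1) (j : ℤ) :
    (thetaExp s (j + 1) : ℤ) = thetaExp s j + 5 * j + 3 - 2 * s := by
  have h1 := two_mul_thetaExp hs j
  have h2 := two_mul_thetaExp hs (j + 1)
  linarith

theorem abs_le_thetaExp (hs : s ≤ 1) (j : ℤ) : |j| ≤ thetaExp s j := by
  have h := two_mul_thetaExp hs j
  interval_cases s <;> push_cast at h <;>
    rcases lt_trichotomy j 0 with h' | rfl | h' <;>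
    first
    | (rw [abs_of_neg h']; nlinarith)
    | (rw [abs_of_pos h']; nlinarith)
    | simp

variable {R : Type*} [CommRing R] (q : R)

/-- The theta series term `(-1) ^ j * q ^ (j (5 j + 1 - 4 s) / 2)`. -/
def thetaTerm (s : ℕ) (j : ℤ) : R := ((j.negOnePow : ℤ) : R) * q ^ thetaExp s j

theorem negOnePow_succ_cast (j : ℤ) :
    (((j + 1).negOnePow : ℤ) : R) = -((j.negOnePow : ℤ) : R) := by
  simp [Int.negOnePow_succ]

/-- Finite form of the Jacobi triple product, specialised to the base `q ^ 5`. -/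
theorem sum_thetaTerm_mul_qBinom (hs : s ≤ 1) (n M : ℕ) (hnM : n ≤ M) :
    ∑ j ∈ Icc (-(M : ℤ)) M, thetaTerm q s j * qBinom (q ^ 5) (2 * n) (n + j) =
      ∏ i ∈ range n, ((1 - q ^ (5 * i + (3 - 2 * s))) * (1 - q ^ (5 * i + (2 + 2 * s)))) := by
  induction n with
  | zero =>
    rw [sum_eq_single 0]
    · simp [thetaTerm, thetaExp, qBinom]
    · intro j _ hj
      simp [qBinom, hj]
    · simp
  | succ n ih =>
    rw [prod_range_succ, ← ih (by omega), sum_mul, ← sub_eq_zero, ← sum_sub_distrib]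
    set t : ℤ → R := fun j ↦ thetaTerm q s j * qBinom (q ^ 5) (2 * n) (n + j) with ht
    have hstep (j : ℤ) : thetaTerm q s j * qBinom (q ^ 5) (2 * (n + 1)) ((n + 1 : ℕ) + j) =
        (1 + q ^ (10 * n + 5)) * t j - q ^ (5 * n + (3 - 2 * s)) * t (j - 1)
          - q ^ (5 * n + (2 + 2 * s)) * t (j + 1) := by
      have hb : qBinom (q ^ 5) (2 * (n + 1)) ((n + 1 : ℕ) + j) =
          (1 + q ^ (10 * n + 5)) * qBinom (q ^ 5) (2 * n) (n + j)
          + (q ^ 5) ^ (n + 1 - j).toNat * qBinom (q ^ 5) (2 * n) (n + (j - 1))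
          + (q ^ 5) ^ (n + 1 + j).toNat * qBinom (q ^ 5) (2 * n) (n + (j + 1)) := by
        rw [show 2 * (n + 1) = 2 * n + 1 + 1 by ring, qBinom_succ, qBinom_succ',
          qBinom_succ' _ (2 * n)]
        have h := pow_mul_qBinom_congr (q ^ 5) (2 * n) (n + j)
          (a := (n + 1 + j).toNat + (n - j).toNat) (b := 2 * n + 1) (by push_cast; omega)
        have e1 : ((n + 1 : ℕ) + j - 1 : ℤ) = n + j := by push_cast; ring
        have e2 : ((n + 1 : ℕ) + j : ℤ) = n + (j + 1) := by push_cast; ring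
        have e3 : (n + j - 1 : ℤ) = n + (j - 1) := by ring
        have e5 : (((2 * n : ℕ) : ℤ) + 1 - (n + j)).toNat = (n + 1 - j).toNat := by omega
        have e6 : (((2 * n : ℕ) : ℤ) + 1 - (n + (j + 1))).toNat = (n - j).toNat := by omega
        have e7 : (n + (j + 1) : ℤ).toNat = (n + 1 + j).toNat := by omega
        rw [e1, e2, e3, e5, e6, e7]
        rw [pow_add, ← pow_mul q 5 (2 * n + 1)] at h
        linear_combination h
      have hl : q ^ thetaExp s j * ((q ^ 5) ^ (n + 1 - j).toNat
            * qBinom (q ^ 5) (2 * n) (n + (j - 1))) =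
          q ^ (5 * n + (3 - 2 * s)) *
            (q ^ thetaExp s (j - 1) * qBinom (q ^ 5) (2 * n) (n + (j - 1))) := by
        have he := thetaExp_succ hs (j - 1)
        rw [sub_add_cancel] at he
        by_cases h : 2 * (n : ℤ) < n + (j - 1)
        · simp [qBinom_of_lt _ _ (show ((2 * n : ℕ) : ℤ) < n + (j - 1) by push_cast; exact h)]
        · rw [← mul_assoc, ← mul_assoc, ← pow_mul, ← pow_add, ← pow_add]
          congr 2
          omega
      have hr : q ^ thetaExp s j * ((q ^ 5) ^ (n + 1 + j).toNat
            * qBinom (q ^ 5) (2 * n) (n + (j + 1))) =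
          q ^ (5 * n + (2 + 2 * s)) *
            (q ^ thetaExp s (j + 1) * qBinom (q ^ 5) (2 * n) (n + (j + 1))) := by
        have he := thetaExp_succ hs j
        by_cases h : n + (j + 1) < 0
        · simp [qBinom_of_neg _ _ h]
        · rw [← mul_assoc, ← mul_assoc, ← pow_mul, ← pow_add, ← pow_add]
          congr 2
          omega
      have hn := negOnePow_succ_cast (R := R) (j - 1)
      rw [sub_add_cancel] at hn
      rw [hb]
      simp only [ht, thetaTerm, negOnePow_succ_cast]
      linear_combination ((j.negOnePow : ℤ) : R) * hl + ((j.negOnePow : ℤ) : R) * hr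
        + q ^ (5 * n + (3 - 2 * s)) *
            (q ^ thetaExp s (j - 1) * qBinom (q ^ 5) (2 * n) (n + (j - 1))) * hn
    have hp : q ^ (5 * n + (3 - 2 * s)) * q ^ (5 * n + (2 + 2 * s)) = q ^ (10 * n + 5) := by
      rw [← pow_add]; congr 1; omega
    have htel (j : ℤ) : thetaTerm q s j * qBinom (q ^ 5) (2 * (n + 1)) ((n + 1 : ℕ) + j) -
        t j * ((1 - q ^ (5 * n + (3 - 2 * s))) * (1 - q ^ (5 * n + (2 + 2 * s)))) =
        q ^ (5 * n + (2 + 2 * s)) * (t j - t (j + 1))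
        - q ^ (5 * n + (3 - 2 * s)) * (t (j - 1) - t (j + 1 - 1)) := by
      rw [hstep, add_sub_cancel_right]
      linear_combination (-t j) * hp
    rw [sum_congr rfl fun j _ ↦ htel j, sum_sub_distrib, ← mul_sum, ← mul_sum,
      sum_Icc_sub_succ t M, sum_Icc_sub_succ (fun j ↦ t (j - 1)) M]
    simp only [ht]
    rw [qBinom_of_neg _ _ (show (n : ℤ) + -M < 0 by omega),
      qBinom_of_neg _ _ (show (n : ℤ) + (-M - 1) < 0 by omega),
      qBinom_of_lt _ _ (show ((2 * n : ℕ) : ℤ) < n + (M + 1) by omega),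
      qBinom_of_lt _ _ (show ((2 * n : ℕ) : ℤ) < n + (M + 1 - 1) by omega)]
    simp

/-- Schur's recurrence: `schurSeq q s (m + 1)` enumerates the sets of integers in `(s, m]`
without two consecutive elements by their sum. -/
def schurSeq (s : ℕ) : ℕ → R
  | 0 => if s = 0 then 1 else 0
  | 1 => 1
  | m + 2 => schurSeq s (m + 1) + q ^ (m + 1) * schurSeq s m

/-- Schur's finite form of the Rogers-Ramanujan identities. -/
theorem sum_thetaTerm_mul_qBinom_eq_schurSeq (hs : s ≤ 1) (m M : ℕ) (hmM : m ≤ M) :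
    ∑ j ∈ Icc (-(M : ℤ)) M, thetaTerm q s j * qBinom q m ((m - 5 * j) / 2 + s) =
      schurSeq q s m := by
  induction m using Nat.twoStepInduction with
  | zero =>
    rw [sum_eq_single 0]
    · interval_cases s <;> simp [thetaTerm, thetaExp, qBinom, schurSeq]
    · intro j _ hj
      simp only [qBinom]
      rw [if_neg (by push_cast; omega), mul_zero]
    · simp
  | one =>
    rw [sum_eq_single 0]
    · interval_cases s <;> simp [thetaTerm, thetaExp, qBinom, schurSeq]
    · intro j _ hj
      rcases hj.lt_or_gt with h | h
      · rw [qBinom_of_lt _ _ (by push_cast; omega), mul_zero]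
      · rw [qBinom_of_neg _ _ (by push_cast; omega), mul_zero]
    · simp
  | more m ih1 ih2 =>
    rw [schurSeq, ← ih1 (by omega), ← ih2 (by omega), mul_sum, ← sum_add_distrib, ← sub_eq_zero,
      ← sum_sub_distrib]
    set g : ℤ → R := fun j ↦ if (2 : ℤ) ∣ m - j then
      thetaTerm q s j * (q ^ ((m + 2 - 5 * j) / 2 + s : ℤ).toNat
        * qBinom q m ((m + 2 - 5 * j) / 2 + s)) else 0 with hg
    have hstep (j : ℤ) : thetaTerm q s j * qBinom q (m + 2) (((m + 2 : ℕ) - 5 * j) / 2 + s) -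
        (thetaTerm q s j * qBinom q (m + 1) (((m + 1 : ℕ) - 5 * j) / 2 + s) +
          q ^ (m + 1) * (thetaTerm q s j * qBinom q m ((m - 5 * j) / 2 + s))) =
        g j - g (j + 1) := by
      obtain ⟨k, hk⟩ : ∃ k : ℤ, k = (m + 2 - 5 * j) / 2 + s := ⟨_, rfl⟩
      by_cases hj : (2 : ℤ) ∣ m - j
      · rw [hg]
        simp only [if_pos hj, if_neg (show ¬ (2 : ℤ) ∣ m - (j + 1) by omega), ← hk]
        rw [show (((m + 2 : ℕ) - 5 * j) / 2 + s : ℤ) = k by push_cast; omega,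
          show (((m + 1 : ℕ) - 5 * j) / 2 + s : ℤ) = k - 1 by push_cast; omega,
          show ((m - 5 * j) / 2 + s : ℤ) = k - 1 by omega]
        have h := pow_mul_qBinom_congr q m (k - 1) (a := k.toNat + (m + 1 - k).toNat)
          (b := m + 1) (by omega)
        rw [pow_add] at h
        linear_combination thetaTerm q s j *
          (qBinom_succ q (m + 1) k + q ^ k.toNat * qBinom_succ' q m k + h)
      · rw [hg]
        simp only [if_neg hj, if_pos (show (2 : ℤ) ∣ m - (j + 1) by omega)]
        rw [show (((m + 2 : ℕ) - 5 * j) / 2 + s : ℤ) = k by push_cast; omega,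
          show (((m + 1 : ℕ) - 5 * j) / 2 + s : ℤ) = k by push_cast; omega,
          show ((m - 5 * j) / 2 + s : ℤ) = k - 1 by omega,
          show ((m + 2 - 5 * (j + 1)) / 2 + s : ℤ) = k - 1 - 1 by omega]
        have h := pow_mul_qBinom_congr q m (k - 1)
          (a := (((m + 1 : ℕ) : ℤ) + 1 - k).toNat + (k - 1).toNat)
          (b := m + 1) (by push_cast; omega)
        have h' := pow_mul_qBinom_congr q m (k - 1 - 1)
          (a := thetaExp s j + (((m + 1 : ℕ) : ℤ) + 1 - k).toNat)
          (b := thetaExp s (j + 1) + (k - 1 - 1).toNat)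
          (by have := thetaExp_succ hs j; push_cast; omega)
        rw [pow_add] at h
        rw [pow_add, pow_add] at h'
        simp only [thetaTerm, negOnePow_succ_cast]
        linear_combination ((j.negOnePow : ℤ) : R) * q ^ thetaExp s j *
          (qBinom_succ' q (m + 1) k + q ^ (((m + 1 : ℕ) : ℤ) + 1 - k).toNat *
            qBinom_succ q m (k - 1) + h) + ((j.negOnePow : ℤ) : R) * h'
    rw [sum_congr rfl fun j _ ↦ hstep j, sum_Icc_sub_succ]
    simp only [hg]
    rw [qBinom_of_lt _ _ (by omega), qBinom_of_neg _ _ (by omega)]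
    simp

variable {q}

theorem thetaTerm_mul_eq_of_pow_eq_zero {N : ℕ} (hs : s ≤ 1) (hq : q ^ N = 0) (j : ℤ) {a b : R}
    (h : |j| < N → a * b = 1) : thetaTerm q s j * a * b = thetaTerm q s j := by
  by_cases hj : |j| < N
  · rw [mul_assoc, h hj, mul_one]
  · have := abs_le_thetaExp hs j
    simp [thetaTerm, pow_eq_zero_of_le (show N ≤ thetaExp s j by omega) hq]

theorem qPoch_five_mul (hs : s ≤ 1) (n : ℕ) : qPoch q (5 * n) =
    (∏ i ∈ range n, ((1 - q ^ (5 * i + (3 - 2 * s))) * (1 - q ^ (5 * i + (2 + 2 * s))))) *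
      qPoch (q ^ 5) n *
      ∏ i ∈ range (5 * n), (if (i + 1) % 5 = 1 + s ∨ (i + 1) % 5 = 4 - s
        then 1 - q ^ (i + 1) else 1) := by
  induction n with
  | zero => simp [qPoch]
  | succ n ih =>
    rw [show 5 * (n + 1) = 5 * n + 1 + 1 + 1 + 1 + 1 by ring]
    simp only [qPoch_succ, prod_range_succ, ih, ← pow_mul]
    interval_cases s <;> simp [Nat.add_mod, add_assoc] <;> ring

/-- Modulo `q ^ N`, the enumerator of sets without consecutive elements is the inverse of the
product over the relevant residue classes modulo `5`. -/
theorem schurSeq_mul_prod_eq_one {N m : ℕ} (hs : s ≤ 1) (hq : q ^ N = 0) (hm : 7 * N + 2 ≤ m) :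
    schurSeq q s m * ∏ i ∈ range N, (if (i + 1) % 5 = 1 + s ∨ (i + 1) % 5 = 4 - s
        then 1 - q ^ (i + 1) else 1) = 1 := by
  have hq5 : (q ^ 5) ^ N = 0 := by rw [← pow_mul, mul_comm, pow_mul, hq, zero_pow (by norm_num)]
  have h1 : schurSeq q s m * qPoch q N = ∑ j ∈ Icc (-(m : ℤ)) m, thetaTerm q s j := by
    rw [← sum_thetaTerm_mul_qBinom_eq_schurSeq q hs m m le_rfl, sum_mul]
    refine sum_congr rfl fun j _ ↦ thetaTerm_mul_eq_of_pow_eq_zero hs hq j fun hj ↦ ?_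
    rw [abs_lt] at hj
    exact qBinom_mul_qPoch_of_pow_eq_zero hq (by omega) (by omega)
  have h2 := sum_thetaTerm_mul_qBinom q hs (2 * N) m (by omega)
  apply_fun (· * qPoch (q ^ 5) N) at h2
  have h3 : (∑ j ∈ Icc (-(m : ℤ)) m,
      thetaTerm q s j * qBinom (q ^ 5) (2 * (2 * N)) ((2 * N : ℕ) + j)) * qPoch (q ^ 5) N =
      ∑ j ∈ Icc (-(m : ℤ)) m, thetaTerm q s j := by
    rw [sum_mul]
    refine sum_congr rfl fun j _ ↦ thetaTerm_mul_eq_of_pow_eq_zero hs hq j fun hj ↦ ?_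
    rw [abs_lt] at hj
    exact qBinom_mul_qPoch_of_pow_eq_zero hq5 (by push_cast; omega) (by push_cast; omega)
  have h4 := qPoch_five_mul (q := q) hs (2 * N)
  rw [prod_one_sub_pow_eq_of_le hq (by omega) (fun k ↦ k % 5 = 1 + s ∨ k % 5 = 4 - s),
    qPoch_eq_of_le hq (by omega), qPoch_eq_of_le hq5 (by omega : N ≤ 2 * N)] at h4
  refine (isUnit_qPoch hq N).mul_right_cancel ?_
  rw [mul_right_comm, h1, ← h3, h2, one_mul, h4]

end Theta

section Counting

/-- `t` consists of integers greater than `s`, no two of them consecutive. -/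
def IsGapSet (s : ℕ) (t : Finset ℕ) : Prop := ∀ i ∈ t, s < i ∧ i + 1 ∉ t

instance (s : ℕ) : DecidablePred (IsGapSet s) := fun t ↦ by unfold IsGapSet; infer_instance

theorem schurSeq_eq_sum_gapSet {R : Type*} [CommRing R] (q : R) {s : ℕ} (hs : s ≤ 1) (m : ℕ) :
    schurSeq q s (m + 1) =
      ∑ t ∈ (range (m + 1)).powerset, if IsGapSet s t then q ^ (∑ i ∈ t, i) else 0 := by
  induction m using Nat.twoStepInduction with
  | zero =>
    rw [range_add_one, sum_powerset_insert (by simp)]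
    simp [IsGapSet, schurSeq]
  | one =>
    rw [range_add_one, sum_powerset_insert (by simp), range_add_one, sum_powerset_insert (by simp),
      sum_powerset_insert (by simp)]
    interval_cases s <;> simp [IsGapSet, schurSeq]
  | more m ih1 ih2 =>
    rw [schurSeq, ih1, ih2, range_add_one (n := m + 2), sum_powerset_insert (by simp)]
    congr 1
    rw [range_add_one (n := m + 1), sum_powerset_insert (by simp), mul_sum, eq_comm]
    rw [sum_eq_zero (s := (range (m + 1)).powerset) (f := fun t ↦ if IsGapSet s (insert (m + 2)
      (insert (m + 1) t)) then q ^ (∑ i ∈ insert (m + 2) (insert (m + 1) t), i) else 0), add_zero]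
    · refine sum_congr rfl fun t ht ↦ ?_
      have hlt : ∀ i ∈ t, i < m + 1 := fun i hi ↦ mem_range.1 (mem_powerset.1 ht hi)
      have hmem : m + 2 ∉ t := fun h ↦ by have := hlt _ h; omega
      have hiff : IsGapSet s (insert (m + 2) t) ↔ IsGapSet s t := by
        simp only [IsGapSet, mem_insert]
        constructor
        · intro h i hi
          have := h i (Or.inr hi)
          tauto
        · rintro h i (rfl | hi)
          · refine ⟨by omega, ?_⟩
            rintro (h' | h')
            · omega
            · have := hlt _ h'
              omega
          · refine ⟨(h i hi).1, ?_⟩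
            rintro (h' | h')
            · have := hlt _ hi
              omega
            · exact (h i hi).2 h'
      simp only [hiff, sum_insert hmem, mul_ite, mul_zero, pow_add q (m + 2)]
    · intro t _
      refine if_neg fun h ↦ ?_
      exact (h (m + 1) (by simp)).2 (by simp)

open PowerSeries in
theorem coeff_schurSeq_X {s : ℕ} (hs : s ≤ 1) (m n : ℕ) :
    coeff n (schurSeq (X : ℤ⟦X⟧) s (m + 1)) =
      #{t ∈ (range (m + 1)).powerset | IsGapSet s t ∧ ∑ i ∈ t, i = n} := by
  rw [schurSeq_eq_sum_gapSet _ hs, map_sum, card_filter, Nat.cast_sum]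
  refine sum_congr rfl fun t _ ↦ ?_
  split_ifs <;> simp_all [coeff_X_pow, eq_comm]

theorem card_gapPartition {s m n : ℕ} (hn : n ≤ m) :
    Nat.card {p : Nat.Partition n // (∀ i ∈ p.parts, s < i) ∧ p.parts.Nodup ∧
      ∀ i ∈ p.parts, ∀ j ∈ p.parts, i < j → i + 1 < j} =
      #{t ∈ (range (m + 1)).powerset | IsGapSet s t ∧ ∑ i ∈ t, i = n} := by
  classical
  rw [Nat.card_eq_fintype_card, Fintype.card_subtype]
  refine card_bij (fun p _ ↦ p.parts.toFinset) ?_ ?_ ?_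
  · intro p hp
    obtain ⟨hs, hnd, hgap⟩ := (mem_filter.1 hp).2
    simp only [mem_filter, mem_powerset]
    refine ⟨fun i hi ↦ ?_, fun i hi ↦ ⟨hs i (by simpa using hi), fun hi' ↦ ?_⟩, ?_⟩
    · have := Nat.Partition.le_of_mem_parts (Multiset.mem_toFinset.1 hi)
      simp only [mem_range]
      omega
    · have := hgap i (by simpa using hi) (i + 1) (by simpa using hi') (by omega)
      omega
    · rw [sum_eq_multiset_sum, Multiset.map_id', Multiset.toFinset_val, hnd.dedup, p.parts_sum]
  · intro p hp p' hp' h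
    have hnd := (mem_filter.1 hp).2.2.1
    have hnd' := (mem_filter.1 hp').2.2.1
    have hval := congrArg Finset.val h
    rw [Multiset.toFinset_val, Multiset.toFinset_val, hnd.dedup, hnd'.dedup] at hval
    exact Nat.Partition.ext hval
  · intro t ht
    obtain ⟨-, hgap, hsum⟩ := mem_filter.1 ht
    refine ⟨⟨t.val, fun {i} hi ↦ by have := (hgap i hi).1; omega, ?_⟩, ?_, ?_⟩
    · rw [← hsum, sum_eq_multiset_sum, Multiset.map_id']
    · simp only [mem_filter, mem_univ, true_and]
      refine ⟨fun i hi ↦ (hgap i hi).1, t.nodup, fun i hi j hj hij ↦ ?_⟩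
      have : i + 1 ≠ j := by
        rintro rfl
        exact (hgap i hi).2 hj
      omega
    · simp

open PowerSeries PowerSeries.WithPiTopology in
theorem X_pow_dvd_card_restricted_mul_prod (P : ℕ → Prop) [DecidablePred P] (N : ℕ) :
    (X : ℤ⟦X⟧) ^ N ∣ (PowerSeries.mk fun n ↦ (#(Nat.Partition.restricted n P) : ℤ)) *
      ∏ i ∈ range N, (if P (i + 1) then 1 - X ^ (i + 1) else 1) - 1 := by
  have h := Nat.Partition.hasProd_powerSeriesMk_card_restricted ℤ P
  set G : ℤ⟦X⟧ := PowerSeries.mk fun n ↦ (#(Nat.Partition.restricted n P) : ℤ)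
  rw [HasProd, WithPiTopology.tendsto_iff_coeff_tendsto] at h
  simp only [nhds_discrete, Filter.tendsto_pure] at h
  obtain ⟨M, hNM, hM⟩ := (((Filter.eventually_all_finset (range N)).2 fun d _ ↦ h d).and
    (Filter.eventually_ge_atTop (range N))).exists |>.imp fun _ h ↦ h.symm
  have hG : (X : ℤ⟦X⟧) ^ N ∣ G -
      ∏ i ∈ M, (if P (i + 1) then ∑' j : ℕ, X ^ ((i + 1) * j) else 1) := by
    rw [X_pow_dvd_iff]
    intro d hd
    rw [map_sub, hM d (mem_range.2 hd), sub_self]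
  have hD : (X : ℤ⟦X⟧) ^ N ∣ ∏ i ∈ M, (if P (i + 1) then 1 - X ^ (i + 1) else 1) -
      ∏ i ∈ range N, (if P (i + 1) then 1 - X ^ (i + 1) else 1) := by
    rw [← Ideal.mem_span_singleton, ← Ideal.Quotient.eq, map_prod, map_prod]
    refine (prod_subset hNM fun i _ hi ↦ ?_).symm
    split_ifs
    · rw [← map_one (Ideal.Quotient.mk _), Ideal.Quotient.eq, Ideal.mem_span_singleton]
      simpa using pow_dvd_pow (X : ℤ⟦X⟧) (show N ≤ i + 1 by grind)
    · simp
  have h1 : (∏ i ∈ M, (if P (i + 1) then ∑' j : ℕ, (X : ℤ⟦X⟧) ^ ((i + 1) * j) else 1)) *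
      ∏ i ∈ M, (if P (i + 1) then 1 - X ^ (i + 1) else 1) = 1 := by
    rw [← prod_mul_distrib]
    refine prod_eq_one fun i _ ↦ ?_
    split_ifs
    · simp only [pow_mul]
      exact tsum_pow_mul_one_sub_of_constantCoeff_eq_zero (by simp)
    · simp
  obtain ⟨a, ha⟩ := hG
  obtain ⟨b, hb⟩ := hD
  refine ⟨a * ∏ i ∈ M, (if P (i + 1) then 1 - X ^ (i + 1) else 1) - G * b, ?_⟩
  linear_combination (∏ i ∈ M, (if P (i + 1) then 1 - X ^ (i + 1) else 1)) * ha - G * hb + h1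

open PowerSeries in
theorem card_gapPartition_eq_card_restricted {s : ℕ} (hs : s ≤ 1) (n : ℕ) :
    Nat.card {p : Nat.Partition n // (∀ i ∈ p.parts, s < i) ∧ p.parts.Nodup ∧
      ∀ i ∈ p.parts, ∀ j ∈ p.parts, i < j → i + 1 < j} =
      #(Nat.Partition.restricted n fun i ↦ i % 5 = 1 + s ∨ i % 5 = 4 - s) := by
  set π := Ideal.Quotient.mk (Ideal.span {(X : ℤ⟦X⟧) ^ (n + 1)}) with hπ
  set m := 7 * (n + 1) + 1 with hm
  have hmap : π (schurSeq X s (m + 1)) = schurSeq (π X) s (m + 1) := by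
    simp only [schurSeq_eq_sum_gapSet _ hs, map_sum, apply_ite π, map_pow, map_zero]
  have hX : π X ^ (n + 1) = 0 := by
    rw [← map_pow, hπ, Ideal.Quotient.eq_zero_iff_mem]
    exact Ideal.mem_span_singleton_self _
  have h1 := schurSeq_mul_prod_eq_one hs hX (show 7 * (n + 1) + 2 ≤ m + 1 by omega)
  have h2 := X_pow_dvd_card_restricted_mul_prod (fun i ↦ i % 5 = 1 + s ∨ i % 5 = 4 - s) (n + 1)
  rw [← Ideal.mem_span_singleton, ← Ideal.Quotient.eq, ← hπ, map_mul, map_prod] at h2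
  simp only [apply_ite π, map_sub, map_one, map_pow] at h2
  have h3 := hmap.trans (left_inv_eq_right_inv h1 ((mul_comm _ _).trans h2))
  rw [hπ, Ideal.Quotient.eq, Ideal.mem_span_singleton, X_pow_dvd_iff] at h3
  have h4 := h3 n (by omega)
  rw [map_sub, sub_eq_zero, coeff_schurSeq_X hs, coeff_mk,
    ← card_gapPartition (show n ≤ m by omega)] at h4
  exact_mod_cast h4

end Counting

end SchurPartition

/-- **Schur's partition theorems**: the number of partitions of `n` into parts that are
pairwise distinct and pairwise differ by more than 1 equals the number of partitions of `n`
into parts congruent to `±1 (mod 5)`; and the number of partitions of `n` into parts that are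
at least 2, pairwise distinct and pairwise differ by more than 1 equals the number of
partitions of `n` into parts congruent to `±2 (mod 5)`. -/
theorem schur_partition_theorems (n : ℕ) :
    (Nat.card {p : Nat.Partition n //
        p.parts.Nodup ∧ ∀ i ∈ p.parts, ∀ j ∈ p.parts, i < j → i + 1 < j} =
      Nat.card {p : Nat.Partition n // ∀ i ∈ p.parts, i % 5 = 1 ∨ i % 5 = 4}) ∧
    (Nat.card {p : Nat.Partition n //
        (∀ i ∈ p.parts, 2 ≤ i) ∧ p.parts.Nodup ∧
          ∀ i ∈ p.parts, ∀ j ∈ p.parts, i < j → i + 1 < j} =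
      Nat.card {p : Nat.Partition n // ∀ i ∈ p.parts, i % 5 = 2 ∨ i % 5 = 3}) := by
  have key {s : ℕ} (hs : s ≤ 1) := SchurPartition.card_gapPartition_eq_card_restricted hs n
  constructor
  · convert! key zero_le_one using 1
    · refine Nat.card_congr (Equiv.subtypeEquivRight fun p ↦ ?_)
      simp only [iff_and_self]
      exact fun _ i hi ↦ p.parts_pos hi
    · simp [Nat.Partition.restricted, Nat.card_eq_fintype_card, Fintype.card_subtype]
  · convert! key le_rfl using 1
    simp [Nat.Partition.restricted, Nat.card_eq_fintype_card, Fintype.card_subtype]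
end

section
/- Ramanujan's partition congruences: for every n ∈ ℕ, p(5n+4) is divisible by 5 and p(7n+5) is divisible by 7. -/
open Finset PowerSeries

section QBinomial

variable {S : Type*} [CommRing S]

/-- The `q`-Pochhammer product `(1 - q) (1 - q ^ 2) ⋯ (1 - q ^ n)`. -/
def qPochhammer (q : S) (n : ℕ) : S := ∏ i ∈ range n, (1 - q ^ (i + 1))

/-- The Gaussian binomial coefficient with lower indices `k` and `l` and upper index `k + l`. -/
def gaussBinom (q : S) : ℕ → ℕ → S
  | 0, _ => 1
  | _ + 1, 0 => 1
  | k + 1, l + 1 => gaussBinom q k (l + 1) + q ^ (k + 1) * gaussBinom q (k + 1) l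

theorem gaussBinom_zero_left (q : S) (l : ℕ) : gaussBinom q 0 l = 1 := by
  simp [gaussBinom]

theorem gaussBinom_zero_right (q : S) (k : ℕ) : gaussBinom q k 0 = 1 := by
  cases k <;> simp [gaussBinom]

theorem gaussBinom_succ_succ (q : S) (k l : ℕ) : gaussBinom q (k + 1) (l + 1) =
    gaussBinom q k (l + 1) + q ^ (k + 1) * gaussBinom q (k + 1) l := by
  rw [gaussBinom]

theorem qPochhammer_succ (q : S) (n : ℕ) :
    qPochhammer q (n + 1) = qPochhammer q n * (1 - q ^ (n + 1)) :=
  prod_range_succ _ _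

theorem map_gaussBinom {T : Type*} [CommRing T] (f : S →+* T) (q : S) (k l : ℕ) :
    f (gaussBinom q k l) = gaussBinom (f q) k l := by
  induction k generalizing l with
  | zero => simp [gaussBinom_zero_left]
  | succ k ihk =>
    induction l with
    | zero => simp [gaussBinom_zero_right]
    | succ l ihl => simp [gaussBinom_succ_succ, ihk, ihl]

theorem gaussBinom_mul_qPochhammer (q : S) (k l : ℕ) :
    gaussBinom q k l * (qPochhammer q k * qPochhammer q l) = qPochhammer q (k + l) := by
  induction k generalizing l with
  | zero => simp [gaussBinom_zero_left, qPochhammer]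
  | succ k ihk =>
    induction l with
    | zero => simp [gaussBinom_zero_right, qPochhammer]
    | succ l ihl =>
      have h₁ := ihk (l + 1)
      rw [show k + 1 + l = k + (l + 1) by ring, qPochhammer_succ q k] at ihl
      rw [qPochhammer_succ q l] at h₁
      rw [gaussBinom_succ_succ, show k + 1 + (l + 1) = k + (l + 1) + 1 by ring,
        qPochhammer_succ q k, qPochhammer_succ q l, qPochhammer_succ q (k + (l + 1))]
      linear_combination (1 - q ^ (k + 1)) * h₁ + q ^ (k + 1) * (1 - q ^ (l + 1)) * ihl

theorem gaussBinom_comm {q : S} (hq : ∀ n, IsRegular (qPochhammer q n)) (k l : ℕ) :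
    gaussBinom q k l = gaussBinom q l k := by
  apply ((hq k).mul (hq l)).right
  simp only [gaussBinom_mul_qPochhammer]
  rw [mul_comm (qPochhammer q k), gaussBinom_mul_qPochhammer, add_comm]

/-- The **Gauss binomial formula**. -/
theorem prod_add_mul_pow_eq_sum_gaussBinom (q a b : S) (n : ℕ) :
    ∏ i ∈ range n, (a + b * q ^ i) =
      ∑ p ∈ antidiagonal n, gaussBinom q p.1 p.2 * q ^ p.1.choose 2 * a ^ p.2 * b ^ p.1 := by
  induction n generalizing b with
  | zero => simp [gaussBinom_zero_left]
  | succ n ih =>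
    set t : ℕ → ℕ → S := fun k l ↦
      gaussBinom q k l * q ^ k.choose 2 * a ^ l * (b * q) ^ k with ht
    let α : ℕ × ℕ → S := fun p ↦ Nat.casesOn p.2 0 fun l ↦ a * t p.1 l
    let β : ℕ × ℕ → S := fun p ↦ Nat.casesOn p.1 0 fun k ↦ b * t k p.2
    have hα : ∑ p ∈ antidiagonal (n + 1), α p = ∑ p ∈ antidiagonal n, a * t p.1 p.2 := by
      rw [Nat.sum_antidiagonal_succ']
      simp [α]
    have hβ : ∑ p ∈ antidiagonal (n + 1), β p = ∑ p ∈ antidiagonal n, b * t p.1 p.2 := by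
      rw [Nat.sum_antidiagonal_succ]
      simp [β]
    have hprod : ∏ i ∈ range n, (a + b * q ^ (i + 1)) = ∑ p ∈ antidiagonal n, t p.1 p.2 := by
      rw [ht, ← ih]
      exact prod_congr rfl fun i _ ↦ by ring
    rw [prod_range_succ', hprod, pow_zero, mul_one, mul_comm, add_mul, mul_sum, mul_sum,
      ← hα, ← hβ, ← sum_add_distrib]
    refine sum_congr rfl fun p hp ↦ ?_
    rcases p with ⟨_ | k, _ | l⟩
    · simp at hp
    · simp [α, β, ht, gaussBinom_zero_left, pow_succ']
    · simp [α, β, ht, gaussBinom_zero_right, Nat.choose_succ_succ' k 1]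
      ring
    · simp only [α, β, ht, gaussBinom_succ_succ, Nat.choose_succ_succ' k 1, Nat.choose_one_right]
      ring

/-- The derivative at `z = 1` of the Gauss binomial formula for `∏ i, (q ^ n - z * q ^ i)`. -/
theorem qPochhammer_sq_mul_pow_eq_sum_antidiagonal (q : S) (n : ℕ) :
    (-1) ^ (n + 1) * q ^ (n.choose 2 + n + n * n) * qPochhammer q n ^ 2 =
      ∑ p ∈ antidiagonal (2 * n + 1), (-1) ^ p.1 * p.1 *
        (gaussBinom q p.1 p.2 * q ^ (p.1.choose 2 + n * p.2)) := by
  have hder (f : Polynomial S) :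
      (Polynomial.derivative (f * (1 - Polynomial.X))).eval 1 = -f.eval 1 := by simp
  have hterm (p : ℕ × ℕ) : gaussBinom (Polynomial.C q) p.1 p.2 * Polynomial.C q ^ p.1.choose 2 *
      Polynomial.C (q ^ n) ^ p.2 * (-Polynomial.X) ^ p.1 =
      Polynomial.C (gaussBinom q p.1 p.2 * q ^ p.1.choose 2 * (q ^ n) ^ p.2 * (-1) ^ p.1) *
        Polynomial.X ^ p.1 := by
    rw [← map_gaussBinom, neg_pow]
    simp [mul_assoc]
  have hlow : ∏ i ∈ range n, (q ^ n - q ^ i) = (-1) ^ n * q ^ n.choose 2 * qPochhammer q n := by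
    have h : ∀ i ∈ range n, q ^ n - q ^ i = -1 * q ^ i * (1 - q ^ (n - 1 - i + 1)) := by
      intro i hi
      have : q ^ n = q ^ i * q ^ (n - 1 - i + 1) := by
        rw [← pow_add]
        congr 1
        grind
      rw [this]
      ring
    rw [prod_congr rfl h, prod_mul_distrib, prod_mul_distrib, prod_const, card_range,
      prod_pow_eq_pow_sum, prod_range_reflect (fun i ↦ 1 - q ^ (i + 1)) n, sum_range_id,
      Nat.choose_two_right, qPochhammer]
  have hhigh : ∏ i ∈ range n, (q ^ n - q ^ (n + 1 + i)) = q ^ (n * n) * qPochhammer q n := by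
    have h : ∀ i ∈ range n, q ^ n - q ^ (n + 1 + i) = q ^ n * (1 - q ^ (i + 1)) :=
      fun i _ ↦ by ring
    rw [prod_congr rfl h, prod_mul_distrib, prod_const, card_range, ← pow_mul, qPochhammer]
  have hsplit : ∏ i ∈ range (2 * n + 1),
        (Polynomial.C (q ^ n) + -Polynomial.X * Polynomial.C q ^ i) =
      ((∏ i ∈ range n, (Polynomial.C (q ^ n) + -Polynomial.X * Polynomial.C q ^ i)) *
        (∏ i ∈ range n, (Polynomial.C (q ^ n) + -Polynomial.X * Polynomial.C q ^ (n + 1 + i))) *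
        Polynomial.C (q ^ n)) * (1 - Polynomial.X) := by
    rw [show 2 * n + 1 = n + 1 + n by ring, prod_range_add, prod_range_succ, map_pow]
    ring
  have key := congrArg (fun f ↦ (Polynomial.derivative f).eval 1)
    (prod_add_mul_pow_eq_sum_gaussBinom (Polynomial.C q) (Polynomial.C (q ^ n)) (-Polynomial.X)
      (2 * n + 1))
  simp only [hsplit, hder, hterm, Polynomial.derivative_sum, Polynomial.eval_finsetSum] at key
  calc _ = -((∏ i ∈ range n, (q ^ n - q ^ i)) * (∏ i ∈ range n, (q ^ n - q ^ (n + 1 + i))) *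
        q ^ n) := by
        rw [hlow, hhigh]
        ring
    _ = _ := by
        simpa only [Polynomial.eval_mul, Polynomial.eval_prod, Polynomial.eval_add,
          Polynomial.eval_neg, Polynomial.eval_C, Polynomial.eval_X, Polynomial.eval_pow,
          neg_one_mul, ← sub_eq_add_neg] using key
    _ = _ := by
        refine sum_congr rfl fun p _ ↦ ?_
        simp only [Polynomial.derivative_C_mul_X_pow, Polynomial.eval_mul, Polynomial.eval_C,
          Polynomial.eval_pow, Polynomial.eval_X, one_pow]
        ring

/-- A finite form of **Jacobi's identity** for the cube of the Euler function. -/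
theorem qPochhammer_sq_eq_sum_gaussBinom {q : S} (hq : IsRegular q)
    (hP : ∀ n, IsRegular (qPochhammer q n)) (n : ℕ) :
    qPochhammer q n ^ 2 = ∑ j ∈ range (n + 1),
      (-1) ^ j * (2 * j + 1) * q ^ (j + 1).choose 2 * gaussBinom q (n - j) (n + 1 + j) := by
  apply (hq.pow (n.choose 2 + n + n * n)).left
  have hsign : ((-1) ^ (n + 1) * (-1) ^ (n + 1) : S) = 1 := by rw [← mul_pow]; simp
  have key := qPochhammer_sq_mul_pow_eq_sum_antidiagonal q n
  rw [Nat.sum_antidiagonal_eq_sum_range_succ (fun k l ↦ (-1) ^ k * (k : S) *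
    (gaussBinom q k l * q ^ (k.choose 2 + n * l))), show (2 * n + 1).succ = n + 1 + (n + 1) by lia,
    sum_range_add, ← sum_range_reflect, ← sum_add_distrib] at key
  suffices h : _ = (-1) ^ (n + 1) * (q ^ (n.choose 2 + n + n * n) * ∑ j ∈ range (n + 1),
      (-1) ^ j * (2 * j + 1) * q ^ (j + 1).choose 2 * gaussBinom q (n - j) (n + 1 + j)) by
    dsimp only
    linear_combination (-1) ^ (n + 1) * (key.trans h) + (q ^ (n.choose 2 + n + n * n) *
      (∑ j ∈ range (n + 1), (-1) ^ j * (2 * j + 1) * q ^ (j + 1).choose 2 *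
        gaussBinom q (n - j) (n + 1 + j) - qPochhammer q n ^ 2)) * hsign
  rw [mul_sum, mul_sum]
  refine sum_congr rfl fun j hj ↦ ?_
  obtain ⟨m, rfl⟩ := Nat.exists_eq_add_of_le' (Nat.lt_succ_iff.mp (mem_range.mp hj))
  rw [show m + j + 1 - 1 - j = m by lia, show 2 * (m + j) + 1 - m = m + j + 1 + j by lia,
    show 2 * (m + j) + 1 - (m + j + 1 + j) = m by lia, show m + j - j = m by lia,
    gaussBinom_comm hP (m + j + 1 + j) m]
  have e₁ : m.choose 2 + (m + j) * (m + j + 1 + j) =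
      (m + j).choose 2 + (m + j) + (m + j) * (m + j) + (j + 1).choose 2 := by
    rw [← Nat.cast_inj (R := ℚ)]
    push_cast [Nat.cast_choose_two]
    ring
  have e₂ : (m + j + 1 + j).choose 2 + (m + j) * m =
      (m + j).choose 2 + (m + j) + (m + j) * (m + j) + (j + 1).choose 2 := by
    rw [← Nat.cast_inj (R := ℚ)]
    push_cast [Nat.cast_choose_two]
    ring
  have hj2 : ((-1) ^ j * (-1) ^ j : S) = 1 := by rw [← mul_pow]; simp
  rw [e₁, e₂, pow_add q _ ((j + 1).choose 2)]
  push_cast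
  simp only [pow_add, pow_one]
  linear_combination (-1) ^ m * (m : S) * gaussBinom q m (m + j + 1 + j) *
    q ^ (m + j).choose 2 * q ^ m * q ^ j * q ^ ((m + j) * (m + j)) * q ^ (j + 1).choose 2 * (-hj2)

end QBinomial

section EulerFunction

variable (R : Type*) [CommRing R]

theorem constantCoeff_qPochhammer_X (n : ℕ) :
    constantCoeff (qPochhammer (X : R⟦X⟧) n) = 1 := by
  simp [qPochhammer]

theorem isUnit_qPochhammer_X (n : ℕ) : IsUnit (qPochhammer (X : R⟦X⟧) n) := by
  simp [PowerSeries.isUnit_iff_constantCoeff, constantCoeff_qPochhammer_X]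

theorem isRegular_powerSeries_X : IsRegular (X : R⟦X⟧) :=
  ⟨X_mul_injective, fun f g h ↦ X_mul_injective (by simpa only [X_mul] using h)⟩

theorem X_pow_dvd_qPochhammer_add_sub (n r : ℕ) :
    (X : R⟦X⟧) ^ (n + 1) ∣ qPochhammer X (n + r) - qPochhammer X n := by
  induction r with
  | zero => simp
  | succ r ih =>
    rw [← add_assoc, qPochhammer_succ]
    have h : (X : R⟦X⟧) ^ (n + 1) ∣ qPochhammer X (n + r) * X ^ (n + r + 1) :=
      (pow_dvd_pow X (by lia)).mul_left _
    convert! ih.sub h using 1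
    ring

theorem X_pow_dvd_pentagonalSeries_sub_qPochhammer (n : ℕ) :
    (X : R⟦X⟧) ^ (n + 1) ∣ pentagonalSeries R - qPochhammer X n := by
  rw [X_pow_dvd_iff]
  intro d hd
  obtain ⟨M, hM, hn⟩ := ((Filter.tendsto_finset_range.eventually
    (coeff_prod_one_sub_X_pow_eventually_eq R d)).and (Filter.eventually_ge_atTop n)).exists
  obtain ⟨r, rfl⟩ := Nat.exists_eq_add_of_le hn
  have h := X_pow_dvd_iff.mp (X_pow_dvd_qPochhammer_add_sub R n r) d hd
  rw [map_sub, ← hM]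
  simpa [qPochhammer] using h

/-- **Jacobi's identity** `∏ (1 - X ^ n) ^ 3 = ∑ (-1) ^ j (2 j + 1) X ^ (j (j + 1) / 2)`,
coefficientwise. -/
theorem coeff_pentagonalSeries_pow_three (d : ℕ) : coeff d (pentagonalSeries R ^ 3) =
    ∑ j ∈ range (d + 1), if (j + 1).choose 2 = d then (-1 : R) ^ j * (2 * j + 1) else 0 := by
  have hle (j : ℕ) : j ≤ (j + 1).choose 2 := by
    rw [Nat.choose_succ_succ' j 1, Nat.choose_one_right]
    exact Nat.le_add_right _ _
  let I : Ideal R⟦X⟧ := Ideal.span {X ^ (d + 1)}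
  let π := Ideal.Quotient.mk I
  have hπ {f g : R⟦X⟧} : π f = π g ↔ X ^ (d + 1) ∣ f - g := by
    rw [Ideal.Quotient.mk_eq_mk_iff_sub_mem, Ideal.mem_span_singleton]
  have hP (m : ℕ) (hm : d ≤ m) : π (qPochhammer X m) = π (pentagonalSeries R) :=
    (hπ.mpr ((pow_dvd_pow X (by lia)).trans
      (X_pow_dvd_pentagonalSeries_sub_qPochhammer R m))).symm
  have hu : IsUnit (π (pentagonalSeries R)) := hP d le_rfl ▸ (isUnit_qPochhammer_X R d).map π
  have hX (m : ℕ) (hm : d < m) : π (X ^ m) = 0 := by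
    rw [← map_zero π, hπ, sub_zero]
    exact pow_dvd_pow X hm
  have hG (j : ℕ) (hj : j ≤ d) :
      π (gaussBinom X (2 * d - j) (2 * d + 1 + j)) * π (pentagonalSeries R) = 1 := by
    have h := congrArg π (gaussBinom_mul_qPochhammer (X : R⟦X⟧) (2 * d - j) (2 * d + 1 + j))
    rw [map_mul, map_mul, hP _ (by lia), hP _ (by lia), hP _ (by lia)] at h
    apply hu.mul_right_cancel
    rw [mul_assoc, h, one_mul]
  have key : π (pentagonalSeries R ^ 3) = π (∑ j ∈ range (2 * d + 1),
      (-1 : R⟦X⟧) ^ j * (2 * (j : R⟦X⟧) + 1) * X ^ (j + 1).choose 2) := by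
    rw [pow_succ, map_mul, map_pow, ← hP (2 * d) (by lia), ← map_pow,
      qPochhammer_sq_eq_sum_gaussBinom (isRegular_powerSeries_X R)
        (fun n ↦ (isUnit_qPochhammer_X R n).isRegular), hP (2 * d) (by lia), map_sum, map_sum,
      sum_mul]
    refine sum_congr rfl fun j _ ↦ ?_
    rw [map_mul, mul_assoc]
    rcases le_or_gt j d with hj | hj
    · rw [hG j hj, mul_one]
    · rw [map_mul, hX _ (hj.trans_le (hle j))]
      simp
  have hcoeff := X_pow_dvd_iff.mp (hπ.mp key) d (by lia)
  rw [map_sub, sub_eq_zero] at hcoeff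
  have hterm (j : ℕ) : coeff d ((-1 : R⟦X⟧) ^ j * (2 * (j : R⟦X⟧) + 1) * X ^ (j + 1).choose 2) =
      if (j + 1).choose 2 = d then (-1 : R) ^ j * (2 * j + 1) else 0 := by
    have hC : (-1 : R⟦X⟧) ^ j * (2 * (j : R⟦X⟧) + 1) = C ((-1 : R) ^ j * (2 * j + 1)) := by
      simp [map_ofNat]
    rw [hC, coeff_C_mul_X_pow]
    simp only [eq_comm]
  rw [hcoeff, map_sum, show 2 * d + 1 = d + 1 + d by ring, sum_range_add, add_eq_left.mpr]
  · exact sum_congr rfl fun j _ ↦ hterm j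
  · refine sum_eq_zero fun j _ ↦ ?_
    rw [hterm, if_neg (by have := hle (d + 1 + j); lia)]

theorem exists_of_coeff_pentagonalSeries_pow_three_ne_zero {d : ℕ}
    (h : coeff d (pentagonalSeries R ^ 3) ≠ 0) :
    ∃ j : ℕ, 8 * d + 1 = (2 * j + 1) ^ 2 ∧ ((2 * j + 1 : ℕ) : R) ≠ 0 := by
  rw [coeff_pentagonalSeries_pow_three] at h
  obtain ⟨j, -, hj⟩ := exists_ne_zero_of_sum_ne_zero h
  obtain ⟨rfl, hne⟩ := ite_ne_right_iff.mp hj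
  refine ⟨j, ?_, ?_⟩
  · rw [← Nat.cast_inj (R := ℚ)]
    push_cast [Nat.cast_choose_two]
    ring
  · push_cast
    exact right_ne_zero_of_mul hne

theorem exists_of_coeff_pentagonalSeries_ne_zero {d : ℕ}
    (h : coeff d (pentagonalSeries R) ≠ 0) : ∃ k : ℤ, 24 * (d : ℤ) + 1 = (6 * k - 1) ^ 2 := by
  by_cases hd : d ∈ Set.range pentagonal
  · obtain ⟨k, rfl⟩ := hd
    exact ⟨k, by linear_combination 12 * two_mul_natCast_pentagonal k⟩
  · exact absurd (coeff_pentagonalSeries_eq_zero R hd) h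

theorem mk_card_partition_mul_pentagonalSeries :
    (PowerSeries.mk fun n ↦ (Fintype.card (Nat.Partition n) : R)) * pentagonalSeries R = 1 := by
  let _ : TopologicalSpace R := ⊥
  have _ : DiscreteTopology R := ⟨rfl⟩
  open scoped PowerSeries.WithPiTopology in
  have h := (Nat.Partition.hasProd_powerSeriesMk_card_restricted R fun _ ↦ True).mul
    (PowerSeries.WithPiTopology.hasProd_one_sub_X_pow R)
  have h1 (i : ℕ) : (if True then ∑' j : ℕ, (X : R⟦X⟧) ^ ((i + 1) * j) else 1) *
      (1 - X ^ (i + 1)) = 1 := by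
    simp_rw [if_true, pow_mul]
    exact PowerSeries.WithPiTopology.tsum_pow_mul_one_sub_of_constantCoeff_eq_zero (by simp)
  simp only [h1] at h
  simpa [Nat.Partition.restricted] using h.unique hasProd_one

end EulerFunction

theorem PowerSeries.expand_zmod_card {p : ℕ} [hp : Fact p.Prime] (f : (ZMod p)⟦X⟧) :
    expand p hp.out.ne_zero f = f ^ p := by
  have h := MvPowerSeries.map_frobenius_expand p hp.out.ne_zero (f := f)
  rw [ZMod.frobenius_zmod] at h
  simpa [expand] using h

/-- If the coefficients of `∏ (1 - X ^ n) ^ (p - 1)` modulo `p` vanish in a residue class modulo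
`p`, then the partition numbers in that class are divisible by `p`. -/
theorem dvd_card_partition_of_coeff_eq_zero {p : ℕ} [hp : Fact p.Prime] {r : ℕ}
    (h : ∀ m, m ≡ r [MOD p] → coeff m (pentagonalSeries (ZMod p) ^ (p - 1)) = 0) {N : ℕ}
    (hN : N ≡ r [MOD p]) : p ∣ Fintype.card (Nat.Partition N) := by
  set G : (ZMod p)⟦X⟧ := PowerSeries.mk fun n ↦ (Fintype.card (Nat.Partition n) : ZMod p) with hG
  have hmul : G * pentagonalSeries (ZMod p) = 1 := mk_card_partition_mul_pentagonalSeries _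
  have hpow : G = pentagonalSeries (ZMod p) ^ (p - 1) * expand p hp.out.ne_zero G := by
    have hGp : G ^ p = G ^ (p - 1) * G := by rw [← pow_succ, Nat.sub_add_cancel hp.out.one_le]
    rw [expand_zmod_card, hGp, ← mul_assoc, ← mul_pow, mul_comm (pentagonalSeries _), hmul,
      one_pow, one_mul]
  rw [← ZMod.natCast_eq_zero_iff, ← coeff_mk N fun n ↦ (Fintype.card (Nat.Partition n) : ZMod p),
    ← hG, hpow, coeff_mul]
  refine sum_eq_zero fun x hx ↦ ?_
  rw [coeff_expand]
  split_ifs with hd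
  · rw [h x.1 _, zero_mul]
    rw [HasAntidiagonal.mem_antidiagonal] at hx
    rw [← hx] at hN
    simpa using ((Nat.ModEq.refl x.1).add (Nat.modEq_zero_iff_dvd.mpr hd)).symm.trans hN
  · exact mul_zero _

theorem ZMod.eq_zero_of_sq_add_three_mul_sq_eq_zero :
    ∀ a b : ZMod 5, a ^ 2 + 3 * b ^ 2 = 0 → b = 0 := by
  decide

theorem ZMod.eq_zero_of_sq_add_sq_eq_zero :
    ∀ a b : ZMod 7, a ^ 2 + b ^ 2 = 0 → b = 0 := by
  decide

theorem coeff_pentagonalSeries_pow_four_eq_zero {m : ℕ} (hm : m ≡ 4 [MOD 5]) :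
    coeff m (pentagonalSeries (ZMod 5) ^ 4) = 0 := by
  rw [pow_succ', coeff_mul]
  refine sum_eq_zero fun x hx ↦ ?_
  by_contra hne
  obtain ⟨k, hk⟩ := exists_of_coeff_pentagonalSeries_ne_zero _ (left_ne_zero_of_mul hne)
  obtain ⟨j, hj, hj0⟩ :=
    exists_of_coeff_pentagonalSeries_pow_three_ne_zero _ (right_ne_zero_of_mul hne)
  apply hj0
  apply ZMod.eq_zero_of_sq_add_three_mul_sq_eq_zero ((6 * k - 1 : ℤ) : ZMod 5)
  rw [HasAntidiagonal.mem_antidiagonal] at hx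
  rw [← Int.cast_pow, ← Nat.cast_pow, ← hk, ← hj]
  have h5 : 5 ∣ 24 * x.1 + 1 + 3 * (8 * x.2 + 1) := by
    have := hm.dvd
    lia
  exact_mod_cast (ZMod.natCast_eq_zero_iff _ _).mpr h5

theorem coeff_pentagonalSeries_pow_six_eq_zero {m : ℕ} (hm : m ≡ 5 [MOD 7]) :
    coeff m (pentagonalSeries (ZMod 7) ^ 6) = 0 := by
  rw [pow_add _ 3 3, coeff_mul]
  refine sum_eq_zero fun x hx ↦ ?_
  by_contra hne
  obtain ⟨i, hi, -⟩ :=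
    exists_of_coeff_pentagonalSeries_pow_three_ne_zero _ (left_ne_zero_of_mul hne)
  obtain ⟨j, hj, hj0⟩ :=
    exists_of_coeff_pentagonalSeries_pow_three_ne_zero _ (right_ne_zero_of_mul hne)
  apply hj0
  apply ZMod.eq_zero_of_sq_add_sq_eq_zero ((2 * i + 1 : ℕ) : ZMod 7)
  rw [HasAntidiagonal.mem_antidiagonal] at hx
  rw [← Nat.cast_pow, ← Nat.cast_pow, ← hi, ← hj, ← Nat.cast_add, ZMod.natCast_eq_zero_iff]
  have := hm.dvd
  lia

/-- **Ramanujan's partition congruences**: `p(5n+4) ≡ 0 (mod 5)` and `p(7n+5) ≡ 0 (mod 7)`,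
where `p(m)` is the number of partitions of `m`. -/
theorem ramanujan_partition_congruences (n : ℕ) :
    5 ∣ Nat.card (Nat.Partition (5 * n + 4)) ∧ 7 ∣ Nat.card (Nat.Partition (7 * n + 5)) := by
  have : Fact (Nat.Prime 5) := ⟨by norm_num⟩
  have : Fact (Nat.Prime 7) := ⟨by norm_num⟩
  rw [Nat.card_eq_fintype_card, Nat.card_eq_fintype_card]
  exact ⟨dvd_card_partition_of_coeff_eq_zero (r := 4)
      (fun _ ↦ coeff_pentagonalSeries_pow_four_eq_zero) (by simp [Nat.ModEq]),
    dvd_card_partition_of_coeff_eq_zero (r := 5)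
      (fun _ ↦ coeff_pentagonalSeries_pow_six_eq_zero) (by simp [Nat.ModEq])⟩
end

section
/- Ramanujan's 'most beautiful' formula: in ℤ[[X]], ∑_{n=0}^∞ p(5n+4) X^n = 5 · ∏_{k=1}^∞ (1 − X^{5k})^5 · ((1 − X^k)^6)^{−1} (each factor 1 − X^k has constant term 1, hence its sixth power is invertible). -/
open PowerSeries Filter

namespace PowerSeries

section Dissection

variable {R : Type*} [CommRing R]

/-- The series `∑ f_{5n+r} Xⁿ` extracted from `f = ∑ f_n Xⁿ`. -/
noncomputable def quinsection (r : ℕ) (f : R⟦X⟧) : R⟦X⟧ := mk fun n => coeff (5 * n + r) f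

theorem coeff_X_pow_mul_expand_quinsection {r : ℕ} (hr : r < 5) (f : R⟦X⟧) (n : ℕ) :
    coeff n (X ^ r * expand 5 (Nat.succ_ne_zero 4) (quinsection r f)) =
      if n % 5 = r then coeff n f else 0 := by
  rw [coeff_X_pow_mul']
  split_ifs with h₁ h₂ h₂
  · obtain ⟨m, rfl⟩ : ∃ m, n = 5 * m + r := ⟨n / 5, by omega⟩
    simp [quinsection]
  · exact coeff_expand_of_not_dvd _ _ _ (by omega)
  · omega
  · rfl


theorem quinsection_X_pow_mul_expand {r s : ℕ} (hr : r < 5) (hs : s < 5) (f : R⟦X⟧) :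
    quinsection r (X ^ s * expand 5 (Nat.succ_ne_zero 4) f) = if s = r then f else 0 := by
  ext n
  rw [quinsection, coeff_mk, coeff_X_pow_mul']
  split_ifs with h₁ h₂ h₂
  · subst h₂; simp
  · rw [coeff_expand_of_not_dvd _ _ _ (by omega)]; simp
  · omega
  · simp

theorem eq_sum_quinsection (f : R⟦X⟧) :
    f = ∑ r ∈ Finset.range 5, X ^ r * expand 5 (Nat.succ_ne_zero 4) (quinsection r f) := by
  ext n
  rw [map_sum, Finset.sum_congr rfl fun r hr =>
    coeff_X_pow_mul_expand_quinsection (Finset.mem_range.1 hr) f n, Finset.sum_ite_eq,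
    if_pos (Finset.mem_range.2 (Nat.mod_lt _ (by norm_num)))]

theorem quinsection_add (r : ℕ) (f g : R⟦X⟧) :
    quinsection r (f + g) = quinsection r f + quinsection r g := by
  ext n; simp [quinsection]

theorem quinsection_mul_expand {r : ℕ} (hr : r < 5) (f g : R⟦X⟧) :
    quinsection r (f * expand 5 (Nat.succ_ne_zero 4) g) = quinsection r f * g := by
  conv_lhs => rw [eq_sum_quinsection f]
  simp only [Finset.sum_range_succ, Finset.sum_range_zero, zero_add, add_mul, mul_assoc, ← map_mul,
    quinsection_add]
  interval_cases r <;> simp only [quinsection_X_pow_mul_expand, Nat.reduceLT] <;> simp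

theorem quinsection_sum_X_pow_mul_expand {r : ℕ} (hr : r < 5) (g : ℕ → R⟦X⟧) :
    quinsection r (∑ s ∈ Finset.range 5, X ^ s * expand 5 (Nat.succ_ne_zero 4) (g s)) = g r := by
  simp only [Finset.sum_range_succ, Finset.sum_range_zero, zero_add, quinsection_add]
  interval_cases r <;> simp only [quinsection_X_pow_mul_expand, Nat.reduceLT] <;> simp

/-- The product of the values of a quadratic polynomial at the fifth roots of unity. -/
theorem prod_range_five_add_mul_pow {z : R} (hz : 1 + z + z ^ 2 + z ^ 3 + z ^ 4 = 0) (a b c : R) :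
    ∏ i ∈ Finset.range 5, (a + b * z ^ i + c * z ^ (2 * i)) =
      a ^ 5 + b ^ 5 + c ^ 5 - 5 * a * b ^ 3 * c + 5 * a ^ 2 * b * c ^ 2 := by
  have h5 : z ^ 5 = 1 := by linear_combination (z - 1) * hz
  have h₁ : (a + b * z + c * z ^ 2) * (a + b * z ^ 4 + c * z ^ 8) =
      a ^ 2 + b ^ 2 + c ^ 2 + (a * b + b * c) * (z + z ^ 4) + a * c * (z ^ 2 + z ^ 3) := by
    linear_combination (a * c * z ^ 3 + b ^ 2 + b * c * z ^ 4 + b * c * z + c ^ 2 * (z ^ 5 + 1)) * h5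
  have h₂ : (a + b * z ^ 2 + c * z ^ 4) * (a + b * z ^ 3 + c * z ^ 6) =
      a ^ 2 + b ^ 2 + c ^ 2 + (a * b + b * c) * (z ^ 2 + z ^ 3) + a * c * (z + z ^ 4) := by
    linear_combination (a * c * z + b ^ 2 + b * c * z ^ 3 + b * c * z ^ 2 + c ^ 2 * (z ^ 5 + 1)) * h5
  obtain ⟨s, hs⟩ : ∃ s, s = z + z ^ 4 := ⟨_, rfl⟩
  have ht : z ^ 2 + z ^ 3 = -1 - s := by linear_combination hz + hs
  have hq : s ^ 2 + s - 1 = 0 := by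
    rw [hs]; linear_combination hz + (2 + z ^ 3) * h5
  rw [ht, ← hs] at h₁ h₂
  calc _ = (a + b + c) * ((a + b * z + c * z ^ 2) * (a + b * z ^ 4 + c * z ^ 8)) *
        ((a + b * z ^ 2 + c * z ^ 4) * (a + b * z ^ 3 + c * z ^ 6)) := by
        simp only [Finset.prod_range_succ, Finset.prod_range_zero]; ring
    _ = _ := by
      rw [h₁, h₂]
      linear_combination (a + b + c) * (2 * (a * b + b * c) * (a * c) - (a * b + b * c) ^ 2 -
        (a * c) ^ 2) * hq

theorem quintic_norm_factor {a b c : R} (h : a * c + b ^ 2 = 0) :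
    (a + b + c) * (a ^ 4 - 3 * b ^ 3 * c + (2 * b ^ 2 * c ^ 2 - a ^ 3 * b) +
      (2 * a ^ 2 * b ^ 2 - b * c ^ 3) + (c ^ 4 - 3 * a * b ^ 3) + 5 * b ^ 4) =
      a ^ 5 + b ^ 5 + c ^ 5 - 5 * a * b ^ 3 * c + 5 * a ^ 2 * b * c ^ 2 := by
  have hb : b ^ 2 = - (a * c) := by linear_combination h
  grind
end Dissection
theorem abs_le_pentagonal (k : ℤ) : |k| ≤ pentagonal k := by
  have h := two_mul_natCast_pentagonal k
  rcases abs_cases k with ⟨h₁, h₂⟩ | ⟨h₁, h₂⟩ <;> rw [h₁]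
  · rcases h₂.eq_or_lt with rfl | h₃
    · simp
    · nlinarith
  · nlinarith

/-- The terms of the pentagonal series whose index is congruent to `r` modulo `5`. -/
noncomputable def pentagonalClass (r : ℤ) : ℤ⟦X⟧ :=
  mk fun n => ∑ k ∈ Finset.Icc (-n : ℤ) n with pentagonal k = n ∧ k % 5 = r, (k.negOnePow : ℤ)

theorem coeff_pentagonalClass {i n : ℕ} (h : i ≤ n) (r : ℤ) :
    coeff i (pentagonalClass r) =
      ∑ k ∈ Finset.Icc (-n : ℤ) n, if pentagonal k = i ∧ k % 5 = r then (k.negOnePow : ℤ) else 0 := by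
  rw [pentagonalClass, coeff_mk, ← Finset.sum_filter]
  congr 1
  ext k
  have := abs_le.1 (abs_le_pentagonal k)
  simp only [Finset.mem_filter, Finset.mem_Icc]
  grind

theorem coeff_pentagonalClass_pentagonal (k r : ℤ) :
    coeff (pentagonal k) (pentagonalClass r) = if k % 5 = r then (k.negOnePow : ℤ) else 0 := by
  rw [coeff_pentagonalClass le_rfl, Finset.sum_eq_single k]
  · simp
  · simp +contextual [pentagonal_inj]
  · have := abs_le.1 (abs_le_pentagonal k)
    simp +contextual [Finset.mem_Icc]
    grind

theorem coeff_pentagonalClass_eq_zero {n : ℕ} (h : n ∉ Set.range pentagonal) (r : ℤ) :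
    coeff n (pentagonalClass r) = 0 := by
  rw [coeff_pentagonalClass le_rfl]
  exact Finset.sum_eq_zero fun k _ => if_neg fun hk => h ⟨k, hk.1⟩

theorem coeff_pentagonalClass_mul (n : ℕ) (r s : ℤ) :
    coeff n (pentagonalClass r * pentagonalClass s) =
      ∑ p ∈ Finset.Icc (-n : ℤ) n ×ˢ Finset.Icc (-n : ℤ) n,
        if pentagonal p.1 + pentagonal p.2 = n ∧ p.1 % 5 = r ∧ p.2 % 5 = s then
          ((p.1 + p.2).negOnePow : ℤ) else 0 := by
  have h₁ : ∀ x ∈ Finset.HasAntidiagonal.antidiagonal n,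
      coeff x.1 (pentagonalClass r) * coeff x.2 (pentagonalClass s) =
        ∑ p ∈ Finset.Icc (-n : ℤ) n ×ˢ Finset.Icc (-n : ℤ) n,
          (if pentagonal p.1 = x.1 ∧ p.1 % 5 = r then (p.1.negOnePow : ℤ) else 0) *
            (if pentagonal p.2 = x.2 ∧ p.2 % 5 = s then (p.2.negOnePow : ℤ) else 0) := by
    intro x hx
    have := Finset.HasAntidiagonal.mem_antidiagonal.1 hx
    rw [coeff_pentagonalClass (n := n) (by omega), coeff_pentagonalClass (n := n) (by omega),
      Finset.sum_mul_sum, ← Finset.sum_product']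
  rw [coeff_mul, Finset.sum_congr rfl h₁, Finset.sum_comm]
  refine Finset.sum_congr rfl fun p _ => ?_
  by_cases h : pentagonal p.1 + pentagonal p.2 = n
  · rw [Finset.sum_eq_single (pentagonal p.1, pentagonal p.2)]
    · simp only [h, true_and, Int.negOnePow_add, Units.val_mul]
      grind
    · rintro ⟨i, j⟩ _ hne
      grind
    · simp [h]
  · rw [if_neg (by tauto)]
    refine Finset.sum_eq_zero fun x hx => ?_
    have := Finset.HasAntidiagonal.mem_antidiagonal.1 hx
    grind

/-- In terms of `α = (6k - 1) + (6l - 1)i`, the terms with `3k + 4l ≡ 2 (mod 5)` are those with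
`2 + i ∣ α`; they cancel in pairs under the reflection `α ↦ -(2 + i) / (2 - i) * conj α`. -/
theorem sum_negOnePow_pentagonal_add_pentagonal_eq_zero (n : ℕ) :
    ∑ p ∈ Finset.Icc (-n : ℤ) n ×ˢ Finset.Icc (-n : ℤ) n with
      pentagonal p.1 + pentagonal p.2 = n ∧ (3 * p.1 + 4 * p.2) % 5 = 2,
        ((p.1 + p.2).negOnePow : ℤ) = 0 := by
  have hodd (k l : ℤ) (h : (3 * k + 4 * l) % 5 = 2) :
      Odd ((2 - 3 * k - 4 * l) / 5 + (3 * l - 4 * k + 1) / 5 - (k + l)) := by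
    rw [Int.odd_iff]; omega
  refine Finset.sum_involution
    (fun p _ => ((2 - 3 * p.1 - 4 * p.2) / 5, (3 * p.2 - 4 * p.1 + 1) / 5)) ?_ ?_ ?_ ?_
  · rintro ⟨k, l⟩ hp
    have h := hodd k l (Finset.mem_filter.1 hp).2.2
    dsimp only
    rw [← sub_add_cancel ((2 - 3 * k - 4 * l) / 5 + (3 * l - 4 * k + 1) / 5) (k + l),
      Int.negOnePow_add _ (k + l), Int.negOnePow_odd _ h]
    simp
  · rintro ⟨k, l⟩ hp _ heq
    have h := hodd k l (Finset.mem_filter.1 hp).2.2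
    rw [Prod.mk.injEq] at heq
    rw [heq.1, heq.2, sub_self] at h
    simp at h
  · rintro ⟨k, l⟩ hp
    obtain ⟨-, hn, h⟩ := Finset.mem_filter.1 hp
    have hsum : pentagonal ((2 - 3 * k - 4 * l) / 5) + pentagonal ((3 * l - 4 * k + 1) / 5) = n := by
      obtain ⟨u, hu⟩ : ∃ u, u = (2 - 3 * k - 4 * l) / 5 := ⟨_, rfl⟩
      obtain ⟨v, hv⟩ : ∃ v, v = (3 * l - 4 * k + 1) / 5 := ⟨_, rfl⟩
      have hu' : 5 * u = 2 - 3 * k - 4 * l := by omega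
      have hv' : 5 * v = 3 * l - 4 * k + 1 := by omega
      rw [← hu, ← hv, ← hn, ← Nat.cast_inj (R := ℤ)]
      push_cast
      have h₁ := two_mul_natCast_pentagonal u
      have h₂ := two_mul_natCast_pentagonal v
      have h₃ := two_mul_natCast_pentagonal k
      have h₄ := two_mul_natCast_pentagonal l
      have h₅ : 25 * (u * (3 * u - 1) + v * (3 * v - 1)) =
          25 * (k * (3 * k - 1) + l * (3 * l - 1)) := by
        linear_combination (15 * u + 3 * (2 - 3 * k - 4 * l) - 5) * hu' +
          (15 * v + 3 * (3 * l - 4 * k + 1) - 5) * hv'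
      linarith
    have h₁ := abs_le.1 (abs_le_pentagonal ((2 - 3 * k - 4 * l) / 5))
    have h₂ := abs_le.1 (abs_le_pentagonal ((3 * l - 4 * k + 1) / 5))
    simp only [Finset.mem_filter, Finset.mem_product, Finset.mem_Icc]
    refine ⟨?_, hsum, ?_⟩ <;> omega
  · rintro ⟨k, l⟩ hp
    have h : (3 * k + 4 * l) % 5 = 2 := (Finset.mem_filter.1 hp).2.2
    simp only [Prod.mk.injEq]
    omega

theorem pentagonalClass_quadratic_relation :
    (pentagonalClass 0 + pentagonalClass 2) * (pentagonalClass 3 + pentagonalClass 4) +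
      pentagonalClass 1 ^ 2 = 0 := by
  suffices pentagonalClass 0 * pentagonalClass 3 + pentagonalClass 2 * pentagonalClass 4 +
      pentagonalClass 3 * pentagonalClass 2 + pentagonalClass 4 * pentagonalClass 0 +
      pentagonalClass 1 * pentagonalClass 1 = 0 by linear_combination this
  ext n
  simp only [map_add, coeff_pentagonalClass_mul, ← Finset.sum_add_distrib, map_zero]
  refine Eq.trans ?_ (sum_negOnePow_pentagonal_add_pentagonal_eq_zero n)
  rw [Finset.sum_filter]
  refine Finset.sum_congr rfl fun p _ => ?_
  by_cases h : pentagonal p.1 + pentagonal p.2 = n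
  · simp only [h, true_and]
    obtain h₁ | h₁ | h₁ | h₁ | h₁ : p.1 % 5 = 0 ∨ p.1 % 5 = 1 ∨ p.1 % 5 = 2 ∨ p.1 % 5 = 3 ∨
      p.1 % 5 = 4 := by omega
    all_goals split_ifs <;> omega
  · simp [h]

theorem X_pow_mul_expand_quinsection_pentagonalSeries {r : ℕ} (hr : r < 5) {f : ℤ⟦X⟧}
    (h₀ : ∀ n ∉ Set.range pentagonal, coeff n f = 0)
    (h : ∀ k, coeff (pentagonal k) f = if pentagonal k % 5 = r then (k.negOnePow : ℤ) else 0) :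
    X ^ r * expand 5 (Nat.succ_ne_zero 4) (quinsection r (pentagonalSeries ℤ)) = f := by
  ext n
  rw [coeff_X_pow_mul_expand_quinsection hr]
  by_cases hn : n ∈ Set.range pentagonal
  · obtain ⟨k, rfl⟩ := hn
    rw [h, coeff_pentagonalSeries_pentagonal, Int.cast_id]
  · rw [h₀ n hn, coeff_pentagonalSeries_eq_zero _ hn, ite_self]

theorem pentagonal_mod_five (k : ℤ) :
    (k % 5 = 0 ∨ k % 5 = 2) ∧ pentagonal k % 5 = 0 ∨ k % 5 = 1 ∧ pentagonal k % 5 = 1 ∨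
      (k % 5 = 3 ∨ k % 5 = 4) ∧ pentagonal k % 5 = 2 := by
  obtain ⟨q, s, hs, hs', rfl⟩ : ∃ q s : ℤ, 0 ≤ s ∧ s < 5 ∧ k = 5 * q + s :=
    ⟨k / 5, k % 5, by omega, by omega, by omega⟩
  have h := two_mul_natCast_pentagonal (5 * q + s)
  have h' : (5 * q + s) * (3 * (5 * q + s) - 1) =
      5 * (15 * q ^ 2 + 6 * q * s - q) + s * (3 * s - 1) := by ring
  rw [h'] at h
  generalize 15 * q ^ 2 + 6 * q * s - q = m at h
  interval_cases s <;> omega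

theorem X_pow_mul_expand_quinsection_zero :
    X ^ 0 * expand 5 (Nat.succ_ne_zero 4) (quinsection 0 (pentagonalSeries ℤ)) =
      pentagonalClass 0 + pentagonalClass 2 := by
  refine X_pow_mul_expand_quinsection_pentagonalSeries (by norm_num) (fun n hn => ?_) fun k => ?_
  · simp [coeff_pentagonalClass_eq_zero hn]
  · have := pentagonal_mod_five k
    rw [map_add, coeff_pentagonalClass_pentagonal, coeff_pentagonalClass_pentagonal]
    split_ifs <;> omega

theorem X_pow_mul_expand_quinsection_one :
    X ^ 1 * expand 5 (Nat.succ_ne_zero 4) (quinsection 1 (pentagonalSeries ℤ)) =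
      pentagonalClass 1 := by
  refine X_pow_mul_expand_quinsection_pentagonalSeries (by norm_num) (fun n hn => ?_) fun k => ?_
  · simp [coeff_pentagonalClass_eq_zero hn]
  · have := pentagonal_mod_five k
    rw [coeff_pentagonalClass_pentagonal]
    split_ifs <;> omega

theorem X_pow_mul_expand_quinsection_two :
    X ^ 2 * expand 5 (Nat.succ_ne_zero 4) (quinsection 2 (pentagonalSeries ℤ)) =
      pentagonalClass 3 + pentagonalClass 4 := by
  refine X_pow_mul_expand_quinsection_pentagonalSeries (by norm_num) (fun n hn => ?_) fun k => ?_
  · simp [coeff_pentagonalClass_eq_zero hn]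
  · have := pentagonal_mod_five k
    rw [map_add, coeff_pentagonalClass_pentagonal, coeff_pentagonalClass_pentagonal]
    split_ifs <;> omega

theorem quinsection_pentagonalSeries_eq_zero {r : ℕ} (hr : 2 < r) (hr' : r < 5) :
    quinsection r (pentagonalSeries ℤ) = 0 := by
  ext n
  rw [quinsection, coeff_mk, coeff_pentagonalSeries_eq_zero, map_zero]
  rintro ⟨k, hk⟩
  have := pentagonal_mod_five k
  omega

theorem pentagonalSeries_eq_dissection :
    pentagonalSeries ℤ =
      expand 5 (Nat.succ_ne_zero 4) (quinsection 0 (pentagonalSeries ℤ)) +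
      X * expand 5 (Nat.succ_ne_zero 4) (quinsection 1 (pentagonalSeries ℤ)) +
      X ^ 2 * expand 5 (Nat.succ_ne_zero 4) (quinsection 2 (pentagonalSeries ℤ)) := by
  conv_lhs => rw [eq_sum_quinsection (pentagonalSeries ℤ)]
  simp [Finset.sum_range_succ, quinsection_pentagonalSeries_eq_zero]

theorem quinsection_quadratic_relation :
    quinsection 0 (pentagonalSeries ℤ) * quinsection 2 (pentagonalSeries ℤ) +
      quinsection 1 (pentagonalSeries ℤ) ^ 2 = 0 := by
  have h := pentagonalClass_quadratic_relation
  rw [← X_pow_mul_expand_quinsection_zero, ← X_pow_mul_expand_quinsection_one,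
    ← X_pow_mul_expand_quinsection_two] at h
  have h' : X ^ 2 * expand 5 (Nat.succ_ne_zero 4) (quinsection 0 (pentagonalSeries ℤ) *
      quinsection 2 (pentagonalSeries ℤ) + quinsection 1 (pentagonalSeries ℤ) ^ 2) = 0 := by
    rw [← h]; simp only [map_add, map_mul, map_pow]; ring
  have := quinsection_X_pow_mul_expand (r := 2) (s := 2) (by norm_num) (by norm_num)
    (quinsection 0 (pentagonalSeries ℤ) *
      quinsection 2 (pentagonalSeries ℤ) + quinsection 1 (pentagonalSeries ℤ) ^ 2)
  rw [h', if_pos rfl] at this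
  rw [← this]
  ext n; simp [quinsection]

theorem pentagonal_five_mul_add_one (k : ℤ) :
    pentagonal (5 * k + 1) = 25 * pentagonal (-k) + 1 := by
  have h₁ := two_mul_natCast_pentagonal (5 * k + 1)
  have h₂ := two_mul_natCast_pentagonal_neg k
  zify
  linarith

theorem quinsection_one_pentagonalSeries :
    quinsection 1 (pentagonalSeries ℤ) =
      -expand 5 (Nat.succ_ne_zero 4) (pentagonalSeries ℤ) := by
  ext n
  rw [quinsection, coeff_mk, map_neg]
  by_cases hn : ∃ k, n = 5 * pentagonal (-k)
  · obtain ⟨k, rfl⟩ := hn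
    rw [coeff_expand_mul, coeff_pentagonalSeries_pentagonal,
      show 5 * (5 * pentagonal (-k)) + 1 = pentagonal (5 * k + 1) by
        rw [pentagonal_five_mul_add_one]; ring,
      coeff_pentagonalSeries_pentagonal, show 5 * k + 1 = -k + 2 * (3 * k) + 1 by ring,
      Int.negOnePow_succ, Int.negOnePow_add, Int.negOnePow_two_mul]
    simp
  · rw [coeff_pentagonalSeries_eq_zero]
    · rw [coeff_expand]
      split_ifs with h
      · obtain ⟨m, rfl⟩ := h
        rw [Nat.mul_div_cancel_left _ (by norm_num), coeff_pentagonalSeries_eq_zero, neg_zero]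
        rintro ⟨k, rfl⟩
        exact hn ⟨-k, by simp⟩
      · simp
    · rintro ⟨k, hk⟩
      have := pentagonal_mod_five k
      obtain ⟨j, rfl⟩ : ∃ j, k = 5 * j + 1 := ⟨k / 5, by omega⟩
      rw [pentagonal_five_mul_add_one] at hk
      exact hn ⟨j, by omega⟩


section InfiniteProducts

open scoped PowerSeries.WithPiTopology

theorem rescale_expand_of_pow_eq_one {R : Type*} [CommRing R] {p : ℕ} (hp : p ≠ 0) {z : R}
    (hz : z ^ p = 1) (f : R⟦X⟧) : rescale z (expand p hp f) = expand p hp f := by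
  ext n
  rw [coeff_rescale, coeff_expand]
  split_ifs with h
  · obtain ⟨m, rfl⟩ := h
    rw [pow_mul, hz, one_pow, one_mul]
  · rw [mul_zero]

theorem map_pentagonalSeries {R S : Type*} [CommRing R] [CommRing S] (f : R →+* S) :
    map f (pentagonalSeries R) = pentagonalSeries S := by
  ext n
  rw [coeff_map]
  by_cases hn : n ∈ Set.range pentagonal
  · obtain ⟨k, rfl⟩ := hn
    simp
  · rw [coeff_pentagonalSeries_eq_zero _ hn, coeff_pentagonalSeries_eq_zero _ hn, map_zero]

variable {R : Type*} [CommRing R] [TopologicalSpace R]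

theorem continuous_expand (p : ℕ) (hp : p ≠ 0) :
    Continuous (expand p hp : R⟦X⟧ →ₐ[R] R⟦X⟧) := by
  refine continuous_iff_continuousAt.2 fun f =>
    (WithPiTopology.tendsto_iff_coeff_tendsto R _ _ _).2 fun d => ?_
  simp only [coeff_expand]
  split_ifs
  · exact (WithPiTopology.continuous_coeff R _).tendsto f
  · exact tendsto_const_nhds

theorem continuous_rescale [IsTopologicalRing R] (z : R) :
    Continuous (rescale z : R⟦X⟧ →+* R⟦X⟧) := by
  refine continuous_iff_continuousAt.2 fun f =>
    (WithPiTopology.tendsto_iff_coeff_tendsto R _ _ _).2 fun d => ?_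
  simp only [coeff_rescale]
  exact ((WithPiTopology.continuous_coeff R _).tendsto f).const_mul _

theorem hasProd_expand_pentagonalSeries (p : ℕ) (hp : p ≠ 0) :
    HasProd (fun n => (1 - (X ^ p) ^ (n + 1) : R⟦X⟧)) (expand p hp (pentagonalSeries R)) := by
  convert! (WithPiTopology.hasProd_one_sub_X_pow R).map (expand p hp) (continuous_expand p hp)
    using 2
  simp

theorem hasProd_rescale_pentagonalSeries [IsTopologicalRing R] (z : R) :
    HasProd (fun n => (1 - C (z ^ (n + 1)) * X ^ (n + 1) : R⟦X⟧))
      (rescale z (pentagonalSeries R)) := by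
  convert! (WithPiTopology.hasProd_one_sub_X_pow R).map (rescale z) (continuous_rescale z) using 2
  simp [rescale_X, mul_pow]

theorem _root_.HasProd.ite_dvd_add_one {M : Type*} [CommMonoid M] [TopologicalSpace M] {f : ℕ → M}
    {a : M} (h : HasProd (fun n => f (n + 1)) a) {p : ℕ} (hp : 0 < p) :
    HasProd (fun n => if p ∣ n + 1 then f ((n + 1) / p) else 1) a := by
  have hpos (n : ℕ) : p * (n + 1) - 1 + 1 = p * (n + 1) :=
    Nat.sub_add_cancel (Nat.mul_pos hp n.succ_pos)
  have hinj : Function.Injective fun n => p * (n + 1) - 1 := fun m n hmn => by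
    have := congrArg (· + 1) hmn
    simp only [hpos] at this
    simpa using Nat.eq_of_mul_eq_mul_left hp this
  rw [← hinj.hasProd_iff]
  · convert! h using 2 with n
    simp only [Function.comp_apply, hpos, dvd_mul_right, if_true, Nat.mul_div_cancel_left _ hp]
  · intro n hn
    refine if_neg fun ⟨m, hm⟩ => hn ⟨m - 1, ?_⟩
    have : m ≠ 0 := by rintro rfl; simp at hm
    simp only [Nat.sub_add_cancel (Nat.one_le_iff_ne_zero.2 this), ← hm, Nat.add_sub_cancel]

theorem prod_rescale_pentagonalSeries_mul_expand [IsTopologicalRing R] [T2Space R] [IsDomain R]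
    {z : R} (hz : IsPrimitiveRoot z 5) :
    (∏ i ∈ Finset.range 5, rescale (z ^ i) (pentagonalSeries R)) *
        expand 5 (Nat.succ_ne_zero 4) (expand 5 (Nat.succ_ne_zero 4) (pentagonalSeries R)) =
      expand 5 (Nat.succ_ne_zero 4) (pentagonalSeries R) ^ 6 := by
  have h₁ := hasProd_prod fun i (_ : i ∈ Finset.range 5) =>
    hasProd_rescale_pentagonalSeries (R := R) (z ^ i)
  have h₂ := (hasProd_expand_pentagonalSeries (R := R) 5 (Nat.succ_ne_zero 4)).map
    (expand 5 (Nat.succ_ne_zero 4)) (continuous_expand 5 _)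
  have h₃ := hasProd_expand_pentagonalSeries (R := R) 5 (Nat.succ_ne_zero 4)
  have h₂' := HasProd.ite_dvd_add_one (f := fun n => (1 - ((X ^ 5) ^ 5) ^ n : R⟦X⟧))
    (by simpa [Function.comp_def] using h₂) (p := 5) (by norm_num)
  have h₃' := HasProd.ite_dvd_add_one (f := fun n => ((1 - (X ^ 5) ^ n) ^ 5 : R⟦X⟧))
    (by simpa using hasProd_prod fun i (_ : i ∈ Finset.range 5) => h₃) (p := 5) (by norm_num)
  rw [pow_succ]
  refine (h₁.mul h₂').unique ?_
  convert! h₃'.mul h₃ using 2 with n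
  split_ifs with h
  · obtain ⟨m, hm⟩ := h
    rw [hm, Nat.mul_div_cancel_left _ (by norm_num)]
    have (i : ℕ) : (z ^ i) ^ (5 * m) = 1 := by
      rw [← pow_mul, mul_left_comm, pow_mul, hz.pow_eq_one, one_pow]
    simp only [this, map_one, one_mul, Finset.prod_const, Finset.card_range]
    ring
  · have hprim : IsPrimitiveRoot (z ^ (n + 1)) 5 :=
      hz.pow_of_coprime _ (((Nat.Prime.coprime_iff_not_dvd (by norm_num)).2 h).symm)
    have hsum : 1 + z ^ (n + 1) + (z ^ (n + 1)) ^ 2 + (z ^ (n + 1)) ^ 3 + (z ^ (n + 1)) ^ 4 = 0 := by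
      simpa [Finset.sum_range_succ] using hprim.geom_sum_eq_zero (by norm_num)
    have hC := congrArg (C (R := R)) hsum
    simp only [map_add, map_one, map_zero, map_pow C (z ^ (n + 1))] at hC
    have := prod_range_five_add_mul_pow hC 1 (-X ^ (n + 1)) 0
    rw [mul_one, one_mul, ← pow_mul, mul_comm 5 (n + 1), pow_mul]
    refine Eq.trans (Finset.prod_congr rfl fun i _ => ?_) (this.trans ?_)
    · rw [← map_pow, ← pow_mul, ← pow_mul, mul_comm i]; ring
    · ring

theorem quintic_form_mul_expand_pentagonalSeries :
    expand 5 (Nat.succ_ne_zero 4) (pentagonalSeries ℤ) ^ 6 =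
      ((expand 5 (Nat.succ_ne_zero 4) (quinsection 0 (pentagonalSeries ℤ))) ^ 5 +
        (X * expand 5 (Nat.succ_ne_zero 4) (quinsection 1 (pentagonalSeries ℤ))) ^ 5 +
        (X ^ 2 * expand 5 (Nat.succ_ne_zero 4) (quinsection 2 (pentagonalSeries ℤ))) ^ 5 -
        5 * expand 5 (Nat.succ_ne_zero 4) (quinsection 0 (pentagonalSeries ℤ)) *
          (X * expand 5 (Nat.succ_ne_zero 4) (quinsection 1 (pentagonalSeries ℤ))) ^ 3 *
          (X ^ 2 * expand 5 (Nat.succ_ne_zero 4) (quinsection 2 (pentagonalSeries ℤ))) +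
        5 * expand 5 (Nat.succ_ne_zero 4) (quinsection 0 (pentagonalSeries ℤ)) ^ 2 *
          (X * expand 5 (Nat.succ_ne_zero 4) (quinsection 1 (pentagonalSeries ℤ))) *
          (X ^ 2 * expand 5 (Nat.succ_ne_zero 4) (quinsection 2 (pentagonalSeries ℤ))) ^ 2) *
      expand 5 (Nat.succ_ne_zero 4) (expand 5 (Nat.succ_ne_zero 4) (pentagonalSeries ℤ)) := by
  have hz := Complex.isPrimitiveRoot_exp 5 (by norm_num)
  generalize Complex.exp _ = z at hz
  have hmain := prod_rescale_pentagonalSeries_mul_expand hz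
  have hsum : 1 + z + z ^ 2 + z ^ 3 + z ^ 4 = 0 := by
    simpa [Finset.sum_range_succ] using hz.geom_sum_eq_zero (by norm_num)
  have hC := congrArg (C (R := ℂ)) hsum
  simp only [map_add, map_one, map_zero, map_pow] at hC
  refine map_injective (Int.castRingHom ℂ) Int.cast_injective ?_
  have hd := congrArg (map (Int.castRingHom ℂ)) pentagonalSeries_eq_dissection
  simp only [map_add, map_mul, map_sub, map_pow, map_expand, map_pentagonalSeries, map_X,
    map_ofNat] at hd ⊢
  rw [← prod_range_five_add_mul_pow hC, ← hmain]
  congr 1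
  refine Finset.prod_congr rfl fun i _ => ?_
  have hi : (z ^ i) ^ 5 = 1 := by rw [← pow_mul, mul_comm, pow_mul, hz.pow_eq_one, one_pow]
  rw [hd]
  simp only [map_add, map_mul, map_pow, rescale_expand_of_pow_eq_one _ hi, rescale_X]
  ring

end InfiniteProducts

section Partitions

open scoped PowerSeries.WithPiTopology

theorem hasProd_card_partition :
    HasProd (fun i => ∑' j : ℕ, (X ^ (i + 1) : ℤ⟦X⟧) ^ j)
      (mk fun n => (Nat.card (Nat.Partition n) : ℤ)) := by
  convert! Nat.Partition.hasProd_powerSeriesMk_card_restricted ℤ (fun _ => True) using 2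
  · simp [pow_mul]
  · funext n
    simp [Nat.Partition.restricted, Nat.card_eq_fintype_card, Finset.card_univ]

theorem one_sub_X_pow_mul_tsum (i : ℕ) :
    (1 - X ^ (i + 1)) * ∑' j : ℕ, (X ^ (i + 1) : ℤ⟦X⟧) ^ j = 1 :=
  WithPiTopology.one_sub_mul_tsum_pow_of_constantCoeff_eq_zero (by simp)

theorem pentagonalSeries_mul_card_partition :
    pentagonalSeries ℤ * (mk fun n => (Nat.card (Nat.Partition n) : ℤ)) = 1 := by
  refine ((WithPiTopology.hasProd_one_sub_X_pow ℤ).mul hasProd_card_partition).unique ?_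
  simp only [one_sub_X_pow_mul_tsum]
  exact hasProd_one

theorem inv1_eq_of_mul_eq_one {f g : ℤ⟦X⟧} (hf : constantCoeff f = 1) (h : f * g = 1) :
    inv1 f = g := by
  have := mul_invOfUnit f 1 (by simpa using hf)
  rw [inv1]
  calc _ = (f * g) * invOfUnit f 1 := by rw [h, one_mul]
    _ = (f * invOfUnit f 1) * g := by ring
    _ = g := by rw [this, one_mul]

theorem hasProd_ramanujan :
    HasProd (fun k : ℕ => (1 - (X : ℤ⟦X⟧) ^ (5 * (k + 1))) ^ 5 * inv1 ((1 - X ^ (k + 1)) ^ 6))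
      (expand 5 (Nat.succ_ne_zero 4) (pentagonalSeries ℤ) ^ 5 *
        (mk fun n => (Nat.card (Nat.Partition n) : ℤ)) ^ 6) := by
  have h₁ := hasProd_prod fun i (_ : i ∈ Finset.range 5) =>
    hasProd_expand_pentagonalSeries (R := ℤ) 5 (Nat.succ_ne_zero 4)
  have h₂ := hasProd_prod fun i (_ : i ∈ Finset.range 6) => hasProd_card_partition
  simp only [Finset.prod_const, Finset.card_range] at h₁ h₂
  have hinv (k : ℕ) : inv1 ((1 - X ^ (k + 1)) ^ 6) = (∑' j : ℕ, (X ^ (k + 1) : ℤ⟦X⟧) ^ j) ^ 6 :=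
    inv1_eq_of_mul_eq_one (by simp) (by rw [← mul_pow, one_sub_X_pow_mul_tsum, one_pow])
  simp only [hinv, pow_mul]
  exact h₁.mul h₂

theorem quinsection_four_card_partition :
    quinsection 4 (mk fun n => (Nat.card (Nat.Partition n) : ℤ)) =
      5 * (expand 5 (Nat.succ_ne_zero 4) (pentagonalSeries ℤ) ^ 5 *
        (mk fun n => (Nat.card (Nat.Partition n) : ℤ)) ^ 6) := by
  have hPE := pentagonalSeries_mul_card_partition
  generalize (mk fun n => (Nat.card (Nat.Partition n) : ℤ)) = P at hPE ⊢
  have hN := quintic_form_mul_expand_pentagonalSeries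
  have hE := pentagonalSeries_eq_dissection
  have hq := quinsection_quadratic_relation
  have hβ := quinsection_one_pentagonalSeries
  generalize quinsection 0 (pentagonalSeries ℤ) = α at *
  generalize quinsection 1 (pentagonalSeries ℤ) = β at *
  generalize quinsection 2 (pentagonalSeries ℤ) = γ at *
  generalize pentagonalSeries ℤ = E at *
  have hq' := congrArg (expand 5 (Nat.succ_ne_zero 4)) hq
  simp only [map_add, map_mul, map_pow, map_zero] at hq'
  have hfac := quintic_norm_factor (a := expand 5 (Nat.succ_ne_zero 4) α)
    (b := X * expand 5 (Nat.succ_ne_zero 4) β) (c := X ^ 2 * expand 5 (Nat.succ_ne_zero 4) γ)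
    (by linear_combination X ^ 2 * hq')
  rw [← hE] at hfac
  rw [← hfac] at hN
  have hkey : P * expand 5 (Nat.succ_ne_zero 4) (E ^ 6) =
      (∑ s ∈ Finset.range 5, X ^ s * expand 5 (Nat.succ_ne_zero 4)
        (([α ^ 4 - 3 * X * β ^ 3 * γ, 2 * X * β ^ 2 * γ ^ 2 - α ^ 3 * β,
          2 * α ^ 2 * β ^ 2 - X * β * γ ^ 3, X * γ ^ 4 - 3 * α * β ^ 3, 5 * β ^ 4] : List ℤ⟦X⟧).getD
            s 0)) *
      expand 5 (Nat.succ_ne_zero 4) (expand 5 (Nat.succ_ne_zero 4) E) := by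
    rw [map_pow, hN]
    simp only [Finset.sum_range_succ, Finset.sum_range_zero, List.getD_cons_zero,
      List.getD_cons_succ, map_sub, map_mul, map_pow, map_ofNat, expand_X]
    generalize expand 5 (Nat.succ_ne_zero 4) (expand 5 (Nat.succ_ne_zero 4) E) = F
    linear_combination (((expand 5 (Nat.succ_ne_zero 4) α) ^ 4 -
      3 * (X * expand 5 (Nat.succ_ne_zero 4) β) ^ 3 * (X ^ 2 * expand 5 (Nat.succ_ne_zero 4) γ) +
      (2 * (X * expand 5 (Nat.succ_ne_zero 4) β) ^ 2 * (X ^ 2 * expand 5 (Nat.succ_ne_zero 4) γ) ^ 2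
        - (expand 5 (Nat.succ_ne_zero 4) α) ^ 3 * (X * expand 5 (Nat.succ_ne_zero 4) β)) +
      (2 * (expand 5 (Nat.succ_ne_zero 4) α) ^ 2 * (X * expand 5 (Nat.succ_ne_zero 4) β) ^ 2 -
        (X * expand 5 (Nat.succ_ne_zero 4) β) * (X ^ 2 * expand 5 (Nat.succ_ne_zero 4) γ) ^ 3) +
      ((X ^ 2 * expand 5 (Nat.succ_ne_zero 4) γ) ^ 4 -
        3 * (expand 5 (Nat.succ_ne_zero 4) α) * (X * expand 5 (Nat.succ_ne_zero 4) β) ^ 3) +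
      5 * (X * expand 5 (Nat.succ_ne_zero 4) β) ^ 4) * F) * hPE
  have h := congrArg (quinsection 4) hkey
  rw [quinsection_mul_expand (by norm_num), quinsection_mul_expand (by norm_num),
    quinsection_sum_X_pow_mul_expand (by norm_num)] at h
  simp only [List.getD_cons_zero, List.getD_cons_succ, hβ] at h
  have hPE6 : E ^ 6 * P ^ 6 = 1 := by rw [← mul_pow, hPE, one_pow]
  linear_combination P ^ 6 * h - quinsection 4 P * hPE6

end Partitions

end PowerSeries

/-- **Ramanujan's "most beautiful" formula**: in `ℤ⟦X⟧`,
`∑_{n=0}^∞ p(5n+4) Xⁿ = 5 · ∏_{k=1}^∞ (1 − X^{5k})⁵ · ((1 − X^k)⁶)⁻¹`. -/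
theorem ramanujan_most_beautiful :
    ∃ S : PowerSeries ℤ,
      Tendsto (fun N : ℕ => ∏ k ∈ Finset.range N,
          ((1 - (X : PowerSeries ℤ) ^ (5 * (k + 1))) ^ 5 *
            inv1 ((1 - (X : PowerSeries ℤ) ^ (k + 1)) ^ 6)))
        atTop (nhds S) ∧
      PowerSeries.mk (fun n => (Nat.card (Nat.Partition (5 * n + 4)) : ℤ)) = 5 * S := by
  refine ⟨_, hasProd_ramanujan.tendsto_prod_nat, ?_⟩
  rw [← quinsection_four_card_partition]
  ext n
  simp [quinsection]
end
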